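/- arXiv:math-ph/0703028 — 3 statements merged into one kernel-verified Lean document; each statement's English description precedes it below -/
import Mathlib

section
/- Let 0 < a < b be real numbers and q(z) = (z²−a²)(z²−b²). For every sequence (λ_n) of positive reals with λ_n → ∞ such that each λ_n is an eigenvalue of q with eigenfunction y_n, and for every continuous compactly supported φ : ℂ → ℝ, the normalized zero sums converge: (1/λ_n) Σ_{z ∈ ℂ, y_n(z)=0} φ(z) → (1/π) [ ∫_a^b φ(x) √((x²−a²)(b²−x²)) dx + ∫_{−b}^{−a} φ(x) √((x²−a²)(b²−x²)) dx + ∫_{−∞}^{∞} φ(iy) √((y²+a²)(y²+b²)) dy ]. (Equivalently, the zero-counting measures Z_{λ_n,y_n} converge weak* to the measure (1/π)|√(q(z))| |dγ| on γ = (a,b) ∪ (−b,−a) ∪ iℝ.) -/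
open MeasureTheory Filter Topology

/-- The normalized sum of `φ` over the zeros of `y` (a genuinely finite sum when the
zero set of `y` is discrete and `φ` has compact support). -/
noncomputable def zeroSum (y : ℂ → ℂ) (φ : ℂ → ℝ) : ℝ :=
  ∑' z : {z : ℂ // y z = 0}, φ (z : ℂ)

/-- `lam` is an eigenvalue of the potential `q` with eigenfunction `y`:
`y` is entire, not identically zero, solves `y'' = lam² q y` on `ℂ`, and is
square-integrable on the real line. -/
def IsEigen (q : ℂ → ℂ) (lam : ℝ) (y : ℂ → ℂ) : Prop :=
  0 < lam ∧ Differentiable ℂ y ∧ (∃ z, y z ≠ 0) ∧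
    (∀ z : ℂ, deriv (deriv y) z = (lam : ℂ) ^ 2 * q z * y z) ∧
    Integrable (fun x : ℝ => ‖y (x : ℂ)‖ ^ 2)

/-! ### Real-variable monotonicity -/

lemma anti_weak (f f' : ℝ → ℝ) (T : ℝ) (hT : 0 ≤ T)
    (hd : ∀ t ∈ Set.Icc 0 T, HasDerivAt f (f' t) t)
    (hle : ∀ t ∈ Set.Icc 0 T, f' t ≤ 0) : f T ≤ f 0 := by
  have h := antitoneOn_of_hasDerivWithinAt_nonpos (convex_Icc 0 T) (f := f) (f' := f')
    (fun t ht => (hd t ht).continuousAt.continuousWithinAt)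
    (fun t ht => (hd t (interior_subset ht)).hasDerivWithinAt)
    (fun t ht => hle t (interior_subset ht))
  exact h (Set.left_mem_Icc.2 hT) (Set.right_mem_Icc.2 hT) hT

lemma anti_strict (f f' : ℝ → ℝ) (T : ℝ) (hT : 0 < T)
    (hd : ∀ t ∈ Set.Icc 0 T, HasDerivAt f (f' t) t)
    (hle : ∀ t ∈ Set.Icc 0 T, f' t ≤ 0) (τ : ℝ) (hτ : τ ∈ Set.Icc 0 T) (hneg : f' τ < 0) :
    f T < f 0 := by
  have h := antitoneOn_of_hasDerivWithinAt_nonpos (convex_Icc 0 T) (f := f) (f' := f')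
    (fun t ht => (hd t ht).continuousAt.continuousWithinAt)
    (fun t ht => (hd t (interior_subset ht)).hasDerivWithinAt)
    (fun t ht => hle t (interior_subset ht))
  by_contra hcon
  push Not at hcon
  have hconst : ∀ t ∈ Set.Icc 0 T, f t = f 0 := by
    intro t ht
    have h1 := h (Set.left_mem_Icc.2 hT.le) ht ht.1
    have h2 := h ht (Set.right_mem_Icc.2 hT.le) ht.2
    linarith
  have e1 : HasDerivWithinAt f (f' τ) (Set.Icc 0 T) τ := (hd τ hτ).hasDerivWithinAt
  have e2 : HasDerivWithinAt f 0 (Set.Icc 0 T) τ :=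
    (hasDerivWithinAt_const τ (Set.Icc 0 T) (f 0)).congr hconst (hconst τ hτ)
  have := (uniqueDiffOn_Icc hT τ hτ).eq_deriv _ e1 e2
  linarith

/-! ### Solutions of the complex equation -/

/-- Entire solutions of `y'' = L² q y`. -/
def Sol (q : ℂ → ℂ) (L : ℝ) (y : ℂ → ℂ) : Prop :=
  Differentiable ℂ y ∧ ∀ z : ℂ, deriv (deriv y) z = (L : ℂ) ^ 2 * q z * y z

lemma Sol.hd {q : ℂ → ℂ} {L : ℝ} {y : ℂ → ℂ} (h : Sol q L y) (z : ℂ) :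
    HasDerivAt y (deriv y z) z := (h.1 z).hasDerivAt

lemma Sol.hd' {q : ℂ → ℂ} {L : ℝ} {y : ℂ → ℂ} (h : Sol q L y) (z : ℂ) :
    HasDerivAt (deriv y) ((L : ℂ) ^ 2 * q z * y z) z := by
  rw [← h.2 z]
  exact ((h.1.contDiff (n := 2)).differentiable_deriv_two z).hasDerivAt

lemma line_deriv (z d : ℂ) (t : ℝ) : HasDerivAt (fun t : ℝ => z + (t : ℂ) * d) d t := by
  simpa using ((Complex.ofRealCLM.hasDerivAt (x := t)).mul_const d).const_add z

lemma Sol.line {q : ℂ → ℂ} {L : ℝ} {y : ℂ → ℂ} (h : Sol q L y) (z d : ℂ) (t : ℝ) :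
    HasDerivAt (fun t : ℝ => y (z + (t : ℂ) * d)) (deriv y (z + (t : ℂ) * d) * d) t :=
  (h.hd (z + (t : ℂ) * d)).comp t (line_deriv z d t)

lemma Sol.line' {q : ℂ → ℂ} {L : ℝ} {y : ℂ → ℂ} (h : Sol q L y) (z d : ℂ) (t : ℝ) :
    HasDerivAt (fun t : ℝ => deriv y (z + (t : ℂ) * d))
      ((L : ℂ) ^ 2 * q (z + (t : ℂ) * d) * y (z + (t : ℂ) * d) * d) t :=
  HasDerivAt.comp (h₂ := deriv y) t (h.hd' (z + (t : ℂ) * d)) (line_deriv z d t)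

/-- The imaginary part of c times conj y times the derivative of y. -/
noncomputable def G (y : ℂ → ℂ) (c w : ℂ) : ℝ := (c * (star (y w) * deriv y w)).im

/-- Derivative of `G` along a direction `d`. -/
noncomputable def G' (q : ℂ → ℂ) (L : ℝ) (y : ℂ → ℂ) (c d w : ℂ) : ℝ :=
  L ^ 2 * (c * q w * d).im * Complex.normSq (y w) + (c * star d).im * Complex.normSq (deriv y w)

lemma Sol.G_deriv {q : ℂ → ℂ} {L : ℝ} {y : ℂ → ℂ} (h : Sol q L y) (c z d : ℂ) (t : ℝ) :
    HasDerivAt (fun t : ℝ => G y c (z + (t : ℂ) * d)) (G' q L y c d (z + (t : ℂ) * d)) t := by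
  have h1 := ((h.line z d t).star.mul (h.line' z d t)).const_mul c
  have h2 := Complex.imCLM.hasFDerivAt.comp_hasDerivAt t h1
  refine (h2.congr_deriv ?_)
  simp only [G', Complex.imCLM_apply, star_mul]
  generalize z + (t : ℂ) * d = w
  simp only [Complex.normSq_apply, Complex.star_def, Complex.mul_im, Complex.mul_re, Complex.add_re,
    Complex.add_im, Complex.conj_re, Complex.conj_im, pow_two, Complex.ofReal_re, Complex.ofReal_im]
  ring

lemma Sol.G_anti {q : ℂ → ℂ} {L : ℝ} {y : ℂ → ℂ} (h : Sol q L y) (c z d : ℂ) (T : ℝ) (hT : 0 ≤ T)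
    (h1 : ∀ t : ℝ, 0 ≤ t → t ≤ T → (c * q (z + (t : ℂ) * d) * d).im ≤ 0)
    (h2 : (c * star d).im ≤ 0) : G y c (z + (T : ℂ) * d) ≤ G y c z := by
  have := anti_weak (fun t : ℝ => G y c (z + (t : ℂ) * d))
    (fun t : ℝ => G' q L y c d (z + (t : ℂ) * d)) T hT (fun t _ => h.G_deriv c z d t) (by
      intro t ht
      have e1 := h1 t ht.1 ht.2
      have e2 : L ^ 2 * (c * q (z + (t : ℂ) * d) * d).im ≤ 0 :=
        mul_nonpos_of_nonneg_of_nonpos (sq_nonneg _) e1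
      exact add_nonpos (mul_nonpos_of_nonpos_of_nonneg e2 (Complex.normSq_nonneg _))
        (mul_nonpos_of_nonpos_of_nonneg h2 (Complex.normSq_nonneg _)))
  simpa using this

lemma Sol.G_anti_strict {q : ℂ → ℂ} {L : ℝ} {y : ℂ → ℂ} (h : Sol q L y) (c z d : ℂ) (T : ℝ)
    (hT : 0 < T)
    (h1 : ∀ t : ℝ, 0 ≤ t → t ≤ T → (c * q (z + (t : ℂ) * d) * d).im ≤ 0)
    (h2 : (c * star d).im ≤ 0) (τ : ℝ) (hτ0 : 0 ≤ τ) (hτT : τ ≤ T)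
    (hneg : G' q L y c d (z + (τ : ℂ) * d) < 0) : G y c (z + (T : ℂ) * d) < G y c z := by
  have := anti_strict (fun t : ℝ => G y c (z + (t : ℂ) * d))
    (fun t : ℝ => G' q L y c d (z + (t : ℂ) * d)) T hT (fun t _ => h.G_deriv c z d t) (by
      intro t ht
      have e1 := h1 t ht.1 ht.2
      have e2 : L ^ 2 * (c * q (z + (t : ℂ) * d) * d).im ≤ 0 :=
        mul_nonpos_of_nonneg_of_nonpos (sq_nonneg _) e1
      exact add_nonpos (mul_nonpos_of_nonpos_of_nonneg e2 (Complex.normSq_nonneg _))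
        (mul_nonpos_of_nonpos_of_nonneg h2 (Complex.normSq_nonneg _))) τ ⟨hτ0, hτT⟩ hneg
  simpa using this

/-- Uniqueness for the initial value problem. -/
lemma Sol.unique {q : ℂ → ℂ} {L : ℝ} {y : ℂ → ℂ} (h : Sol q L y) (hq : Continuous q)
    (z0 : ℂ) (h0 : y z0 = 0) (h0' : deriv y z0 = 0) (z : ℂ) : y z = 0 := by
  set d := z - z0 with hd
  have hcont : Continuous (fun t : ℝ => ‖(L : ℂ) ^ 2 * q (z0 + (t : ℂ) * d) * d‖) := by fun_prop
  obtain ⟨K, hK⟩ := (isCompact_Icc (a := (0:ℝ)) (b := 1)).exists_bound_of_continuousOn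
    hcont.continuousOn
  set F : ℝ → ℂ × ℂ := fun t => (y (z0 + (t : ℂ) * d), deriv y (z0 + (t : ℂ) * d)) with hF
  have hFd : ∀ t : ℝ, HasDerivAt F (deriv y (z0 + (t : ℂ) * d) * d,
      (L : ℂ) ^ 2 * q (z0 + (t : ℂ) * d) * y (z0 + (t : ℂ) * d) * d) t := fun t =>
    (h.line z0 d t).prodMk (h.line' z0 d t)
  have key := norm_le_gronwallBound_of_norm_deriv_right_le (f := F)
    (f' := fun t => (deriv y (z0 + (t : ℂ) * d) * d,
      (L : ℂ) ^ 2 * q (z0 + (t : ℂ) * d) * y (z0 + (t : ℂ) * d) * d))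
    (δ := 0) (K := max K ‖d‖) (ε := 0) (a := 0) (b := 1)
    (fun t _ => (hFd t).continuousAt.continuousWithinAt)
    (fun t _ => (hFd t).hasDerivWithinAt) (by simp [hF, h0, h0']) (by
      intro t ht
      have e1 := hK t ⟨ht.1, ht.2.le⟩
      rw [norm_norm] at e1
      rw [add_zero, Prod.norm_def]
      apply max_le
      · rw [norm_mul, mul_comm]
        exact mul_le_mul (le_max_right _ _) (le_max_right _ _) (norm_nonneg _)
          (le_trans (norm_nonneg d) (le_max_right _ _))
      · have : (L : ℂ) ^ 2 * q (z0 + (t : ℂ) * d) * y (z0 + (t : ℂ) * d) * d =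
          ((L : ℂ) ^ 2 * q (z0 + (t : ℂ) * d) * d) * y (z0 + (t : ℂ) * d) := by ring
        simp only [this]
        rw [norm_mul]
        exact mul_le_mul (e1.trans (le_max_left _ _)) (le_max_left _ _) (norm_nonneg _)
          (le_trans (norm_nonneg d) (le_max_right _ _))) 1 ⟨zero_le_one, le_rfl⟩
  rw [gronwallBound_ε0_δ0] at key
  have h1 : F 1 = 0 := norm_le_zero_iff.1 key
  have h2 := congrArg Prod.fst h1
  simpa [hF, hd] using h2

lemma intervalMono_zero (f : ℝ → ℝ) (x0 : ℝ) (hm : MonotoneOn f (Set.Ici x0))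
    (h0 : ∀ x, 0 ≤ f x) (hi : Integrable f) : ∀ x ≥ x0, f x = 0 := by
  intro x hx
  by_contra hne
  have hpos : 0 < f x := lt_of_le_of_ne (h0 x) (Ne.symm hne)
  have : IntegrableOn (fun _ : ℝ => f x) (Set.Ioi x) := by
    refine Integrable.mono' hi.integrableOn aestronglyMeasurable_const ?_
    refine (ae_restrict_mem measurableSet_Ioi).mono ?_
    intro t ht
    rw [Real.norm_of_nonneg hpos.le]
    exact hm hx (le_trans hx (le_of_lt ht)) (le_of_lt ht)
  rw [integrableOn_const_iff] at this
  simp [hne] at this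

/-- A solution that is square integrable with `Re (conj y y') ≥ 0` at some `x1 ≥ b` is zero. -/
lemma Sol.zero_of_L2 {q : ℂ → ℂ} {L : ℝ} {y : ℂ → ℂ} (h : Sol q L y) (hq : Continuous q) (b : ℝ)
    (hpos : ∀ x : ℝ, b ≤ x → 0 ≤ (q x).re) (hL2 : Integrable (fun x : ℝ => ‖y (x : ℂ)‖ ^ 2))
    (x1 : ℝ) (hx1 : b ≤ x1) (h1 : 0 ≤ (star (y x1) * deriv y x1).re) (z : ℂ) : y z = 0 := by
  have hnn : ∀ x : ℝ, x1 ≤ x → 0 ≤ (star (y x) * deriv y x).re := by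
    intro x hx
    have := h.G_anti (-Complex.I) x1 1 (x - x1) (by linarith) (by
      intro t ht _
      have := hpos (x1 + t) (by linarith)
      simpa using this) (by simp)
    simp only [G] at this
    push_cast at this
    rw [mul_one, add_sub_cancel] at this
    simp only [Complex.mul_im, Complex.neg_re, Complex.I_re, Complex.neg_im, Complex.I_im] at this
    linarith
  have hder : ∀ x : ℝ, HasDerivAt (fun x : ℝ => ‖y (x : ℂ)‖ ^ 2)
      (2 * (star (y x) * deriv y x).re) x := by
    intro x
    have e := (h.line 0 1 x)
    simp only [zero_add, mul_one] at e
    have := e.norm_sq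
    refine this.congr_deriv ?_
    rw [Complex.inner]; simp; ring
  have hmono : MonotoneOn (fun x : ℝ => ‖y (x : ℂ)‖ ^ 2) (Set.Ici x1) := by
    refine monotoneOn_of_hasDerivWithinAt_nonneg (convex_Ici x1)
      (fun t _ => (hder t).continuousAt.continuousWithinAt)
      (fun t _ => (hder t).hasDerivWithinAt) ?_
    intro t ht
    have := hnn t (interior_subset ht)
    linarith
  have hz := intervalMono_zero _ x1 hmono (fun _ => by positivity) hL2
  have hz' : ∀ x : ℝ, x1 ≤ x → y x = 0 := by
    intro x hx; simpa using hz x hx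
  refine h.unique hq ((x1 + 1 : ℝ) : ℂ) (hz' _ (by linarith)) ?_ z
  have e := (h.line 0 1 (x1 + 1))
  simp only [zero_add, mul_one] at e
  have e2 : HasDerivAt (fun t : ℝ => y (t : ℂ)) 0 (x1 + 1) := by
    refine (hasDerivAt_const (x1 + 1) (0 : ℂ)).congr_of_eventuallyEq ?_
    filter_upwards [lt_mem_nhds (show x1 < x1 + 1 by linarith)] with t ht
    exact hz' t ht.le
  exact e.unique e2

lemma Sol.comb {q : ℂ → ℂ} {L : ℝ} {y w : ℂ → ℂ} (h : Sol q L y) (h' : Sol q L w) (α β : ℂ) :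
    Sol q L (fun z => α * y z + β * w z) := by
  have hd1 : deriv (fun z => α * y z + β * w z) = fun z => α * deriv y z + β * deriv w z :=
    funext fun z => (((h.hd z).const_mul α).add ((h'.hd z).const_mul β)).deriv
  refine ⟨(h.1.const_mul α).add (h'.1.const_mul β), fun z => ?_⟩
  rw [hd1]
  refine (((h.hd' z).const_mul α).add ((h'.hd' z).const_mul β)).deriv.trans ?_
  ring

lemma Sol.neg {q : ℂ → ℂ} {L : ℝ} {y : ℂ → ℂ} (h : Sol q L y) (hq : ∀ z, q (-z) = q z) :
    Sol q L (fun z => y (-z)) := by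
  have hd1 : deriv (fun z => y (-z)) = fun z => - deriv y (-z) :=
    funext fun z => deriv_comp_neg y z
  refine ⟨h.1.comp differentiable_neg, fun z => ?_⟩
  have := deriv_comp_neg (deriv y) z
  rw [hd1, deriv.fun_neg, this, h.2, hq]
  ring

lemma Sol.conj {q : ℂ → ℂ} {L : ℝ} {y : ℂ → ℂ} (h : Sol q L y)
    (hq : ∀ z, q (star z) = star (q z)) : Sol q L (fun z => star (y (star z))) := by
  have hd : ∀ z, HasDerivAt (fun z => star (y (star z))) (star (deriv y (star z))) z := by
    intro z
    have h1 := (h.hd (star z)).conj_conj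
    simp only [← Complex.star_def, star_star] at h1
    exact h1
  have hd' : ∀ z, HasDerivAt (fun z => star (deriv y (star z)))
      (star ((L : ℂ) ^ 2 * q (star z) * y (star z))) z := by
    intro z
    have h1 := (h.hd' (star z)).conj_conj
    simp only [← Complex.star_def, star_star] at h1
    exact h1
  have hd1 : deriv (fun z => star (y (star z))) = fun z => star (deriv y (star z)) :=
    funext fun z => (hd z).deriv
  refine ⟨fun z => (hd z).differentiableAt, fun z => ?_⟩
  rw [hd1, (hd' z).deriv, hq]
  simp

lemma L2_comb (y w : ℂ → ℂ) (hyc : Continuous y) (hwc : Continuous w)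
    (hy : Integrable (fun x : ℝ => ‖y (x : ℂ)‖ ^ 2))
    (hw : Integrable (fun x : ℝ => ‖w (x : ℂ)‖ ^ 2)) (α β : ℂ) :
    Integrable (fun x : ℝ => ‖α * y (x : ℂ) + β * w (x : ℂ)‖ ^ 2) := by
  refine Integrable.mono' ((hy.const_mul (2 * ‖α‖ ^ 2)).add (hw.const_mul (2 * ‖β‖ ^ 2))) ?_ ?_
  · exact Continuous.aestronglyMeasurable (by fun_prop)
  · refine Eventually.of_forall fun x => ?_
    simp only [Pi.add_apply]
    rw [Real.norm_of_nonneg (by positivity)]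
    have h1 := norm_add_le (α * y (x : ℂ)) (β * w (x : ℂ))
    rw [norm_mul, norm_mul] at h1
    have h2 := norm_nonneg (α * y (x : ℂ) + β * w (x : ℂ))
    nlinarith [sq_nonneg (‖α‖ * ‖y x‖ - ‖β‖ * ‖w x‖)]

/-- Normalised eigenfunctions: real on the real axis, even or odd. -/
structure Good (q : ℂ → ℂ) (b L : ℝ) (y : ℂ → ℂ) : Prop where
  sol : Sol q L y
  conj : ∀ z, star (y (star z)) = y z
  par : (∀ z, y (-z) = y z) ∨ (∀ z, y (-z) = - y z)
  simple : ∀ z, y z = 0 → deriv y z ≠ 0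
  neg : ∀ x : ℝ, b ≤ x → (star (y x) * deriv y x).re < 0

lemma exists_good (q : ℂ → ℂ) (L b : ℝ) (y : ℂ → ℂ) (hqc : Continuous q)
    (hqe : ∀ z, q (-z) = q z) (hqs : ∀ z, q (star z) = star (q z))
    (hpos : ∀ x : ℝ, b ≤ x → 0 ≤ (q x).re)
    (hs : Sol q L y) (hne : ∃ z, y z ≠ 0) (hL2 : Integrable (fun x : ℝ => ‖y (x : ℂ)‖ ^ 2)) :
    ∃ Y : ℂ → ℂ, Good q b L Y ∧ ∀ z, Y z = 0 ↔ y z = 0 := by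
  have key : ∀ w : ℂ → ℂ, Sol q L w → Integrable (fun x : ℝ => ‖w (x : ℂ)‖ ^ 2) →
      w b = 0 → ∀ z, w z = 0 := fun w hw hw2 hwb z =>
    hw.zero_of_L2 hqc b hpos hw2 b le_rfl (by simp [hwb]) z
  have hyb : y b ≠ 0 := fun h0 => by
    obtain ⟨z, hz⟩ := hne
    exact hz (key y hs hL2 h0 z)
  set Y : ℂ → ℂ := fun z => (y b)⁻¹ * y z + 0 * y z with hY
  have hYs : Sol q L Y := hs.comb hs _ _
  have hY2 : Integrable (fun x : ℝ => ‖Y (x : ℂ)‖ ^ 2) :=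
    L2_comb y y hs.1.continuous hs.1.continuous hL2 hL2 _ _
  have hYz : ∀ z, Y z = 0 ↔ y z = 0 := by intro z; simp [hY, hyb]
  have hYb : Y b = 1 := by simp [hY, hyb]
  have hYne : ¬ ∀ z, Y z = 0 := fun h => one_ne_zero (hYb.symm.trans (h b))
  have hconj : ∀ z, star (Y (star z)) = Y z := by
    intro z
    have := key _ ((hYs.conj hqs).comb hYs 1 (-1))
      (L2_comb (fun z => star (Y (star z))) Y (hYs.conj hqs).1.continuous hYs.1.continuous
        (by simpa using hY2) hY2 1 (-1)) (by simp [hYb]) z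
    simp only [one_mul, neg_mul] at this
    exact add_neg_eq_zero.1 this
  have hneg : ∀ z, Y (-z) = Y (-b) * Y z := by
    intro z
    have := key _ ((hYs.neg hqe).comb hYs 1 (-Y (-b)))
      (L2_comb (fun z => Y (-z)) Y (hYs.neg hqe).1.continuous hYs.1.continuous
        (by simpa using hY2.comp_neg) hY2 1 (-Y (-b))) (by simp [hYb]) z
    simp only [one_mul, neg_mul] at this
    exact add_neg_eq_zero.1 this
  have hk : Y (-b) = 1 ∨ Y (-b) = -1 := by
    have := hneg (-b)
    rw [neg_neg, hYb] at this
    exact mul_self_eq_one_iff.1 this.symm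
  refine ⟨Y, ⟨hYs, hconj, ?_, ?_, ?_⟩, hYz⟩
  · rcases hk with hk | hk
    · left; intro z; rw [hneg, hk, one_mul]
    · right; intro z; rw [hneg, hk]; ring
  · intro z h0 h0'
    exact hYne (hYs.unique hqc z h0 h0')
  · intro x hx
    by_contra hcon
    push Not at hcon
    exact hYne (hYs.zero_of_L2 hqc b hpos hY2 x hx hcon)

lemma Good.conj' {q : ℂ → ℂ} {b L : ℝ} {y : ℂ → ℂ} (h : Good q b L y) (z : ℂ) :
    star (deriv y (star z)) = deriv y z := by
  have h1 := (h.sol.hd (star z)).conj_conj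
  simp only [← Complex.star_def, star_star] at h1
  have h2 : (⇑(starRingEnd ℂ) ∘ y ∘ ⇑(starRingEnd ℂ)) = y := funext fun z => h.conj z
  have h3 : HasDerivAt y (star (deriv y (star z))) z := by
    have := (h.sol.hd (star z)).conj_conj
    rw [h2] at this
    simpa using this
  exact h3.unique (h.sol.hd z)

lemma Good.real {q : ℂ → ℂ} {b L : ℝ} {y : ℂ → ℂ} (h : Good q b L y) (x : ℝ) :
    (y x).im = 0 ∧ (deriv y x).im = 0 := by
  have h1 := h.conj x
  have h2 := h.conj' x
  have e : star (x : ℂ) = x := Complex.conj_ofReal x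
  rw [e] at h1 h2
  exact ⟨Complex.conj_eq_iff_im.1 h1, Complex.conj_eq_iff_im.1 h2⟩

lemma Good.G_real {q : ℂ → ℂ} {b L : ℝ} {y : ℂ → ℂ} (h : Good q b L y) (c : ℂ) (x : ℝ) :
    G y c x = c.im * (star (y x) * deriv y x).re := by
  obtain ⟨h1, h2⟩ := h.real x
  simp [G, h1, h2]

lemma Good.imag {q : ℂ → ℂ} {b L : ℝ} {y : ℂ → ℂ} (h : Good q b L y) (t : ℝ) :
    ((∀ t : ℝ, (y (t * Complex.I)).im = 0) ∧ (deriv y (t * Complex.I)).re = 0) ∨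
    ((∀ t : ℝ, (y (t * Complex.I)).re = 0) ∧ (deriv y (t * Complex.I)).im = 0) := by
  have e : ∀ t : ℝ, star ((t : ℂ) * Complex.I) = -((t : ℂ) * Complex.I) := by intro t; simp
  rcases h.par with hp | hp
  · left
    have hp' : deriv y (-(t * Complex.I)) = - deriv y (t * Complex.I) := by
      have := deriv_comp_neg y (t * Complex.I)
      simp only [hp] at this
      rw [this, neg_neg]
    refine ⟨fun t => ?_, ?_⟩
    · have h1 := h.conj (t * Complex.I)
      rw [e, hp] at h1
      exact Complex.conj_eq_iff_im.1 h1
    · have h1 := congrArg Complex.re (h.conj' (t * Complex.I))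
      rw [e, hp'] at h1
      simp only [Complex.star_def, Complex.conj_re, Complex.neg_re] at h1
      linarith
  · right
    have hp' : deriv y (-(t * Complex.I)) = deriv y (t * Complex.I) := by
      have := deriv_comp_neg y (t * Complex.I)
      simp only [hp] at this
      rw [deriv.fun_neg] at this
      exact (neg_injective this).symm
    refine ⟨fun t => ?_, ?_⟩
    · have h1 := congrArg Complex.re (h.conj (t * Complex.I))
      rw [e, hp] at h1
      simp only [Complex.star_def, Complex.conj_re, Complex.neg_re] at h1
      linarith
    · have h1 := h.conj' (t * Complex.I)
      rw [e, hp'] at h1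
      exact Complex.conj_eq_iff_im.1 h1

lemma Good.G_imag {q : ℂ → ℂ} {b L : ℝ} {y : ℂ → ℂ} (h : Good q b L y) (t : ℝ) :
    G y (-Complex.I) (t * Complex.I) = 0 := by
  rcases h.imag t with ⟨h1, h2⟩ | ⟨h1, h2⟩
  · have := h1 t
    simp only [G, Complex.mul_im, Complex.mul_re, Complex.neg_re, Complex.neg_im, Complex.I_re,
      Complex.I_im, Complex.star_def, Complex.conj_re, Complex.conj_im, h2, h1 t]
    ring
  · simp only [G, Complex.mul_im, Complex.mul_re, Complex.neg_re, Complex.neg_im, Complex.I_re,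
      Complex.I_im, Complex.star_def, Complex.conj_re, Complex.conj_im, h2, h1 t]
    ring

/-- Real part of the potential. -/
def qre (a b x t : ℝ) : ℝ :=
  x ^ 4 - 6 * x ^ 2 * t ^ 2 + t ^ 4 - (a ^ 2 + b ^ 2) * (x ^ 2 - t ^ 2) + a ^ 2 * b ^ 2

/-- Imaginary part of the potential. -/
def qim (a b x t : ℝ) : ℝ := 2 * x * t * (2 * x ^ 2 - 2 * t ^ 2 - (a ^ 2 + b ^ 2))

lemma q_re (a b : ℝ) (q : ℂ → ℂ)
    (hq : ∀ z : ℂ, q z = (z ^ 2 - (a : ℂ) ^ 2) * (z ^ 2 - (b : ℂ) ^ 2)) (w : ℂ) :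
    (q w).re = qre a b w.re w.im := by
  rw [hq, qre]
  simp only [pow_two, Complex.mul_re, Complex.sub_re, Complex.sub_im, Complex.mul_im,
    Complex.ofReal_re, Complex.ofReal_im]
  ring

lemma q_im (a b : ℝ) (q : ℂ → ℂ)
    (hq : ∀ z : ℂ, q z = (z ^ 2 - (a : ℂ) ^ 2) * (z ^ 2 - (b : ℂ) ^ 2)) (w : ℂ) :
    (q w).im = qim a b w.re w.im := by
  rw [hq, qim]
  simp only [pow_two, Complex.mul_re, Complex.sub_re, Complex.sub_im, Complex.mul_im,
    Complex.ofReal_re, Complex.ofReal_im]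
  ring

/-- On vertical lines `qre` is convex in `t²`. -/
lemma qre_convex (a b x t0 t1 t m : ℝ) (h0 : qre a b x t0 ≤ m) (h1 : qre a b x t1 ≤ m)
    (ht0 : 0 ≤ t0) (h01 : t0 ≤ t) (ht1 : t ≤ t1) : qre a b x t ≤ m := by
  have e0 : t0 ^ 2 ≤ t ^ 2 := by nlinarith
  have e1 : t ^ 2 ≤ t1 ^ 2 := by nlinarith
  unfold qre at *
  generalize hA : t0 ^ 2 = A at *
  generalize hB : t1 ^ 2 = B at *
  generalize hC : t ^ 2 = C at *
  have hA' : t0 ^ 4 = A ^ 2 := by rw [← hA]; ring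
  have hB' : t1 ^ 4 = B ^ 2 := by rw [← hB]; ring
  have hC' : t ^ 4 = C ^ 2 := by rw [← hC]; ring
  rw [hA'] at h0; rw [hB'] at h1; rw [hC']
  rcases eq_or_lt_of_le (e0.trans e1) with h | h
  · have : C = A := by linarith
    rw [this]; exact h0
  · have hBA : 0 < B - A := by linarith
    have k0 := mul_nonneg (sub_nonneg.2 e1) (sub_nonneg.2 h0)
    have k1 := mul_nonneg (sub_nonneg.2 e0) (sub_nonneg.2 h1)
    have k2 := mul_nonneg (mul_nonneg (sub_nonneg.2 e1) (sub_nonneg.2 e0)) hBA.le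
    by_contra hcon
    push Not at hcon
    have k3 := mul_pos hBA (sub_pos.2 hcon)
    nlinarith

lemma qre_real (a b x : ℝ) : qre a b x 0 = (x ^ 2 - a ^ 2) * (x ^ 2 - b ^ 2) := by
  unfold qre; ring

lemma qre_hyp (a b x t : ℝ) (ha : 0 < a) (hab : a < b)
    (h : 2 * x ^ 2 - 2 * t ^ 2 - (a ^ 2 + b ^ 2) = 0) : qre a b x t < 0 := by
  have hb : a ^ 2 < b ^ 2 := by nlinarith
  have : x ^ 2 = t ^ 2 + (a ^ 2 + b ^ 2) / 2 := by linarith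
  have e : qre a b x t = - 4 * x ^ 2 * t ^ 2 - ((b ^ 2 - a ^ 2) / 2) ^ 2 := by
    unfold qre
    have : x ^ 4 = (x ^ 2) ^ 2 := by ring
    rw [this, ‹x ^ 2 = _›]; ring
  rw [e]
  have : 0 < ((b ^ 2 - a ^ 2) / 2) ^ 2 := by apply pow_pos; linarith
  nlinarith [mul_nonneg (sq_nonneg x) (sq_nonneg t)]

lemma qre_left (a b x0 x t : ℝ) (hx : 0 ≤ x) (hx0 : x ≤ x0)
    (hh : 2 * x0 ^ 2 - 2 * t ^ 2 - (a ^ 2 + b ^ 2) ≤ 0) (h0 : 0 ≤ qre a b x0 t) :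
    0 ≤ qre a b x t := by
  have e : x ^ 2 ≤ x0 ^ 2 := by nlinarith
  have : qre a b x t - qre a b x0 t =
    (x0 ^ 2 - x ^ 2) * (6 * t ^ 2 + (a ^ 2 + b ^ 2) - x0 ^ 2 - x ^ 2) := by unfold qre; ring
  have h2 : 0 ≤ (x0 ^ 2 - x ^ 2) * (6 * t ^ 2 + (a ^ 2 + b ^ 2) - x0 ^ 2 - x ^ 2) :=
    mul_nonneg (by linarith) (by nlinarith [sq_nonneg t])
  linarith

lemma Good.pos_left {q : ℂ → ℂ} {a b L : ℝ} {y : ℂ → ℂ} (ha : 0 < a) (hab : a < b)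
    (hq : ∀ z : ℂ, q z = (z ^ 2 - (a : ℂ) ^ 2) * (z ^ 2 - (b : ℂ) ^ 2)) (hL : 0 < L)
    (h : Good q b L y) (x : ℝ) (hx : 0 < x) (hxa : x ≤ a) :
    0 < (star (y x) * deriv y x).re := by
  have h0 : G y (-Complex.I) 0 = 0 := by simpa using h.G_imag 0
  have hneg : G' q L y (-Complex.I) 1 (0 + ((0 : ℝ) : ℂ) * 1) < 0 := by
    have hq0 : q 0 = ((a ^ 2 * b ^ 2 : ℝ) : ℂ) := by rw [hq]; push_cast; ring
    have hp : 0 < a ^ 2 * b ^ 2 := by have := ha.trans hab; positivity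
    have e : G' q L y (-Complex.I) 1 (0 + ((0 : ℝ) : ℂ) * 1) =
        - (L ^ 2 * (a ^ 2 * b ^ 2) * Complex.normSq (y 0) + Complex.normSq (deriv y 0)) := by
      simp only [G', Complex.ofReal_zero, zero_mul, add_zero, hq0, Complex.mul_im, Complex.mul_re,
        Complex.neg_re, Complex.neg_im, Complex.I_re, Complex.I_im, Complex.ofReal_re,
        Complex.ofReal_im, star_one, Complex.one_re, Complex.one_im]
      ring
    rw [e]
    have n1 := Complex.normSq_nonneg (y 0)
    have n2 := Complex.normSq_nonneg (deriv y 0)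
    by_cases hy : y 0 = 0
    · have := Complex.normSq_pos.2 (h.simple 0 hy)
      have : 0 ≤ L ^ 2 * (a ^ 2 * b ^ 2) * Complex.normSq (y 0) := by positivity
      linarith
    · have := Complex.normSq_pos.2 hy
      have : 0 < L ^ 2 * (a ^ 2 * b ^ 2) * Complex.normSq (y 0) := by positivity
      linarith
  have := h.sol.G_anti_strict (-Complex.I) 0 1 x hx (by
    intro t ht0 htx
    have e : (-Complex.I * q (0 + (t : ℂ) * 1) * 1).im = - (q (0 + (t : ℂ) * 1)).re := by simp
    rw [e, q_re a b q hq]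
    simp only [zero_add, mul_one, Complex.ofReal_re, Complex.ofReal_im]
    rw [qre_real]
    nlinarith [mul_nonneg (show 0 ≤ a ^ 2 - t ^ 2 by nlinarith)
      (show 0 ≤ b ^ 2 - t ^ 2 by nlinarith)]) (by simp) 0 le_rfl hx.le hneg
  rw [h0, zero_add, mul_one, h.G_real] at this
  simp only [Complex.neg_im, Complex.I_im] at this
  linarith

lemma G_zero (y : ℂ → ℂ) (c w : ℂ) (h : y w = 0) : G y c w = 0 := by simp [G, h]

lemma G'_zero (q : ℂ → ℂ) (L : ℝ) (y : ℂ → ℂ) (c d w : ℂ) (h : y w = 0) (h' : deriv y w ≠ 0)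
    (hc : (c * star d).im < 0) : G' q L y c d w < 0 := by
  have : 0 < Complex.normSq (deriv y w) := Complex.normSq_pos.2 h'
  simp only [G', h, Complex.normSq_zero, mul_zero, zero_add]
  exact mul_neg_of_neg_of_pos hc this

/-- No zeros in the open first quadrant. -/
lemma Good.no_quadrant {q : ℂ → ℂ} {a b L : ℝ} {y : ℂ → ℂ} (ha : 0 < a) (hab : a < b)
    (hq : ∀ z : ℂ, q z = (z ^ 2 - (a : ℂ) ^ 2) * (z ^ 2 - (b : ℂ) ^ 2)) (hL : 0 < L)
    (h : Good q b L y) (x t : ℝ) (hx : 0 < x) (ht : 0 < t) : y (x + t * Complex.I) ≠ 0 := by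
  intro h0
  have hb : 0 < b := ha.trans hab
  have hab2 : a ^ 2 < b ^ 2 := by nlinarith
  have hs := h.simple _ h0
  have qr : ∀ u v : ℝ, (q (u + v * Complex.I)).re = qre a b u v := by
    intro u v; rw [q_re a b q hq]; simp
  have qi : ∀ u v : ℝ, (q (u + v * Complex.I)).im = qim a b u v := by
    intro u v; rw [q_im a b q hq]; simp
  -- vertical descent with `c = 1`
  have vert : ¬ (∀ v : ℝ, 0 ≤ v → v ≤ t → qre a b x v ≤ 0) := by
    intro hv
    have := h.sol.G_anti_strict 1 x Complex.I t ht (by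
      intro v hv0 hvt
      have e := hv v hv0 hvt
      rw [← qr] at e
      simpa using e) (by simp) t ht.le le_rfl (G'_zero _ _ _ _ _ _ h0 hs (by simp))
    rw [G_zero _ _ _ h0, h.G_real] at this
    simp at this
  -- vertical segment, real part
  have vertRe : ∀ c : ℂ, c = Complex.I ∨ c = -Complex.I →
      (∀ v : ℝ, 0 ≤ v → v ≤ t → c.im * qim a b x v ≥ 0) →
      0 ≤ c.im * (star (y x) * deriv y x).re := by
    intro c hc hv
    have := h.sol.G_anti c x Complex.I t ht.le (by
      intro v hv0 hvt
      have e := hv v hv0 hvt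
      rw [← qi] at e
      rcases hc with rfl | rfl
      · simp at e ⊢; simpa using e
      · simp at e ⊢; simpa using e) (by rcases hc with rfl | rfl <;> simp)
    rw [G_zero _ _ _ h0, h.G_real] at this
    exact this
  -- horizontal segment to the imaginary axis
  have horiz : 2 * x ^ 2 - 2 * t ^ 2 - (a ^ 2 + b ^ 2) ≤ 0 → ¬ (0 ≤ qre a b x t) := by
    intro hh hre
    have e0 : ∀ u : ℝ, (t * Complex.I + u * 1 : ℂ) = u + t * Complex.I := by intro u; ring
    have := h.sol.G_anti_strict (-Complex.I) (t * Complex.I) 1 x hx (by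
      intro u hu0 hux
      have e := qre_left a b x u t hu0 hux hh hre
      rw [← qr] at e
      rw [e0]
      simpa using e) (by simp) x hx.le le_rfl (by
        rw [e0]; exact G'_zero _ _ _ _ _ _ h0 hs (by simp))
    rw [e0, G_zero _ _ _ h0, h.G_imag] at this
    exact lt_irrefl _ this
  rcases le_or_gt x a with hxa | hxa
  · have h1 := h.pos_left ha hab hq hL x hx hxa
    have h2 := vertRe (-Complex.I) (Or.inr rfl) (by
      intro v hv0 hvt
      simp only [Complex.neg_im, Complex.I_im, qim]
      have e1 : 2 * x ^ 2 - 2 * v ^ 2 - (a ^ 2 + b ^ 2) ≤ 0 := by nlinarith [sq_nonneg v]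
      have e2 : 0 ≤ 2 * x * v := by positivity
      nlinarith [mul_nonneg e2 (neg_nonneg.2 e1)])
    simp only [Complex.neg_im, Complex.I_im] at h2
    linarith
  have hxa2 : a ^ 2 < x ^ 2 := by nlinarith
  rcases le_or_gt x b with hxb | hxb
  · have hr0 : qre a b x 0 ≤ 0 := by
      rw [qre_real]
      nlinarith [mul_nonneg (show 0 ≤ x ^ 2 - a ^ 2 by linarith)
        (show 0 ≤ b ^ 2 - x ^ 2 by nlinarith)]
    by_cases hr : qre a b x t ≤ 0
    · exact vert fun v hv0 hvt => qre_convex a b x 0 t v 0 hr0 hr le_rfl hv0 hvt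
    · push Not at hr
      rcases le_or_gt (2 * x ^ 2 - 2 * t ^ 2 - (a ^ 2 + b ^ 2)) 0 with hh | hh
      · exact horiz hh hr.le
      · set t1 := Real.sqrt (x ^ 2 - (a ^ 2 + b ^ 2) / 2) with ht1
        have hsq : t1 ^ 2 = x ^ 2 - (a ^ 2 + b ^ 2) / 2 :=
          Real.sq_sqrt (by nlinarith [sq_nonneg t])
        have ht1' : t ≤ t1 := Real.le_sqrt_of_sq_le (by linarith)
        have e1 : qre a b x t1 < 0 := qre_hyp a b x t1 ha hab (by rw [hsq]; ring)
        have := qre_convex a b x 0 t1 t 0 hr0 e1.le le_rfl ht.le ht1'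
        linarith
  · have hxb2 : b ^ 2 < x ^ 2 := by nlinarith
    rcases le_or_gt (2 * x ^ 2 - 2 * t ^ 2 - (a ^ 2 + b ^ 2)) 0 with hh | hh
    · rcases le_or_gt 0 (qre a b x t) with hr | hr
      · exact horiz hh hr
      · -- two segments
        set t1 := Real.sqrt (x ^ 2 - (a ^ 2 + b ^ 2) / 2) with ht1
        have hsq : t1 ^ 2 = x ^ 2 - (a ^ 2 + b ^ 2) / 2 :=
          Real.sq_sqrt (by nlinarith)
        have ht1pos : 0 < t1 := Real.sqrt_pos.2 (by nlinarith)
        have ht1' : t1 ≤ t := Real.sqrt_le_iff.2 ⟨ht.le, by linarith⟩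
        have e1 : qre a b x t1 < 0 := qre_hyp a b x t1 ha hab (by rw [hsq]; ring)
        -- uniform negativity
        obtain ⟨M, hM⟩ := (isCompact_Icc (a := t1) (b := t)).exists_bound_of_continuousOn
          (f := fun v => qim a b x v) (by unfold qim; fun_prop)
        set m := max (qre a b x t1) (qre a b x t) with hm
        have hneg : m < 0 := max_lt e1 hr
        set k := - m / (|M| + 1) with hk
        have hkpos : 0 < k := div_pos (by linarith) (by positivity)
        -- c = 1 + k i, direction -1 + k i from the real axis
        have hfin := h.neg (x + t1 / k) (by have := div_pos ht1pos hkpos; linarith)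
        set c : ℂ := 1 + k * Complex.I with hc
        have s1 := h.sol.G_anti c ((x + t1 / k : ℝ) : ℂ) (-1 + k * Complex.I) (t1 / k)
          (by positivity) (by
            intro r hr0 hr1
            have e : (((x + t1 / k : ℝ) : ℂ) + (r : ℂ) * (-1 + k * Complex.I)) =
              ((x + t1 / k - r : ℝ) : ℂ) + ((k * r : ℝ) : ℂ) * Complex.I := by
                push_cast; ring
            rw [e]
            have e2 : (c * q (((x + t1 / k - r : ℝ) : ℂ) + ((k * r : ℝ) : ℂ) * Complex.I) *
              (-1 + k * Complex.I)).im = - (1 + k ^ 2) * qim a b (x + t1 / k - r) (k * r) := by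
              rw [← qi, hc]
              simp only [Complex.mul_im, Complex.mul_re, Complex.add_re, Complex.add_im,
                Complex.neg_re, Complex.neg_im, Complex.one_re, Complex.one_im, Complex.I_re,
                Complex.I_im, Complex.ofReal_re, Complex.ofReal_im]
              ring
            rw [e2]
            have hkr : k * r ≤ t1 := by
              have := mul_le_mul_of_nonneg_left hr1 hkpos.le
              rwa [mul_div_cancel₀ _ hkpos.ne'] at this
            have hxx : x ≤ x + t1 / k - r := by linarith
            have hkr0 : 0 ≤ k * r := by positivity
            have : 0 ≤ qim a b (x + t1 / k - r) (k * r) := by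
              unfold qim
              generalize x + t1 / k - r = X at hxx ⊢
              generalize k * r = R at hkr hkr0 ⊢
              have : 0 ≤ X := by linarith
              refine mul_nonneg (by positivity) ?_
              nlinarith
            have h1k : 0 < 1 + k ^ 2 := by positivity
            nlinarith [mul_nonneg h1k.le this]) (by
            rw [hc]
            simp
            linarith)
        have e3 : (((x + t1 / k : ℝ) : ℂ) + ((t1 / k : ℝ) : ℂ) * (-1 + k * Complex.I)) =
            (x : ℂ) + (t1 : ℂ) * Complex.I := by
          have : (k : ℂ) ≠ 0 := by exact_mod_cast hkpos.ne'
          push_cast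
          field_simp
          ring
        have s2 := h.sol.G_anti c (x + t1 * Complex.I) Complex.I (t - t1) (by linarith) (by
            intro r hr0 hr1
            have e : ((x : ℂ) + t1 * Complex.I + (r : ℂ) * Complex.I) =
              (x : ℂ) + ((t1 + r : ℝ) : ℂ) * Complex.I := by push_cast; ring
            rw [e]
            have e2 : (c * q ((x : ℂ) + ((t1 + r : ℝ) : ℂ) * Complex.I) * Complex.I).im =
              qre a b x (t1 + r) - k * qim a b x (t1 + r) := by
              rw [← qi, ← qr, hc]
              simp only [Complex.mul_im, Complex.mul_re, Complex.add_re, Complex.add_im,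
                Complex.one_re, Complex.one_im, Complex.I_re,
                Complex.I_im, Complex.ofReal_re, Complex.ofReal_im]
              ring
            rw [e2]
            have hmem : t1 + r ∈ Set.Icc t1 t := ⟨by linarith, by linarith⟩
            have b1 : qre a b x (t1 + r) ≤ m :=
              qre_convex a b x t1 t (t1 + r) m (le_max_left _ _) (le_max_right _ _) ht1pos.le
                hmem.1 hmem.2
            have b2 := (abs_le.1 (hM _ hmem)).1
            have b3 : k * (|M| + 1) = - m := by
              rw [hk]; field_simp
            have b4 : M ≤ |M| := le_abs_self M
            have b5 : -(qim a b x (t1 + r)) ≤ |M| + 1 := by linarith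
            have := mul_le_mul_of_nonneg_left b5 hkpos.le
            linarith) (by rw [hc]; simp)
        have e4 : ((x : ℂ) + t1 * Complex.I + ((t - t1 : ℝ) : ℂ) * Complex.I) =
            x + t * Complex.I := by push_cast; ring
        rw [e4, G_zero _ _ _ h0] at s2
        rw [e3, h.G_real] at s1
        have hci : c.im = k := by rw [hc]; simp
        rw [hci] at s1
        have := mul_neg_of_pos_of_neg hkpos hfin
        linarith
    · have h1 := h.neg x hxb.le
      have h2 := vertRe Complex.I (Or.inl rfl) (by
        intro v hv0 hvt
        simp only [Complex.I_im, qim]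
        have e1 : 0 ≤ 2 * x ^ 2 - 2 * v ^ 2 - (a ^ 2 + b ^ 2) := by nlinarith
        have e2 : 0 ≤ 2 * x * v := by positivity
        nlinarith [mul_nonneg e2 e1])
      simp only [Complex.I_im] at h2
      linarith

/-! ### Sturm theory on the real line -/

/-- `u'' = -L² p u` with simple zeros. -/
structure Osc (p : ℝ → ℝ) (L : ℝ) (u u' : ℝ → ℝ) : Prop where
  hu : ∀ x, HasDerivAt u (u' x) x
  hu' : ∀ x, HasDerivAt u' (-(L ^ 2 * p x * u x)) x
  simple : ∀ x, u x = 0 → u' x ≠ 0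

lemma mono_strict' (f f' : ℝ → ℝ) (A B : ℝ) (hAB : A < B)
    (hd : ∀ t ∈ Set.Icc A B, HasDerivAt f (f' t) t)
    (hle : ∀ t ∈ Set.Icc A B, 0 ≤ f' t) (hneg : 0 < f' A) : f A < f B := by
  have := anti_strict (fun t => - f (A + t)) (fun t => - f' (A + t)) (B - A) (by linarith)
    (fun t ht => ((hd (A + t) ⟨by linarith [ht.1], by linarith [ht.2]⟩).comp_const_add A t).neg)
    (fun t ht => by
      have := hle (A + t) ⟨by linarith [ht.1], by linarith [ht.2]⟩
      linarith) 0 ⟨le_rfl, by linarith⟩ (by simpa using hneg)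
  simpa using this

lemma Osc.sep {p : ℝ → ℝ} {L : ℝ} {u u' : ℝ → ℝ} (h : Osc p L u u') (hL : 0 < L) (M x1 x2 : ℝ)
    (hM : 0 < M) (hx : x1 < x2) (h1 : u x1 = 0) (h2 : u x2 = 0)
    (hp : ∀ x ∈ Set.Icc x1 x2, p x ≤ M ^ 2) : Real.pi ≤ L * M * (x2 - x1) := by
  by_contra hcon
  push Not at hcon
  have hLM : 0 < L * M := mul_pos hL hM
  set ε := (Real.pi - L * M * (x2 - x1)) / 2 with hε
  have hεpos : 0 < ε := by rw [hε]; linarith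
  set θ : ℝ → ℝ := fun x => L * M * (x - x1) + ε with hθ
  have hθd : ∀ x, HasDerivAt θ (L * M) x := by
    intro x
    have := (((hasDerivAt_id x).sub_const x1).const_mul (L * M)).add_const ε
    exact this.congr_deriv (by simp)
  have hsin : ∀ x ∈ Set.Icc x1 x2, 0 < Real.sin (θ x) := by
    intro x hx'
    apply Real.sin_pos_of_pos_of_lt_pi
    · have := mul_nonneg hLM.le (sub_nonneg.2 hx'.1)
      simp only [hθ]; linarith
    · have := mul_le_mul_of_nonneg_left (sub_le_sub_right hx'.2 x1) hLM.le
      simp only [hθ]; linarith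
  have hd : ∀ x ∈ Set.Icc x1 x2, HasDerivAt
      (fun x => u x * u' x - u x ^ 2 * (L * M * Real.cos (θ x) / Real.sin (θ x)))
      ((u' x - u x * (L * M * Real.cos (θ x) / Real.sin (θ x))) ^ 2
        + L ^ 2 * (M ^ 2 - p x) * u x ^ 2) x := by
    intro x hx'
    have hs := (hsin x hx').ne'
    have d1 := (h.hu x).mul (h.hu' x)
    have d2 := (((hθd x).cos.const_mul (L * M)).div (hθd x).sin hs)
    have d3 := ((h.hu x).pow 2).mul d2
    refine (d1.sub d3).congr_deriv ?_
    have hcs := Real.sin_sq_add_cos_sq (θ x)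
    simp only [Pi.pow_apply, Pi.div_apply]
    field_simp
    push_cast
    simp only [pow_one]
    ring_nf
  have := mono_strict' _ _ x1 x2 hx hd (by
    intro x hx'
    have := hp x hx'
    have h3 : 0 ≤ L ^ 2 * (M ^ 2 - p x) * u x ^ 2 :=
      mul_nonneg (mul_nonneg (sq_nonneg _) (by linarith)) (sq_nonneg _)
    have h4 := sq_nonneg (u' x - u x * (L * M * Real.cos (θ x) / Real.sin (θ x)))
    linarith) (by
    have := h.simple x1 h1
    rw [h1]
    simp only [zero_mul, sub_zero]
    have : 0 < u' x1 ^ 2 := by positivity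
    simpa using this)
  simp [h1, h2] at this

lemma Osc.neg {p : ℝ → ℝ} {L : ℝ} {u u' : ℝ → ℝ} (h : Osc p L u u') :
    Osc p L (fun x => - u x) (fun x => - u' x) :=
  ⟨fun x => (h.hu x).neg, fun x => by
    have := (h.hu' x).neg
    exact this.congr_deriv (by ring), fun x hx => by
    have := h.simple x (by simpa using hx)
    simpa using this⟩

lemma Osc.not_pos {p : ℝ → ℝ} {L : ℝ} {u u' : ℝ → ℝ} (h : Osc p L u u') (hL : 0 < L)
    (m x1 δ : ℝ) (hm : 0 < m) (hδ : L * m * δ = Real.pi)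
    (hp : ∀ x ∈ Set.Icc x1 (x1 + δ), m ^ 2 ≤ p x)
    (hpos : ∀ x ∈ Set.Ico x1 (x1 + δ), 0 < u x) : False := by
  have hLm : 0 < L * m := mul_pos hL hm
  have hδpos : 0 < δ := by
    by_contra hc
    push Not at hc
    have := mul_nonpos_of_nonneg_of_nonpos hLm.le hc
    linarith [Real.pi_pos]
  have hend : 0 ≤ u (x1 + δ) := by
    have hc : ContinuousWithinAt u (Set.Ico x1 (x1 + δ)) (x1 + δ) :=
      (h.hu _).continuousAt.continuousWithinAt
    have hmem : x1 + δ ∈ closure (Set.Ico x1 (x1 + δ)) := by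
      rw [closure_Ico (by linarith)]
      exact ⟨by linarith, le_rfl⟩
    have := hc.mem_closure_image hmem
    have hsub : closure (u '' Set.Ico x1 (x1 + δ)) ⊆ Set.Ici 0 := by
      apply closure_minimal _ isClosed_Ici
      rintro _ ⟨x, hx, rfl⟩
      exact (hpos x hx).le
    exact hsub this
  set θ : ℝ → ℝ := fun x => L * m * (x - x1) with hθ
  have hθd : ∀ x, HasDerivAt θ (L * m) x := by
    intro x
    have := (((hasDerivAt_id x).sub_const x1).const_mul (L * m))
    simpa using this
  have hmono := monotoneOn_of_hasDerivWithinAt_nonneg (convex_Icc x1 (x1 + δ))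
    (f := fun x => u x * (L * m * Real.cos (θ x)) - u' x * Real.sin (θ x))
    (f' := fun x => L ^ 2 * (p x - m ^ 2) * u x * Real.sin (θ x))
    (by
      have : Continuous u := continuous_iff_continuousAt.2 fun x => (h.hu x).continuousAt
      have : Continuous u' := continuous_iff_continuousAt.2 fun x => (h.hu' x).continuousAt
      fun_prop)
    (fun x _ => by
      have d1 := ((h.hu x).mul ((hθd x).cos.const_mul (L * m))).sub ((h.hu' x).mul (hθd x).sin)
      refine (d1.congr_deriv ?_).hasDerivWithinAt
      ring)
    (fun x hx => by
      rw [interior_Icc] at hx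
      have h1 := hp x ⟨hx.1.le, hx.2.le⟩
      have h2 := hpos x ⟨hx.1.le, hx.2⟩
      have h3 : 0 ≤ Real.sin (θ x) := by
        apply Real.sin_nonneg_of_nonneg_of_le_pi
        · exact mul_nonneg hLm.le (by linarith [hx.1])
        · rw [← hδ]
          exact mul_le_mul_of_nonneg_left (by linarith [hx.2]) hLm.le
      have h4 : 0 ≤ p x - m ^ 2 := by linarith
      positivity)
  have := hmono (Set.left_mem_Icc.2 (by linarith)) (Set.right_mem_Icc.2 (by linarith))
    (show x1 ≤ x1 + δ by linarith)
  simp [hθ, hδ] at this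
  have h1 := mul_pos (hpos x1 ⟨le_rfl, by linarith⟩) hLm
  have h2 := mul_nonneg hend hLm.le
  linarith

lemma Osc.exists_zero {p : ℝ → ℝ} {L : ℝ} {u u' : ℝ → ℝ} (h : Osc p L u u') (hL : 0 < L)
    (m x1 δ : ℝ) (hm : 0 < m) (hδ : L * m * δ = Real.pi)
    (hp : ∀ x ∈ Set.Icc x1 (x1 + δ), m ^ 2 ≤ p x) :
    ∃ x ∈ Set.Ico x1 (x1 + δ), u x = 0 := by
  by_contra hcon
  push Not at hcon
  have hc : Continuous u := continuous_iff_continuousAt.2 fun x => (h.hu x).continuousAt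
  have hpre : IsPreconnected (Set.Ico x1 (x1 + δ)) := isPreconnected_Ico
  by_cases hex : ∃ x ∈ Set.Ico x1 (x1 + δ), 0 < u x
  · obtain ⟨x, hx, hux⟩ := hex
    refine h.not_pos hL m x1 δ hm hδ hp ?_
    intro z hz
    by_contra hle
    push Not at hle
    obtain ⟨w, hw, hw0⟩ := hpre.intermediate_value hz hx hc.continuousOn ⟨hle, hux.le⟩
    exact hcon w hw hw0
  · push Not at hex
    refine h.neg.not_pos hL m x1 δ hm hδ hp ?_
    intro z hz
    have := lt_of_le_of_ne (hex z hz) (hcon z hz)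
    linarith

lemma Osc.count_upper {p : ℝ → ℝ} {L : ℝ} {u u' : ℝ → ℝ} (h : Osc p L u u') (hL : 0 < L)
    (M x1 x2 : ℝ) (hM : 0 < M) (hx : x1 ≤ x2) (hp : ∀ x ∈ Set.Icc x1 x2, p x ≤ M ^ 2) :
    ({x | u x = 0} ∩ Set.Ico x1 x2).Finite ∧
    Real.pi * ({x | u x = 0} ∩ Set.Ico x1 x2).ncard ≤ L * M * (x2 - x1) + Real.pi := by
  have hLM : 0 < L * M := mul_pos hL hM
  set δ := Real.pi / (L * M) with hδ
  have hδpos : 0 < δ := div_pos Real.pi_pos hLM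
  have hδe : L * M * δ = Real.pi := by rw [hδ]; field_simp
  set S := {x | u x = 0} ∩ Set.Ico x1 x2 with hS
  have sepδ : ∀ s ∈ S, ∀ t ∈ S, s < t → δ ≤ t - s := by
    intro s hs t ht hst
    have := h.sep hL M s t hM hst hs.1 ht.1
      (fun x hx' => hp x ⟨hs.2.1.trans hx'.1, hx'.2.trans ht.2.2.le⟩)
    rw [hδ, div_le_iff₀ hLM]; linarith
  set f : ℝ → ℕ := fun z => ⌊(z - x1) / δ⌋₊ with hf
  have hlt : ∀ s ∈ S, ∀ t ∈ S, s < t → f s ≠ f t := by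
    intro s hs t ht hst he
    have h1 := sepδ s hs t ht hst
    have a1 := Nat.floor_le (a := (s - x1) / δ) (div_nonneg (by linarith [hs.2.1]) hδpos.le)
    have a2 := Nat.lt_floor_add_one ((t - x1) / δ)
    have he' : (⌊(s - x1) / δ⌋₊ : ℝ) = (⌊(t - x1) / δ⌋₊ : ℝ) := by exact_mod_cast he
    have a3 : (t - x1) / δ - (s - x1) / δ < 1 := by linarith
    rw [← sub_div, div_lt_one hδpos] at a3
    linarith
  have hinj : Set.InjOn f S := by
    intro s hs t ht he
    rcases lt_trichotomy s t with hlt' | heq | hgt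
    · exact absurd he (hlt s hs t ht hlt')
    · exact heq
    · exact absurd he.symm (hlt t ht s hs hgt)
  have hmaps : Set.MapsTo f S (Finset.range (⌊(x2 - x1) / δ⌋₊ + 1) : Finset ℕ) := by
    intro s hs
    simp only [Finset.coe_range, Set.mem_Iio, hf]
    apply Nat.lt_succ_of_le
    apply Nat.floor_le_floor
    gcongr
    exact hs.2.2.le
  have hfin : S.Finite := Set.Finite.of_injOn hmaps hinj (Finset.finite_toSet _)
  refine ⟨hfin, ?_⟩
  have hcard := Set.ncard_le_ncard_of_injOn f hmaps hinj (Finset.finite_toSet _)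
  rw [Set.ncard_coe_finset, Finset.card_range] at hcard
  have hfl := Nat.floor_le (a := (x2 - x1) / δ) (div_nonneg (by linarith) hδpos.le)
  have hcard' : (S.ncard : ℝ) ≤ (x2 - x1) / δ + 1 := by
    have : (S.ncard : ℝ) ≤ (⌊(x2 - x1) / δ⌋₊ : ℝ) + 1 := by exact_mod_cast hcard
    linarith
  have := mul_le_mul_of_nonneg_left hcard' Real.pi_pos.le
  have e : Real.pi * ((x2 - x1) / δ + 1) = L * M * (x2 - x1) + Real.pi := by
    rw [← hδe]; field_simp
  linarith

lemma Osc.count_lower {p : ℝ → ℝ} {L : ℝ} {u u' : ℝ → ℝ} (h : Osc p L u u') (hL : 0 < L)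
    (m x1 x2 : ℝ) (hm : 0 < m) (hx : x1 ≤ x2) (hp : ∀ x ∈ Set.Icc x1 x2, m ^ 2 ≤ p x)
    (hfin : ({x | u x = 0} ∩ Set.Ico x1 x2).Finite) :
    L * m * (x2 - x1) - Real.pi ≤ Real.pi * ({x | u x = 0} ∩ Set.Ico x1 x2).ncard := by
  have hLm : 0 < L * m := mul_pos hL hm
  set δ := Real.pi / (L * m) with hδ
  have hδpos : 0 < δ := div_pos Real.pi_pos hLm
  have hδe : L * m * δ = Real.pi := by rw [hδ]; field_simp
  set S := {x | u x = 0} ∩ Set.Ico x1 x2 with hS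
  set k := ⌊(x2 - x1) / δ⌋₊ with hk
  have hkle : (k : ℝ) * δ ≤ x2 - x1 := by
    have hfl := Nat.floor_le (a := (x2 - x1) / δ) (div_nonneg (by linarith) hδpos.le)
    rwa [le_div_iff₀ hδpos] at hfl
  have hex : ∀ j : ℕ, ∃ x, j < k → (x ∈ Set.Ico (x1 + j * δ) (x1 + j * δ + δ) ∧ x ∈ S) := by
    intro j
    by_cases hj : j < k
    · have hj' : ((j : ℝ) + 1) ≤ k := by exact_mod_cast hj
      have hj2 := mul_le_mul_of_nonneg_right hj' hδpos.le
      have hj3 : 0 ≤ (j : ℝ) * δ := by positivity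
      obtain ⟨x, hx', hux⟩ := h.exists_zero hL m (x1 + j * δ) δ hm hδe
        (fun x hx' => hp x ⟨by linarith [hx'.1], by linarith [hx'.2]⟩)
      exact ⟨x, fun _ => ⟨hx', hux, by linarith [hx'.1], by linarith [hx'.2]⟩⟩
    · exact ⟨0, fun h => absurd h hj⟩
  choose g hg using hex
  have hglt : ∀ i j : ℕ, i < j → j < k → g i < g j := by
    intro i j hij hj
    have h1 := (hg i (hij.trans hj)).1.2
    have h2 := (hg j hj).1.1
    have : ((i : ℝ) + 1) ≤ j := by exact_mod_cast hij
    have := mul_le_mul_of_nonneg_right this hδpos.le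
    linarith
  have hinj : Set.InjOn g (Finset.range k : Finset ℕ) := by
    intro i hi j hj he
    simp only [Finset.coe_range, Set.mem_Iio] at hi hj
    rcases lt_trichotomy i j with hlt' | heq | hgt
    · exact absurd he (hglt i j hlt' hj).ne
    · exact heq
    · exact absurd he (hglt j i hgt hi).ne'
  have hmaps : Set.MapsTo g (Finset.range k : Finset ℕ) S := by
    intro i hi
    simp only [Finset.coe_range, Set.mem_Iio] at hi
    exact (hg i hi).2
  have hcard := Set.ncard_le_ncard_of_injOn g hmaps hinj hfin
  rw [Set.ncard_coe_finset, Finset.card_range] at hcard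
  have hcard' : (x2 - x1) / δ - 1 ≤ S.ncard := by
    have : (k : ℝ) ≤ S.ncard := by exact_mod_cast hcard
    have := Nat.lt_floor_add_one ((x2 - x1) / δ)
    linarith
  have := mul_le_mul_of_nonneg_left hcard' Real.pi_pos.le
  have e : Real.pi * ((x2 - x1) / δ - 1) = L * m * (x2 - x1) - Real.pi := by
    rw [← hδe]; field_simp
  linarith

lemma Osc.local_error {p φ : ℝ → ℝ} {L : ℝ} {u u' : ℝ → ℝ} (h : Osc p L u u') (hL : 0 < L)
    (hpc : Continuous p) (hφc : Continuous φ)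
    (x1 x2 ε B C : ℝ) (hx : x1 ≤ x2) (hε : 0 < ε) (hε1 : ε ≤ 1)
    (hp0 : ∀ x ∈ Set.Icc x1 x2, 0 ≤ p x)
    (hB : ∀ x ∈ Set.Icc x1 x2, Real.sqrt (p x) ≤ B) (hC : ∀ x ∈ Set.Icc x1 x2, |φ x| ≤ C)
    (hφ : ∀ x ∈ Set.Icc x1 x2, |φ x - φ x1| ≤ ε)
    (hp : ∀ x ∈ Set.Icc x1 x2, |Real.sqrt (p x) - Real.sqrt (p x1)| ≤ ε) :
    |Real.pi * (∑ᶠ x ∈ {x | u x = 0} ∩ Set.Ico x1 x2, φ x)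
      - L * ∫ x in x1..x2, φ x * Real.sqrt (p x)|
      ≤ (2 * B + 1 + 2 * C) * ε * L * (x2 - x1) + Real.pi * (1 + C) := by
  have hx1 : x1 ∈ Set.Icc x1 x2 := Set.left_mem_Icc.2 hx
  set w := Real.sqrt (p x1) with hw
  have hw0 : 0 ≤ w := Real.sqrt_nonneg _
  have hwB : w ≤ B := hB x1 hx1
  have hC0 : 0 ≤ C := (abs_nonneg _).trans (hC x1 hx1)
  have hℓ : 0 ≤ x2 - x1 := by linarith
  obtain ⟨hfin, hup⟩ := h.count_upper hL (w + ε) x1 x2 (by linarith) hx (by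
    intro x hx'
    have e := (abs_le.1 (hp x hx')).2
    have e2 : Real.sqrt (p x) ≤ w + ε := by linarith
    rw [← Real.sq_sqrt (hp0 x hx')]
    exact pow_le_pow_left₀ (Real.sqrt_nonneg _) e2 2)
  set S := {x | u x = 0} ∩ Set.Ico x1 x2 with hS
  have hN0 : (0 : ℝ) ≤ S.ncard := Nat.cast_nonneg _
  have hπ := Real.pi_pos
  have hlow : L * (w - ε) * (x2 - x1) - Real.pi ≤ Real.pi * S.ncard := by
    rcases le_or_gt (w - ε) 0 with h0 | h0
    · have := mul_nonpos_of_nonpos_of_nonneg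
        (mul_nonpos_of_nonneg_of_nonpos hL.le h0) hℓ
      have := mul_nonneg hπ.le hN0
      linarith
    · refine h.count_lower hL (w - ε) x1 x2 h0 hx ?_ hfin
      intro x hx'
      have e := (abs_le.1 (hp x hx')).1
      have e2 : w - ε ≤ Real.sqrt (p x) := by linarith
      rw [← Real.sq_sqrt (hp0 x hx')]
      exact pow_le_pow_left₀ h0.le e2 2
  have hNerr : |Real.pi * S.ncard - L * w * (x2 - x1)| ≤ L * ε * (x2 - x1) + Real.pi := by
    rw [abs_le]; constructor <;> nlinarith
  -- sum versus value at the left end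
  have hsum : |(∑ᶠ x ∈ S, φ x) - S.ncard * φ x1| ≤ S.ncard * ε := by
    rw [finsum_mem_eq_finite_toFinset_sum _ hfin, Set.ncard_eq_toFinset_card S hfin,
      ← nsmul_eq_mul, ← Finset.sum_const, ← Finset.sum_sub_distrib]
    refine (Finset.abs_sum_le_sum_abs _ _).trans ?_
    rw [← nsmul_eq_mul]
    apply Finset.sum_le_card_nsmul
    intro x hx'
    have := (hfin.mem_toFinset.1 hx').2
    exact hφ x ⟨this.1, this.2.le⟩
  have hIb : |(∫ x in x1..x2, φ x * Real.sqrt (p x)) - φ x1 * w * (x2 - x1)|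
      ≤ (C + B) * ε * (x2 - x1) := by
    have e : (∫ x in x1..x2, φ x * Real.sqrt (p x)) - φ x1 * w * (x2 - x1) =
        ∫ x in x1..x2, (φ x * Real.sqrt (p x) - φ x1 * w) := by
      rw [intervalIntegral.integral_sub, intervalIntegral.integral_const, smul_eq_mul]
      · ring
      · exact Continuous.intervalIntegrable (by fun_prop) _ _
      · exact Continuous.intervalIntegrable (by fun_prop) _ _
    rw [e]
    have := intervalIntegral.norm_integral_le_of_norm_le_const (a := x1) (b := x2)
      (f := fun x => φ x * Real.sqrt (p x) - φ x1 * w) (C := (C + B) * ε) (by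
        intro x hx'
        rw [Set.uIoc_of_le hx] at hx'
        have hx'' : x ∈ Set.Icc x1 x2 := ⟨hx'.1.le, hx'.2⟩
        have e2 : φ x * Real.sqrt (p x) - φ x1 * w =
          φ x * (Real.sqrt (p x) - w) + w * (φ x - φ x1) := by ring
        rw [e2, Real.norm_eq_abs]
        refine (abs_add_le _ _).trans ?_
        rw [abs_mul, abs_mul, abs_of_nonneg hw0]
        have f1 := mul_le_mul (hC x hx'') (hp x hx'') (abs_nonneg _) hC0
        have f2 := mul_le_mul hwB (hφ x hx'') (abs_nonneg _) (hw0.trans hwB)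
        linarith)
    rw [Real.norm_eq_abs, abs_of_nonneg hℓ] at this
    exact this
  have hsplit : Real.pi * (∑ᶠ x ∈ S, φ x) - L * ∫ x in x1..x2, φ x * Real.sqrt (p x) =
      Real.pi * ((∑ᶠ x ∈ S, φ x) - S.ncard * φ x1)
      + φ x1 * (Real.pi * S.ncard - L * w * (x2 - x1))
      - L * ((∫ x in x1..x2, φ x * Real.sqrt (p x)) - φ x1 * w * (x2 - x1)) := by ring
  rw [hsplit]
  refine (abs_sub _ _).trans ?_
  have t0 := abs_add_le (Real.pi * ((∑ᶠ x ∈ S, φ x) - S.ncard * φ x1))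
    (φ x1 * (Real.pi * S.ncard - L * w * (x2 - x1)))
  rw [abs_mul, abs_mul, abs_of_pos hπ] at t0
  rw [abs_mul L, abs_of_pos hL]
  have t1 := mul_le_mul_of_nonneg_left hsum hπ.le
  have t2 := mul_le_mul (hC x1 hx1) hNerr (abs_nonneg _) hC0
  have t3 := mul_le_mul_of_nonneg_left hIb hL.le
  have t4 := mul_le_mul_of_nonneg_right hup hε.le
  have hLℓ : 0 ≤ L * (x2 - x1) := mul_nonneg hL.le hℓ
  have t5 : L * (w + ε) * (x2 - x1) * ε ≤ (B + 1) * ε * (L * (x2 - x1)) := by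
    have : (w + ε) ≤ B + 1 := by linarith
    have := mul_le_mul_of_nonneg_right this (mul_nonneg hε.le hLℓ)
    nlinarith
  have t6 : Real.pi * ε ≤ Real.pi * 1 := mul_le_mul_of_nonneg_left hε1 hπ.le
  nlinarith

lemma Osc.finite {p : ℝ → ℝ} {L : ℝ} {u u' : ℝ → ℝ} (h : Osc p L u u') (hL : 0 < L)
    (hpc : Continuous p) (c d : ℝ) : ({x | u x = 0} ∩ Set.Ico c d).Finite := by
  rcases le_or_gt c d with hcd | hcd
  · obtain ⟨K, hK⟩ := (isCompact_Icc (a := c) (b := d)).exists_bound_of_continuousOn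
      hpc.continuousOn
    refine (h.count_upper hL (|K| + 1) c d (by positivity) hcd ?_).1
    intro x hx
    have h1 := (abs_le.1 (hK x hx)).2
    have h2 := le_abs_self K
    have h3 := abs_nonneg K
    nlinarith
  · rw [Set.Ico_eq_empty (by linarith), Set.inter_empty]
    exact Set.finite_empty

lemma sturm_limit (p φ : ℝ → ℝ) (hpc : Continuous p) (hφc : Continuous φ) (c d : ℝ) (hcd : c < d)
    (hp0 : ∀ x ∈ Set.Icc c d, 0 ≤ p x) (lam : ℕ → ℝ) (hpos : ∀ n, 0 < lam n)
    (hlam : Tendsto lam atTop atTop) (u u' : ℕ → ℝ → ℝ) (h : ∀ n, Osc p (lam n) (u n) (u' n)) :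
    Tendsto (fun n => (1 / lam n) * ∑ᶠ x ∈ {x | u n x = 0} ∩ Set.Ico c d, φ x) atTop
      (𝓝 ((1 / Real.pi) * ∫ x in c..d, φ x * Real.sqrt (p x))) := by
  have hπ := Real.pi_pos
  have hsc : Continuous (fun x => Real.sqrt (p x)) := by fun_prop
  obtain ⟨B, hB⟩ := (isCompact_Icc (a := c) (b := d)).exists_bound_of_continuousOn hsc.continuousOn
  obtain ⟨C, hC⟩ := (isCompact_Icc (a := c) (b := d)).exists_bound_of_continuousOn hφc.continuousOn
  have hB0 : 0 ≤ B := (norm_nonneg _).trans (hB c (Set.left_mem_Icc.2 hcd.le))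
  have hC0 : 0 ≤ C := (norm_nonneg _).trans (hC c (Set.left_mem_Icc.2 hcd.le))
  set K := 2 * B + 1 + 2 * C with hK
  have hKpos : 0 < K := by rw [hK]; linarith
  rw [Metric.tendsto_atTop]
  intro η hη
  set ε := min 1 (η * Real.pi / (2 * K * (d - c))) with hε
  have hdc : 0 < d - c := by linarith
  have hεpos : 0 < ε := lt_min one_pos (by positivity)
  have hε1 : ε ≤ 1 := min_le_left _ _
  have hε2 : K * ε * (d - c) ≤ η * Real.pi / 2 := by
    have : ε ≤ η * Real.pi / (2 * K * (d - c)) := min_le_right _ _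
    rw [le_div_iff₀ (by positivity)] at this
    linarith
  have uc1 := isCompact_Icc.uniformContinuousOn_of_continuous (hφc.continuousOn (s := Set.Icc c d))
  have uc2 := isCompact_Icc.uniformContinuousOn_of_continuous (hsc.continuousOn (s := Set.Icc c d))
  rw [Metric.uniformContinuousOn_iff] at uc1 uc2
  obtain ⟨δ1, hδ1, hu1⟩ := uc1 ε hεpos
  obtain ⟨δ2, hδ2, hu2⟩ := uc2 ε hεpos
  obtain ⟨N, hN⟩ := exists_nat_gt ((d - c) / min δ1 δ2)
  have hmin : 0 < min δ1 δ2 := lt_min hδ1 hδ2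
  have hNpos : (0 : ℝ) < N := lt_trans (by positivity) hN
  set s := (d - c) / N with hs
  have hspos : 0 < s := by positivity
  have hsN : N * s = d - c := by rw [hs]; field_simp
  have hslt : s < min δ1 δ2 := by
    rw [hs, div_lt_iff₀ hNpos]
    rw [div_lt_iff₀ hmin] at hN
    linarith
  -- bound for all n
  have main : ∀ n, |Real.pi * (∑ᶠ x ∈ {x | u n x = 0} ∩ Set.Ico c d, φ x)
      - lam n * ∫ x in c..d, φ x * Real.sqrt (p x)|
      ≤ N * (K * ε * lam n * s + Real.pi * (1 + C)) := by
    intro n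
    have ind : ∀ k : ℕ, k ≤ N →
      |Real.pi * (∑ᶠ x ∈ {x | u n x = 0} ∩ Set.Ico c (c + k * s), φ x)
      - lam n * ∫ x in c..(c + k * s), φ x * Real.sqrt (p x)|
      ≤ k * (K * ε * lam n * s + Real.pi * (1 + C)) := by
      intro k
      induction k with
      | zero => intro _; simp
      | succ k ih =>
        intro hk
        have ih' := ih (by omega)
        have hk' : ((k : ℝ) + 1) ≤ N := by exact_mod_cast hk
        have hks : ((k : ℝ) + 1) * s ≤ d - c := by
          rw [← hsN]; exact mul_le_mul_of_nonneg_right hk' hspos.le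
        have hks0 : 0 ≤ (k : ℝ) * s := by positivity
        have hsub : Set.Icc (c + k * s) (c + (k + 1) * s) ⊆ Set.Icc c d := fun x hx =>
          ⟨by linarith [hx.1], by linarith [hx.2]⟩
        have hle : c + k * s ≤ c + (k + 1) * s := by linarith
        have hdist : ∀ x ∈ Set.Icc (c + k * s) (c + (k + 1) * s),
            dist x (c + k * s) < min δ1 δ2 := by
          intro x hx
          rw [Real.dist_eq, abs_of_nonneg (by linarith [hx.1])]
          linarith [hx.2]
        have hmem : c + k * s ∈ Set.Icc (c + k * s) (c + (k + 1) * s) := ⟨le_rfl, hle⟩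
        have loc := (h n).local_error (hpos n) hpc hφc (c + k * s) (c + (k + 1) * s) ε B C
          hle hεpos hε1 (fun x hx => hp0 x (hsub hx))
          (fun x hx => (le_abs_self _).trans (hB x (hsub hx))) (fun x hx => hC x (hsub hx))
          (fun x hx => (hu1 x (hsub hx) _ (hsub hmem)
            ((hdist x hx).trans_le (min_le_left _ _))).le)
          (fun x hx => (hu2 x (hsub hx) _ (hsub hmem)
            ((hdist x hx).trans_le (min_le_right _ _))).le)
        have hunion : {x | u n x = 0} ∩ Set.Ico c (c + (k + 1) * s) =
            ({x | u n x = 0} ∩ Set.Ico c (c + k * s)) ∪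
            ({x | u n x = 0} ∩ Set.Ico (c + k * s) (c + (k + 1) * s)) := by
          rw [← Set.inter_union_distrib_left, Set.Ico_union_Ico_eq_Ico (by linarith) hle]
        have hdisj : Disjoint ({x | u n x = 0} ∩ Set.Ico c (c + k * s))
            ({x | u n x = 0} ∩ Set.Ico (c + k * s) (c + (k + 1) * s)) := by
          rw [Set.disjoint_left]
          intro x hx hx'
          exact absurd hx.2.2 (not_lt.2 hx'.2.1)
        push_cast
        rw [hunion, finsum_mem_union hdisj ((h n).finite (hpos n) hpc _ _)
          ((h n).finite (hpos n) hpc _ _),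
          ← intervalIntegral.integral_add_adjacent_intervals (b := c + k * s)
            (Continuous.intervalIntegrable (by fun_prop) _ _)
            (Continuous.intervalIntegrable (by fun_prop) _ _)]
        have e : c + (k + 1) * s - (c + k * s) = s := by ring
        rw [e] at loc
        have tri := abs_add_le
          (Real.pi * (∑ᶠ x ∈ {x | u n x = 0} ∩ Set.Ico c (c + k * s), φ x)
            - lam n * ∫ x in c..(c + k * s), φ x * Real.sqrt (p x))
          (Real.pi * (∑ᶠ x ∈ {x | u n x = 0} ∩ Set.Ico (c + k * s) (c + (k + 1) * s), φ x)
            - lam n * ∫ x in (c + k * s)..(c + (k + 1) * s), φ x * Real.sqrt (p x))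
        refine le_trans (le_of_eq ?_) (tri.trans (le_trans (add_le_add ih' loc) (le_of_eq ?_)))
        · congr 1; ring
        · ring
    have := ind N le_rfl
    rwa [hsN, add_sub_cancel] at this
  obtain ⟨n0, hn0⟩ := (hlam.eventually_gt_atTop (2 * N * (Real.pi * (1 + C)) / (η * Real.pi))).exists_forall_of_atTop
  refine ⟨n0, fun n hn => ?_⟩
  have hl := hn0 n hn
  rw [div_lt_iff₀ (by positivity)] at hl
  have hm := main n
  have hp := hpos n
  rw [Real.dist_eq]
  have e : (1 / lam n) * (∑ᶠ x ∈ {x | u n x = 0} ∩ Set.Ico c d, φ x)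
      - (1 / Real.pi) * ∫ x in c..d, φ x * Real.sqrt (p x) =
      (Real.pi * (∑ᶠ x ∈ {x | u n x = 0} ∩ Set.Ico c d, φ x)
      - lam n * ∫ x in c..d, φ x * Real.sqrt (p x)) / (lam n * Real.pi) := by
    field_simp
  rw [e, abs_div, abs_of_pos (mul_pos hp hπ), div_lt_iff₀ (mul_pos hp hπ)]
  refine hm.trans_lt ?_
  have e2 : N * (K * ε * lam n * s + Real.pi * (1 + C)) =
    K * ε * (N * s) * lam n + N * (Real.pi * (1 + C)) := by ring
  rw [e2, hsN]
  have := mul_le_mul_of_nonneg_right hε2 hp.le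
  linarith

/-! ### Restriction to the axes -/

lemma Good.osc_real {q : ℂ → ℂ} {a b L : ℝ} {y : ℂ → ℂ}
    (hq : ∀ z : ℂ, q z = (z ^ 2 - (a : ℂ) ^ 2) * (z ^ 2 - (b : ℂ) ^ 2)) (h : Good q b L y) :
    Osc (fun x => (x ^ 2 - a ^ 2) * (b ^ 2 - x ^ 2)) L (fun x => (y x).re)
      (fun x => (deriv y x).re) := by
  refine ⟨fun x => ?_, fun x => ?_, fun x hx => ?_⟩
  · have := Complex.reCLM.hasFDerivAt.comp_hasDerivAt x (h.sol.line 0 1 x)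
    simp only [zero_add, mul_one] at this
    exact this
  · have := Complex.reCLM.hasFDerivAt.comp_hasDerivAt x (h.sol.line' 0 1 x)
    simp only [zero_add, mul_one] at this
    refine this.congr_deriv ?_
    have e : (L : ℂ) ^ 2 * q x * y x =
        ((-(L ^ 2 * ((x ^ 2 - a ^ 2) * (b ^ 2 - x ^ 2))) : ℝ) : ℂ) * y x := by
      rw [hq]; push_cast; ring
    rw [e, Complex.reCLM_apply, Complex.re_ofReal_mul]
    ring
  · obtain ⟨h1, h2⟩ := h.real x
    have h3 := h.simple x (Complex.ext hx h1)
    intro h4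
    exact h3 (Complex.ext h4 h2)

lemma Good.real_iff {q : ℂ → ℂ} {b L : ℝ} {y : ℂ → ℂ} (h : Good q b L y) (x : ℝ) :
    (y x).re = 0 ↔ y x = 0 :=
  ⟨fun hx => Complex.ext hx (h.real x).1, fun hx => by rw [hx]; rfl⟩

lemma Good.imag_iff {q : ℂ → ℂ} {b L : ℝ} {y : ℂ → ℂ} (h : Good q b L y) (t : ℝ) :
    (y (t * Complex.I)).re + (y (t * Complex.I)).im = 0 ↔ y (t * Complex.I) = 0 := by
  constructor
  · intro ht
    rcases h.imag t with ⟨h1, _⟩ | ⟨h1, _⟩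
    · have := h1 t
      exact Complex.ext (by simp only [Complex.zero_re]; linarith) this
    · have := h1 t
      exact Complex.ext this (by simp only [Complex.zero_im]; linarith)
  · intro ht; rw [ht]; simp

lemma Good.osc_imag {q : ℂ → ℂ} {a b L : ℝ} {y : ℂ → ℂ}
    (hq : ∀ z : ℂ, q z = (z ^ 2 - (a : ℂ) ^ 2) * (z ^ 2 - (b : ℂ) ^ 2)) (h : Good q b L y) :
    Osc (fun t => (t ^ 2 + a ^ 2) * (t ^ 2 + b ^ 2)) L
      (fun t => (y (t * Complex.I)).re + (y (t * Complex.I)).im)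
      (fun t => (deriv y (t * Complex.I)).re - (deriv y (t * Complex.I)).im) := by
  refine ⟨fun x => ?_, fun x => ?_, fun x hx => ?_⟩
  · have e1 := Complex.reCLM.hasFDerivAt.comp_hasDerivAt x (h.sol.line 0 Complex.I x)
    have e2 := Complex.imCLM.hasFDerivAt.comp_hasDerivAt x (h.sol.line 0 Complex.I x)
    simp only [zero_add] at e1 e2
    refine (e1.add e2).congr_deriv ?_
    simp
    ring
  · have e1 := Complex.reCLM.hasFDerivAt.comp_hasDerivAt x (h.sol.line' 0 Complex.I x)
    have e2 := Complex.imCLM.hasFDerivAt.comp_hasDerivAt x (h.sol.line' 0 Complex.I x)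
    simp only [zero_add] at e1 e2
    refine (e1.sub e2).congr_deriv ?_
    have e : (L : ℂ) ^ 2 * q (x * Complex.I) * y (x * Complex.I) * Complex.I =
        ((L ^ 2 * ((x ^ 2 + a ^ 2) * (x ^ 2 + b ^ 2)) : ℝ) : ℂ) *
          (y (x * Complex.I) * Complex.I) := by
      rw [hq, mul_pow, Complex.I_sq]; push_cast; ring
    rw [e, Complex.reCLM_apply, Complex.imCLM_apply, Complex.re_ofReal_mul, Complex.im_ofReal_mul]
    simp only [Complex.mul_re, Complex.mul_im, Complex.I_re, Complex.I_im]
    ring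
  · have h3 := h.simple _ ((h.imag_iff x).1 hx)
    intro h4
    apply h3
    rcases h.imag x with ⟨_, h2⟩ | ⟨_, h2⟩
    · exact Complex.ext h2 (by simp only [Complex.zero_im]; linarith)
    · exact Complex.ext (by simp only [Complex.zero_re]; linarith) h2

lemma Good.neg_zero {q : ℂ → ℂ} {b L : ℝ} {y : ℂ → ℂ} (h : Good q b L y) (z : ℂ) (hz : y z = 0) :
    y (-z) = 0 := by
  rcases h.par with hp | hp <;> simp [hp, hz]

lemma Good.conj_zero {q : ℂ → ℂ} {b L : ℝ} {y : ℂ → ℂ} (h : Good q b L y) (z : ℂ) (hz : y z = 0) :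
    y (star z) = 0 := by
  have := h.conj (star z)
  rw [star_star, hz, star_zero] at this
  exact this.symm

/-- All zeros lie on the two axes. -/
lemma Good.zeros {q : ℂ → ℂ} {a b L : ℝ} {y : ℂ → ℂ} (ha : 0 < a) (hab : a < b)
    (hq : ∀ z : ℂ, q z = (z ^ 2 - (a : ℂ) ^ 2) * (z ^ 2 - (b : ℂ) ^ 2)) (hL : 0 < L)
    (h : Good q b L y) (z : ℂ) :
    y z = 0 ↔ (∃ x : ℝ, y x = 0 ∧ x ∈ Set.Ico a b ∧ z = x) ∨
      (∃ x : ℝ, y x = 0 ∧ x ∈ Set.Ico a b ∧ z = -(x : ℂ)) ∨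
      (∃ t : ℝ, y (t * Complex.I) = 0 ∧ z = t * Complex.I) := by
  constructor
  · intro hz
    have hre : (z : ℂ) = z.re + z.im * Complex.I := (Complex.re_add_im z).symm
    by_cases hx : z.re = 0
    · right; right
      have : z = z.im * Complex.I := by rw [hx] at hre; simpa using hre
      exact ⟨z.im, by rw [← this]; exact hz, this⟩
    by_cases ht : z.im = 0
    · have hzr : z = (z.re : ℂ) := by rw [ht] at hre; simpa using hre
      have pos : ∀ x : ℝ, 0 < x → y x = 0 → x ∈ Set.Ico a b := by
        intro x hx0 hyx
        constructor
        · by_contra hc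
          push Not at hc
          have := h.pos_left ha hab hq hL x hx0 hc.le
          simp [hyx] at this
        · by_contra hc
          push Not at hc
          have := h.neg x hc
          simp [hyx] at this
      rcases lt_or_gt_of_ne hx with hneg | hpos
      · right; left
        have h1 : y ((-z.re : ℝ) : ℂ) = 0 := by
          push_cast; rw [← hzr]; exact h.neg_zero z hz
        exact ⟨-z.re, h1, pos _ (by linarith) h1, by push_cast; rw [neg_neg]; exact hzr⟩
      · left
        have h1 : y ((z.re : ℝ) : ℂ) = 0 := by rw [← hzr]; exact hz
        exact ⟨z.re, h1, pos _ hpos h1, hzr⟩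
    · exfalso
      have key : ∀ w : ℂ, w.re = |z.re| → w.im = |z.im| → y w ≠ 0 := by
        intro w h1 h2
        have := h.no_quadrant ha hab hq hL |z.re| |z.im| (abs_pos.2 hx) (abs_pos.2 ht)
        rw [← h1, ← h2, Complex.re_add_im] at this
        exact this
      rcases abs_choice z.re with hr | hr <;> rcases abs_choice z.im with hi | hi
      · exact key z hr.symm hi.symm hz
      · exact key (star z) (by simp [hr]) (by simp [hi]) (h.conj_zero z hz)
      · exact key (-star z) (by simp [hr]) (by simp [hi]) (h.neg_zero _ (h.conj_zero z hz))
      · exact key (-z) (by simp [hr]) (by simp [hi]) (h.neg_zero z hz)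
  · rintro (⟨x, hx, _, rfl⟩ | ⟨x, hx, _, rfl⟩ | ⟨t, ht, rfl⟩)
    · exact hx
    · exact h.neg_zero _ hx
    · exact ht

lemma Good.zeroSum_eq {q : ℂ → ℂ} {a b L : ℝ} {y0 y : ℂ → ℂ} (ha : 0 < a) (hab : a < b)
    (hq : ∀ z : ℂ, q z = (z ^ 2 - (a : ℂ) ^ 2) * (z ^ 2 - (b : ℂ) ^ 2)) (hL : 0 < L)
    (h : Good q b L y) (hy0 : ∀ z, y z = 0 ↔ y0 z = 0) (φ : ℂ → ℝ) (R : ℝ)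
    (hR : ∀ z, R ≤ ‖z‖ → φ z = 0) :
    zeroSum y0 φ = (∑ᶠ x ∈ {x : ℝ | (y x).re = 0} ∩ Set.Ico a b, φ x)
      + (∑ᶠ x ∈ {x : ℝ | (y x).re = 0} ∩ Set.Ico a b, φ ((-x : ℝ) : ℂ))
      + ∑ᶠ t ∈ {t : ℝ | (y (t * Complex.I)).re + (y (t * Complex.I)).im = 0} ∩ Set.Ico (-R) R,
          φ (t * Complex.I) := by
  set A := {x : ℝ | (y x).re = 0} ∩ Set.Ico a b with hA
  set C := {t : ℝ | (y (t * Complex.I)).re + (y (t * Complex.I)).im = 0} ∩ Set.Ico (-R) R with hC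
  have hAf : A.Finite := (h.osc_real hq).finite hL (by fun_prop) a b
  have hCf : C.Finite := (h.osc_imag hq).finite hL (by fun_prop) (-R) R
  set f1 : ℝ → ℂ := fun x => (x : ℂ) with hf1
  set f2 : ℝ → ℂ := fun x => ((-x : ℝ) : ℂ) with hf2
  set f3 : ℝ → ℂ := fun t => (t : ℂ) * Complex.I with hf3
  have i1 : Function.Injective f1 := fun s t hst => by simpa [hf1] using hst
  have i2 : Function.Injective f2 := fun s t hst => by simpa [hf2] using hst
  have i3 : Function.Injective f3 := fun s t hst => by simpa [hf3] using hst
  set F := (f1 '' A ∪ f2 '' A) ∪ f3 '' C with hF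
  have hFf : F.Finite := ((hAf.image _).union (hAf.image _)).union (hCf.image _)
  have d1 : Disjoint (f1 '' A) (f2 '' A) := by
    rw [Set.disjoint_left]
    rintro _ ⟨s, hs, rfl⟩ ⟨t, ht, hst⟩
    have := congrArg Complex.re hst
    simp only [hf1, hf2, Complex.ofReal_re] at this
    linarith [hs.2.1, ht.2.1]
  have d2 : Disjoint (f1 '' A ∪ f2 '' A) (f3 '' C) := by
    rw [Set.disjoint_left]
    rintro _ (⟨s, hs, rfl⟩ | ⟨s, hs, rfl⟩) ⟨t, ht, hst⟩
    · have := congrArg Complex.re hst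
      simp [hf1, hf3] at this
      linarith [hs.2.1]
    · have := congrArg Complex.re hst
      simp [hf2, hf3] at this
      linarith [hs.2.1]
  have hind : Set.indicator {z | y0 z = 0} φ = Set.indicator F φ := by
    funext z
    by_cases hz : y0 z = 0
    · rw [Set.indicator_of_mem (show z ∈ {z | y0 z = 0} from hz)]
      by_cases hzF : z ∈ F
      · rw [Set.indicator_of_mem hzF]
      · rw [Set.indicator_of_notMem hzF]
        rcases (h.zeros ha hab hq hL z).1 ((hy0 z).2 hz) with
          ⟨x, hx, hm, rfl⟩ | ⟨x, hx, hm, rfl⟩ | ⟨t, ht, rfl⟩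
        · exact absurd (Or.inl (Or.inl ⟨x, ⟨(h.real_iff x).2 hx, hm⟩, rfl⟩)) hzF
        · exact absurd (Or.inl (Or.inr ⟨x, ⟨(h.real_iff x).2 hx, hm⟩, by simp [hf2]⟩)) hzF
        · apply hR
          by_contra hc
          push Not at hc
          simp only [norm_mul, Complex.norm_real, Complex.norm_I, mul_one, Real.norm_eq_abs] at hc
          have := abs_lt.1 hc
          exact hzF (Or.inr ⟨t, ⟨(h.imag_iff t).2 ht, this.1.le, this.2⟩, rfl⟩)
    · rw [Set.indicator_of_notMem (show z ∉ {z | y0 z = 0} from hz)]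
      rw [Set.indicator_of_notMem]
      intro hzF
      apply hz
      rw [← hy0, h.zeros ha hab hq hL]
      rcases hzF with (⟨x, hx, rfl⟩ | ⟨x, hx, rfl⟩) | ⟨t, ht, rfl⟩
      · exact Or.inl ⟨x, (h.real_iff x).1 hx.1, hx.2, rfl⟩
      · exact Or.inr (Or.inl ⟨x, (h.real_iff x).1 hx.1, hx.2, by simp [hf2]⟩)
      · exact Or.inr (Or.inr ⟨t, (h.imag_iff t).1 ht.1, rfl⟩)
  have e1 : zeroSum y0 φ = ∑' z, Set.indicator {z | y0 z = 0} φ z :=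
    tsum_subtype {z | y0 z = 0} φ
  rw [e1, hind, tsum_eq_finsum (hFf.subset (fun z hz => by
    by_contra hc
    exact hz (Set.indicator_of_notMem hc φ))), ← finsum_mem_def, hF,
    finsum_mem_union d2 ((hAf.image _).union (hAf.image _)) (hCf.image _),
    finsum_mem_union d1 (hAf.image _) (hAf.image _),
    finsum_mem_image i1.injOn, finsum_mem_image i2.injOn, finsum_mem_image i3.injOn]

/-- Theorem 2 (symmetric double well): for `q(z) = (z²−a²)(z²−b²)` with `0 < a < b`,
the zero-counting measures of the eigenfunctions converge weak* to
`(1/π)|√q| |dγ|` on `γ = (a,b) ∪ (−b,−a) ∪ iℝ`. -/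
theorem symmetric_double_well_zero_limit
    (a b : ℝ) (ha : 0 < a) (hab : a < b)
    (q : ℂ → ℂ) (hq : ∀ z : ℂ, q z = (z ^ 2 - (a : ℂ) ^ 2) * (z ^ 2 - (b : ℂ) ^ 2))
    (lam : ℕ → ℝ) (y : ℕ → ℂ → ℂ)
    (hlam : Tendsto lam atTop atTop)
    (heig : ∀ n, IsEigen q (lam n) (y n))
    (φ : ℂ → ℝ) (hφc : Continuous φ) (hφs : HasCompactSupport φ) :
    Tendsto (fun n => (1 / lam n) * zeroSum (y n) φ) atTop
      (nhds ((1 / Real.pi) *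
        ((∫ x in a..b, φ (x : ℂ) * Real.sqrt ((x ^ 2 - a ^ 2) * (b ^ 2 - x ^ 2)))
        + (∫ x in (-b)..(-a), φ (x : ℂ) * Real.sqrt ((x ^ 2 - a ^ 2) * (b ^ 2 - x ^ 2)))
        + ∫ t : ℝ, φ ((t : ℂ) * Complex.I) *
            Real.sqrt ((t ^ 2 + a ^ 2) * (t ^ 2 + b ^ 2))))) := by
  have hb : 0 < b := ha.trans hab
  have hqc : Continuous q := by
    rw [funext hq]; fun_prop
  have hqe : ∀ z, q (-z) = q z := by intro z; rw [hq, hq]; ring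
  have hqs : ∀ z, q (star z) = star (q z) := by
    intro z; rw [hq, hq]; simp
  have hpos : ∀ x : ℝ, b ≤ x → 0 ≤ (q x).re := by
    intro x hx
    rw [q_re a b q hq, Complex.ofReal_re, Complex.ofReal_im, qre_real]
    exact mul_nonneg (by nlinarith) (by nlinarith)
  have hL : ∀ n, 0 < lam n := fun n => (heig n).1
  have hex : ∀ n, ∃ Y : ℂ → ℂ, Good q b (lam n) Y ∧ ∀ z, Y z = 0 ↔ y n z = 0 := fun n =>
    exists_good q (lam n) b (y n) hqc hqe hqs hpos ⟨(heig n).2.1, (heig n).2.2.2.1⟩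
      (heig n).2.2.1 (heig n).2.2.2.2
  choose Y hY hYz using hex
  obtain ⟨R0, hR0⟩ := hφs.isCompact.isBounded.subset_ball (0 : ℂ)
  set R := max R0 1 with hRdef
  have hRpos : 0 < R := lt_of_lt_of_le one_pos (le_max_right _ _)
  have hR : ∀ z, R ≤ ‖z‖ → φ z = 0 := by
    intro z hz
    by_contra hne
    have := hR0 (subset_tsupport φ hne)
    rw [mem_ball_zero_iff] at this
    have := le_max_left R0 1
    linarith
  have hsum : ∀ n, (1 / lam n) * zeroSum (y n) φ = _ := fun n =>
    congrArg (fun s => (1 / lam n) * s)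
      ((hY n).zeroSum_eq ha hab hq (hL n) (hYz n) φ R hR)
  simp only [hsum]
  have pR : ∀ x ∈ Set.Icc a b, 0 ≤ (x ^ 2 - a ^ 2) * (b ^ 2 - x ^ 2) := by
    intro x hx
    exact mul_nonneg (by nlinarith [hx.1, hx.2]) (by nlinarith [hx.1, hx.2])
  have l1 := sturm_limit (fun x => (x ^ 2 - a ^ 2) * (b ^ 2 - x ^ 2)) (fun x => φ (x : ℂ))
    (by fun_prop) (by fun_prop) a b hab pR lam hL hlam _ _ (fun n => (hY n).osc_real hq)
  have l2 := sturm_limit (fun x => (x ^ 2 - a ^ 2) * (b ^ 2 - x ^ 2))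
    (fun x => φ ((-x : ℝ) : ℂ))
    (by fun_prop) (by fun_prop) a b hab pR lam hL hlam _ _ (fun n => (hY n).osc_real hq)
  have l3 := sturm_limit (fun t => (t ^ 2 + a ^ 2) * (t ^ 2 + b ^ 2))
    (fun t => φ ((t : ℂ) * Complex.I))
    (by fun_prop) (by fun_prop) (-R) R (by linarith) (fun x _ => by positivity) lam hL hlam _ _
    (fun n => (hY n).osc_imag hq)
  have e2 : (∫ x in (-b)..(-a), φ (x : ℂ) * Real.sqrt ((x ^ 2 - a ^ 2) * (b ^ 2 - x ^ 2))) =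
      ∫ x in a..b, φ ((-x : ℝ) : ℂ) * Real.sqrt ((x ^ 2 - a ^ 2) * (b ^ 2 - x ^ 2)) := by
    rw [← intervalIntegral.integral_comp_neg
      (fun x : ℝ => φ (x : ℂ) * Real.sqrt ((x ^ 2 - a ^ 2) * (b ^ 2 - x ^ 2)))]
    simp only [neg_sq]
  have e3 : (∫ t : ℝ, φ ((t : ℂ) * Complex.I) *
      Real.sqrt ((t ^ 2 + a ^ 2) * (t ^ 2 + b ^ 2))) =
      ∫ t in (-R)..R, φ ((t : ℂ) * Complex.I) *
        Real.sqrt ((t ^ 2 + a ^ 2) * (t ^ 2 + b ^ 2)) := by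
    symm
    apply intervalIntegral.integral_eq_integral_of_support_subset
    intro t ht
    have h1 : φ ((t : ℂ) * Complex.I) ≠ 0 := left_ne_zero_of_mul ht
    have h2 : |t| < R := by
      by_contra hc
      push Not at hc
      exact h1 (hR _ (by simpa using hc))
    have := abs_lt.1 h2
    exact ⟨this.1, this.2.le⟩
  rw [e2, e3, mul_add, mul_add]
  refine ((l1.add l2).add l3).congr fun n => ?_
  rw [mul_add, mul_add]
end

section
/- Let a, b > 0 be real numbers and q(z) = (z²−a²)(z²+b²). For every sequence (λ_n) of positive reals with λ_n → ∞ such that each λ_n is an eigenvalue of q with eigenfunction y_n, and for every continuous compactly supported φ : ℂ → ℝ, the normalized zero sums converge: (1/λ_n) Σ_{z ∈ ℂ, y_n(z)=0} φ(z) → (1/π) [ ∫_{−a}^{a} φ(x) √((a²−x²)(x²+b²)) dx + ∫_b^{∞} φ(iy) √((y²+a²)(y²−b²)) dy + ∫_{−∞}^{−b} φ(iy) √((y²+a²)(y²−b²)) dy ]. (Equivalently, the zero-counting measures Z_{λ_n,y_n} converge weak* to the measure (1/π)|√(q(z))| |dγ| on γ = (−a,a) ∪ (bi, i∞) ∪ (−i∞,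 −bi).) -/
open MeasureTheory Filter Topology

/-- The logarithmic-derivative quantity conj(y) times the derivative of y. -/
noncomputable def BB (y : ℂ → ℂ) (z : ℂ) : ℂ := (starRingEnd ℂ) (y z) * deriv y z

theorem line_deriv_s1 (y : ℂ → ℂ) (hy : Differentiable ℂ y) (p v : ℂ) (s : ℝ) :
    HasDerivAt (fun s : ℝ => y (p + s * v)) (deriv y (p + s * v) * v) s := by
  have h1 : HasDerivAt (fun s : ℝ => p + (s : ℂ) * v) v s := by
    have := ((Complex.ofRealCLM.hasDerivAt (x := s)).mul_const v).const_add p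
    simpa using this
  exact (hy (p + s * v)).hasDerivAt.comp s h1

theorem hasDerivAt_BB (y Q : ℂ → ℂ) (hy : Differentiable ℂ y)
    (hode : ∀ z, deriv (deriv y) z = Q z * y z) (p v : ℂ) (s : ℝ) :
    HasDerivAt (fun s : ℝ => BB y (p + s * v))
      ((starRingEnd ℂ) v * ((‖deriv y (p + s * v)‖ ^ 2 : ℝ) : ℂ)
        + v * Q (p + s * v) * ((‖y (p + s * v)‖ ^ 2 : ℝ) : ℂ)) s := by
  have hy' : Differentiable ℂ (deriv y) := hy.deriv
  have h1 := line_deriv_s1 y hy p v s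
  have h2 := line_deriv_s1 (deriv y) hy' p v s
  have h3 : HasDerivAt (fun s : ℝ => (starRingEnd ℂ) (y (p + s * v)))
      ((starRingEnd ℂ) (deriv y (p + s * v) * v)) s := h1.star
  have h4 := h3.mul h2
  have e : ∀ w : ℂ, ((‖w‖ ^ 2 : ℝ) : ℂ) = (starRingEnd ℂ) w * w := by
    intro w; rw [Complex.conj_mul']; push_cast; rfl
  have key : (starRingEnd ℂ) v * ((‖deriv y (p + s * v)‖ ^ 2 : ℝ) : ℂ)
        + v * Q (p + s * v) * ((‖y (p + s * v)‖ ^ 2 : ℝ) : ℂ) =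
      (starRingEnd ℂ) (deriv y (p + ↑s * v) * v) * deriv y (p + ↑s * v) +
      (starRingEnd ℂ) (y (p + ↑s * v)) * (deriv (deriv y) (p + ↑s * v) * v) := by
    rw [e, e, hode, map_mul]; ring
  rw [key]
  exact h4

theorem re_hasDerivAt {f : ℝ → ℂ} {f' : ℂ} {s : ℝ} (h : HasDerivAt f f' s) :
    HasDerivAt (fun s => (f s).re) f'.re s :=
  (Complex.reCLM.hasFDerivAt.comp_hasDerivAt s h)

theorem im_hasDerivAt {f : ℝ → ℂ} {f' : ℂ} {s : ℝ} (h : HasDerivAt f f' s) :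
    HasDerivAt (fun s => (f s).im) f'.im s :=
  (Complex.imCLM.hasFDerivAt.comp_hasDerivAt s h)

theorem G_h (y Q : ℂ → ℂ) (hy : Differentiable ℂ y)
    (hode : ∀ z, deriv (deriv y) z = Q z * y z) (t x : ℝ) :
    HasDerivAt (fun x : ℝ => (BB y (x + t * Complex.I)).re)
      (‖deriv y (x + t * Complex.I)‖ ^ 2 + (Q (x + t * Complex.I)).re *
        ‖y (x + t * Complex.I)‖ ^ 2) x := by
  have h := re_hasDerivAt (hasDerivAt_BB y Q hy hode (t * Complex.I) 1 x)
  simp only [mul_one, add_comm ((t : ℂ) * Complex.I)] at h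
  convert h using 1
  simp only [map_one, one_mul, Complex.add_re, Complex.re_mul_ofReal, Complex.ofReal_re]

theorem F_h (y Q : ℂ → ℂ) (hy : Differentiable ℂ y)
    (hode : ∀ z, deriv (deriv y) z = Q z * y z) (t x : ℝ) :
    HasDerivAt (fun x : ℝ => (BB y (x + t * Complex.I)).im)
      ((Q (x + t * Complex.I)).im * ‖y (x + t * Complex.I)‖ ^ 2) x := by
  have h := im_hasDerivAt (hasDerivAt_BB y Q hy hode (t * Complex.I) 1 x)
  simp only [mul_one, add_comm ((t : ℂ) * Complex.I)] at h
  convert h using 1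
  simp only [map_one, one_mul, Complex.add_im, Complex.im_mul_ofReal, Complex.ofReal_im, zero_add]

theorem G_v (y Q : ℂ → ℂ) (hy : Differentiable ℂ y)
    (hode : ∀ z, deriv (deriv y) z = Q z * y z) (x t : ℝ) :
    HasDerivAt (fun t : ℝ => (BB y (x + t * Complex.I)).re)
      (-(Q (x + t * Complex.I)).im * ‖y (x + t * Complex.I)‖ ^ 2) t := by
  have h := re_hasDerivAt (hasDerivAt_BB y Q hy hode x Complex.I t)
  convert h using 1
  simp only [Complex.conj_I, Complex.add_re, Complex.re_mul_ofReal, Complex.I_mul_re,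
    Complex.neg_re, Complex.I_re]
  ring

theorem F_v (y Q : ℂ → ℂ) (hy : Differentiable ℂ y)
    (hode : ∀ z, deriv (deriv y) z = Q z * y z) (x t : ℝ) :
    HasDerivAt (fun t : ℝ => (BB y (x + t * Complex.I)).im)
      (-‖deriv y (x + t * Complex.I)‖ ^ 2 + (Q (x + t * Complex.I)).re *
        ‖y (x + t * Complex.I)‖ ^ 2) t := by
  have h := im_hasDerivAt (hasDerivAt_BB y Q hy hode x Complex.I t)
  convert h using 1
  simp only [Complex.conj_I, Complex.add_im, Complex.im_mul_ofReal, Complex.I_mul_im,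
    Complex.neg_im, Complex.I_im]
  ring

theorem norm_h (y : ℂ → ℂ) (hy : Differentiable ℂ y) (t x : ℝ) :
    HasDerivAt (fun x : ℝ => ‖y (x + t * Complex.I)‖ ^ 2)
      (2 * (BB y (x + t * Complex.I)).re) x := by
  have h1 := line_deriv_s1 y hy (t * Complex.I) 1 x
  have h2 := h1.norm_sq
  simp only [mul_one, add_comm ((t : ℂ) * Complex.I)] at h2
  convert h2 using 1
  simp [BB, Complex.inner]
  ring

/-- A function with nonnegative derivative and no net growth is flat. -/
theorem flat_of_deriv_nonneg {g g' : ℝ → ℝ} {α β : ℝ} 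
    (hg : ∀ s ∈ Set.Icc α β, HasDerivAt g (g' s) s)
    (hpos : ∀ s ∈ Set.Ioo α β, 0 ≤ g' s) (hle : g β ≤ g α) :
    ∀ s ∈ Set.Ioo α β, g' s = 0 := by
  have hmono : MonotoneOn g (Set.Icc α β) := by
    apply monotoneOn_of_deriv_nonneg (convex_Icc α β)
    · exact fun s hs => (hg s hs).continuousAt.continuousWithinAt
    · intro s hs
      rw [interior_Icc] at hs
      exact (hg s (Set.Ioo_subset_Icc_self hs)).differentiableAt.differentiableWithinAt
    · intro s hs
      rw [interior_Icc] at hs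
      rw [(hg s (Set.Ioo_subset_Icc_self hs)).deriv]
      exact hpos s hs
  intro s hs
  have hαβ : α ≤ β := by linarith [hs.1, hs.2]
  have hc : g =ᶠ[𝓝 s] fun _ => g α := by
    filter_upwards [Ioo_mem_nhds hs.1 hs.2] with u hu
    have hu' := Set.Ioo_subset_Icc_self hu
    have h1 := hmono (Set.left_mem_Icc.2 hαβ) hu' hu'.1
    have h2 := hmono hu' (Set.right_mem_Icc.2 hαβ) hu'.2
    linarith
  have h1 := hg s (Set.Ioo_subset_Icc_self hs)
  have h2 : HasDerivAt g 0 s := (hasDerivAt_const s (g α)).congr_of_eventuallyEq hc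
  exact h1.unique h2

/-- Identity theorem along a segment. -/
theorem entire_zero_of_segment (f : ℂ → ℂ) (hf : Differentiable ℂ f) (p v : ℂ) (hv : v ≠ 0)
    (α β : ℝ) (hαβ : α < β) (h : ∀ s ∈ Set.Ioo α β, f (p + s * v) = 0) : ∀ z, f z = 0 := by
  have hA : AnalyticOnNhd ℂ f Set.univ := fun z _ => hf.analyticAt z
  set m := (α + β) / 2 with hm
  have ht : Tendsto (fun s : ℝ => p + (s : ℂ) * v) (𝓝[≠] m) (𝓝[≠] (p + (m : ℂ) * v)) := by
    apply tendsto_nhdsWithin_iff.2 ⟨?_, ?_⟩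
    · have : Continuous (fun s : ℝ => p + (s : ℂ) * v) := by fun_prop
      exact (this.tendsto m).mono_left nhdsWithin_le_nhds
    · filter_upwards [self_mem_nhdsWithin] with s hs
      intro h
      apply hs
      simpa [hv] using h
  have hev : ∀ᶠ s : ℝ in 𝓝[≠] m, f (p + (s : ℂ) * v) = 0 := by
    apply nhdsWithin_le_nhds
    filter_upwards [Ioo_mem_nhds (show α < m by linarith) (show m < β by linarith)] with s hs
    exact h s hs
  have hfr : ∃ᶠ z in 𝓝[≠] (p + (m : ℂ) * v), f z = 0 := ht.frequently hev.frequently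
  have := hA.eqOn_zero_of_preconnected_of_frequently_eq_zero isPreconnected_univ
    (Set.mem_univ _) hfr
  intro z
  exact this (Set.mem_univ z)

theorem entire_zero_of_deriv_segment (y : ℂ → ℂ) (hy : Differentiable ℂ y) (p v : ℂ) (hv : v ≠ 0)
    (α β : ℝ) (hαβ : α < β) (h : ∀ s ∈ Set.Ioo α β, deriv y (p + s * v) = 0)
    (z₀ : ℂ) (hz : y z₀ = 0) : ∀ z, y z = 0 := by
  have h1 := entire_zero_of_segment (deriv y) hy.deriv p v hv α β hαβ h
  intro z
  rw [is_const_of_deriv_eq_zero hy h1 z z₀, hz]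

theorem not_integrable_of_lower {f : ℝ → ℝ} {X c : ℝ} (hc : 0 < c)
    (h : ∀ x, X < x → c ≤ f x) : ¬ IntegrableOn f (Set.Ioi X) := by
  intro hi
  have : IntegrableOn (fun _ : ℝ => c) (Set.Ioi X) := by
    refine Integrable.mono' hi aestronglyMeasurable_const ?_
    filter_upwards [ae_restrict_mem measurableSet_Ioi] with x hx
    rw [Real.norm_of_nonneg hc.le]
    exact h x hx
  rw [integrableOn_const_iff] at this
  simp [hc.ne'] at this

theorem integrable_of_decay (y Q : ℂ → ℂ) (hy : Differentiable ℂ y)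
    (hode : ∀ z, deriv (deriv y) z = Q z * y z) (t X : ℝ)
    (hQ : ∀ x : ℝ, X ≤ x → 1 ≤ (Q (x + t * Complex.I)).re)
    (hG : ∀ x : ℝ, X ≤ x → (BB y (x + t * Complex.I)).re ≤ 0) :
    IntegrableOn (fun x : ℝ => ‖deriv y (x + t * Complex.I)‖ ^ 2) (Set.Ioi X) ∧
    IntegrableOn (fun x : ℝ => ‖y (x + t * Complex.I)‖ ^ 2) (Set.Ioi X) := by
  set g : ℝ → ℝ := fun x => (BB y (x + t * Complex.I)).re with hg
  set g' : ℝ → ℝ := fun x => ‖deriv y (x + t * Complex.I)‖ ^ 2 + (Q (x + t * Complex.I)).re *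
        ‖y (x + t * Complex.I)‖ ^ 2 with hg'
  have hd : ∀ x, HasDerivAt g (g' x) x := fun x => G_h y Q hy hode t x
  have hpos : ∀ x, X ≤ x → 0 ≤ g' x := by
    intro x hx
    have := hQ x hx
    simp only [hg']; positivity
  have hmono : MonotoneOn g (Set.Ici X) := by
    apply monotoneOn_of_deriv_nonneg (convex_Ici X)
    · exact fun s hs => (hd s).continuousAt.continuousWithinAt
    · exact fun s hs => (hd s).differentiableAt.differentiableWithinAt
    · intro s hs
      rw [interior_Ici] at hs
      rw [(hd s).deriv]
      exact hpos s hs.le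
  have hIntg : IntegrableOn g' (Set.Ioi X) := by
    set G : ℝ → ℝ := fun x => g (max x X) with hGdef
    have hGm : Monotone G := by
      intro u w huw
      exact hmono (Set.mem_Ici.2 (le_max_right _ _)) (Set.mem_Ici.2 (le_max_right _ _)) (max_le_max huw le_rfl)
    have hbd : BddAbove (Set.range G) := ⟨0, by
      rintro _ ⟨x, rfl⟩
      exact hG _ (le_max_right _ _)⟩
    have hl := tendsto_atTop_ciSup hGm hbd
    have hl' : Tendsto g atTop (𝓝 (⨆ i, G i)) := by
      refine hl.congr' ?_
      filter_upwards [eventually_ge_atTop X] with x hx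
      simp [hGdef, max_eq_left hx]
    exact integrableOn_Ioi_deriv_of_nonneg (hd X).continuousAt.continuousWithinAt
      (fun x _ => hd x) (fun x hx => hpos x (le_of_lt hx)) hl'
  have hc1 : Continuous (fun x : ℝ => ‖deriv y (x + t * Complex.I)‖ ^ 2) := by
    have := hy.deriv.continuous
    fun_prop
  have hc2 : Continuous (fun x : ℝ => ‖y (x + t * Complex.I)‖ ^ 2) := by
    have := hy.continuous
    fun_prop
  constructor
  · refine Integrable.mono' hIntg hc1.aestronglyMeasurable ?_
    filter_upwards [ae_restrict_mem measurableSet_Ioi] with x hx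
    have := hQ x (le_of_lt hx)
    rw [Real.norm_of_nonneg (by positivity)]
    simp only [hg']
    have : 0 ≤ (Q (x + t * Complex.I)).re * ‖y (x + t * Complex.I)‖ ^ 2 := by positivity
    linarith
  · refine Integrable.mono' hIntg hc2.aestronglyMeasurable ?_
    filter_upwards [ae_restrict_mem measurableSet_Ioi] with x hx
    have := hQ x (le_of_lt hx)
    rw [Real.norm_of_nonneg (by positivity)]
    simp only [hg']
    have h1 : 0 ≤ ‖deriv y (x + t * Complex.I)‖ ^ 2 := by positivity
    have h2 : 0 ≤ ‖y (x + t * Complex.I)‖ ^ 2 := by positivity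
    nlinarith

theorem G_real_nonpos (y Q : ℂ → ℂ) (hy : Differentiable ℂ y)
    (hode : ∀ z, deriv (deriv y) z = Q z * y z) (X : ℝ)
    (hQ : ∀ x : ℝ, X ≤ x → 0 ≤ (Q x).re)
    (hI : Integrable (fun x : ℝ => ‖y (x : ℂ)‖ ^ 2)) (x : ℝ) (hx : X ≤ x) :
    (BB y x).re ≤ 0 := by
  by_contra hcon
  push Not at hcon
  have hd : ∀ x : ℝ, HasDerivAt (fun x : ℝ => (BB y x).re) (‖deriv y x‖ ^ 2 + (Q x).re *
        ‖y x‖ ^ 2) x := fun x => by simpa using G_h y Q hy hode 0 x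
  have hn : ∀ x : ℝ, HasDerivAt (fun x : ℝ => ‖y x‖ ^ 2) (2 * (BB y x).re) x :=
    fun x => by simpa using norm_h y hy 0 x
  have hmono : MonotoneOn (fun x : ℝ => (BB y x).re) (Set.Ici X) := by
    apply monotoneOn_of_deriv_nonneg (convex_Ici X)
    · exact fun s hs => (hd s).continuousAt.continuousWithinAt
    · exact fun s hs => (hd s).differentiableAt.differentiableWithinAt
    · intro s hs
      rw [interior_Ici] at hs
      rw [(hd s).deriv]
      have := hQ s (le_of_lt hs)
      positivity
  have hmono2 : StrictMonoOn (fun x : ℝ => ‖y x‖ ^ 2) (Set.Ici x) := by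
    apply strictMonoOn_of_deriv_pos (convex_Ici x)
    · exact fun s hs => (hn s).continuousAt.continuousWithinAt
    · intro s hs
      rw [interior_Ici] at hs
      rw [(hn s).deriv]
      have := hmono (show x ∈ Set.Ici X from hx) (show s ∈ Set.Ici X from hx.trans (le_of_lt hs))
        (le_of_lt hs)
      simp only at this
      linarith
  have hpos : 0 < ‖y ((x + 1 : ℝ) : ℂ)‖ ^ 2 := by
    have := hmono2 (show x ∈ Set.Ici x from Set.self_mem_Ici) (show x + 1 ∈ Set.Ici x by simp) (by linarith)
    simp only at this
    have h0 : 0 ≤ ‖y (x : ℂ)‖ ^ 2 := by positivity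
    linarith
  refine not_integrable_of_lower (X := x + 1) hpos ?_ hI.integrableOn
  intro s hs
  exact (hmono2 (show x + 1 ∈ Set.Ici x by simp) (show s ∈ Set.Ici x by simp; linarith) hs).le

theorem q_re_s1 (a b x t : ℝ) (q : ℂ → ℂ)
    (hq : ∀ z : ℂ, q z = (z ^ 2 - (a : ℂ) ^ 2) * (z ^ 2 + (b : ℂ) ^ 2)) :
    (q (x + t * Complex.I)).re =
      (x ^ 2 - t ^ 2 - a ^ 2) * (x ^ 2 - t ^ 2 + b ^ 2) - 4 * x ^ 2 * t ^ 2 := by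
  rw [hq]
  simp [pow_two]
  ring

theorem q_im_s1 (a b x t : ℝ) (q : ℂ → ℂ)
    (hq : ∀ z : ℂ, q z = (z ^ 2 - (a : ℂ) ^ 2) * (z ^ 2 + (b : ℂ) ^ 2)) :
    (q (x + t * Complex.I)).im = 2 * x * t * (2 * (x ^ 2 - t ^ 2) + b ^ 2 - a ^ 2) := by
  rw [hq]
  simp [pow_two]
  ring

theorem Q_re (a b x t lam : ℝ) (q : ℂ → ℂ)
    (hq : ∀ z : ℂ, q z = (z ^ 2 - (a : ℂ) ^ 2) * (z ^ 2 + (b : ℂ) ^ 2)) :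
    ((lam : ℂ) ^ 2 * q (x + t * Complex.I)).re =
      lam ^ 2 * ((x ^ 2 - t ^ 2 - a ^ 2) * (x ^ 2 - t ^ 2 + b ^ 2) - 4 * x ^ 2 * t ^ 2) := by
  rw [← q_re_s1 a b x t q hq, ← Complex.ofReal_pow, Complex.re_ofReal_mul]

theorem Q_im (a b x t lam : ℝ) (q : ℂ → ℂ)
    (hq : ∀ z : ℂ, q z = (z ^ 2 - (a : ℂ) ^ 2) * (z ^ 2 + (b : ℂ) ^ 2)) :
    ((lam : ℂ) ^ 2 * q (x + t * Complex.I)).im =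
      lam ^ 2 * (2 * x * t * (2 * (x ^ 2 - t ^ 2) + b ^ 2 - a ^ 2)) := by
  rw [← q_im_s1 a b x t q hq, ← Complex.ofReal_pow, Complex.im_ofReal_mul]

/-- Far out on horizontal lines the potential is large. -/
theorem Q_large (a b t lam : ℝ) (hlam : 0 < lam) (q : ℂ → ℂ)
    (hq : ∀ z : ℂ, q z = (z ^ 2 - (a : ℂ) ^ 2) * (z ^ 2 + (b : ℂ) ^ 2)) :
    ∃ X : ℝ, |a| ≤ X ∧ 0 < X ∧ ∀ x : ℝ, X ≤ x → a ^ 2 + t ^ 2 ≤ x ^ 2 ∧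
      1 ≤ ((lam : ℂ) ^ 2 * q (x + t * Complex.I)).re := by
  set K : ℝ := a ^ 2 + 4 * t ^ 2 + 1 + a ^ 2 * b ^ 2 + 4 * t ^ 4 + 1 / lam ^ 2 with hK
  have hl : 0 < 1 / lam ^ 2 := by positivity
  have hK1 : 1 ≤ K := by
    have : 0 ≤ a ^ 2 + 4 * t ^ 2 + a ^ 2 * b ^ 2 + 4 * t ^ 4 := by positivity
    linarith
  refine ⟨K + t ^ 2 + |a|, by nlinarith [sq_nonneg t], by positivity, ?_⟩
  intro x hx
  have hx1 : K + t ^ 2 ≤ x := by linarith [abs_nonneg a]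
  have hx2 : K + t ^ 2 ≤ x ^ 2 := by nlinarith [sq_nonneg t]
  have ha2 : a ^ 2 ≤ K := by
    have : 0 ≤ 4 * t ^ 2 + 1 + a ^ 2 * b ^ 2 + 4 * t ^ 4 := by positivity
    linarith
  refine ⟨by linarith, ?_⟩
  rw [Q_re a b x t lam q hq]
  set u := x ^ 2 - t ^ 2 with hu
  have huK : K ≤ u := by linarith
  have hx2u : x ^ 2 = u + t ^ 2 := by rw [hu]; ring
  have key : 1 / lam ^ 2 ≤ (u - a ^ 2) * (u + b ^ 2) - 4 * x ^ 2 * t ^ 2 := by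
    rw [hx2u]
    have h1 : (1 + a ^ 2 * b ^ 2 + 4 * t ^ 4 + 1 / lam ^ 2) ≤ u - a ^ 2 - 4 * t ^ 2 := by
      linarith
    have h3 : 0 ≤ a ^ 2 * b ^ 2 + 4 * t ^ 4 := by positivity
    have h2 : 1 + a ^ 2 * b ^ 2 + 4 * t ^ 4 + 1 / lam ^ 2 ≤ u * (u - a ^ 2 - 4 * t ^ 2) := by
      nlinarith
    nlinarith [mul_nonneg (sq_nonneg b) (show 0 ≤ u by linarith)]
  calc (1 : ℝ) = lam ^ 2 * (1 / lam ^ 2) := by field_simp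
    _ ≤ _ := by gcongr

theorem Q_real_nonneg (a b lam x : ℝ) (hx : |a| ≤ x) (q : ℂ → ℂ)
    (hq : ∀ z : ℂ, q z = (z ^ 2 - (a : ℂ) ^ 2) * (z ^ 2 + (b : ℂ) ^ 2)) :
    0 ≤ ((lam : ℂ) ^ 2 * q x).re := by
  have := Q_re a b x 0 lam q hq
  simp only [Complex.ofReal_zero, zero_mul, add_zero] at this
  rw [this]
  have h1 : a ^ 2 ≤ x ^ 2 := by
    rw [← sq_abs a]; have := abs_nonneg a; gcongr
  have h2 : 0 ≤ x ^ 2 - a ^ 2 := by linarith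
  have h3 : (x ^ 2 - 0 ^ 2 - a ^ 2) * (x ^ 2 - 0 ^ 2 + b ^ 2) - 4 * x ^ 2 * 0 ^ 2 =
    (x ^ 2 - a ^ 2) * (x ^ 2 + b ^ 2) := by ring
  rw [h3]; positivity

theorem eigen_G_real (a b lam : ℝ) (q y : ℂ → ℂ)
    (hq : ∀ z : ℂ, q z = (z ^ 2 - (a : ℂ) ^ 2) * (z ^ 2 + (b : ℂ) ^ 2))
    (h : IsEigen q lam y) (x : ℝ) (hx : |a| ≤ x) : (BB y x).re ≤ 0 := by
  obtain ⟨hl, hy, hne, hode, hI⟩ := h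
  exact G_real_nonpos y (fun z => (lam : ℂ) ^ 2 * q z) hy hode |a|
    (fun x hx => Q_real_nonneg a b lam x hx q hq) hI x hx

/-- On each horizontal line, `BB` has nonpositive real part far to the right. -/
theorem eigen_G_line (a b lam : ℝ) (q y : ℂ → ℂ)
    (hq : ∀ z : ℂ, q z = (z ^ 2 - (a : ℂ) ^ 2) * (z ^ 2 + (b : ℂ) ^ 2))
    (h : IsEigen q lam y) (t : ℝ) (ht : 0 ≤ t) (x : ℝ) (hx : |a| ≤ x)
    (hxt : a ^ 2 + t ^ 2 ≤ x ^ 2) : (BB y (x + t * Complex.I)).re ≤ 0 := by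
  have h0 := eigen_G_real a b lam q y hq h x hx
  obtain ⟨hl, hy, hne, hode, hI⟩ := h
  have hx0 : 0 ≤ x := (abs_nonneg a).trans hx
  have hd := G_v y (fun z => (lam : ℂ) ^ 2 * q z) hy hode x
  have hanti : AntitoneOn (fun t : ℝ => (BB y (x + t * Complex.I)).re) (Set.Icc 0 t) := by
    apply antitoneOn_of_deriv_nonpos (convex_Icc 0 t)
    · exact fun s hs => (hd s).continuousAt.continuousWithinAt
    · exact fun s hs => (hd s).differentiableAt.differentiableWithinAt
    · intro s hs
      rw [interior_Icc] at hs
      rw [(hd s).deriv]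
      rw [Q_im a b x s lam q hq]
      have hs0 : 0 ≤ s := hs.1.le
      have h1 : 0 ≤ 2 * (x ^ 2 - s ^ 2) + b ^ 2 - a ^ 2 := by nlinarith [hs.2, sq_nonneg a, sq_nonneg b]
      have : 0 ≤ lam ^ 2 * (2 * x * s * (2 * (x ^ 2 - s ^ 2) + b ^ 2 - a ^ 2)) *
        ‖y (x + s * Complex.I)‖ ^ 2 := by positivity
      linarith
  have := hanti (Set.left_mem_Icc.2 ht) (Set.right_mem_Icc.2 ht) ht
  simp only [Complex.ofReal_zero, zero_mul, add_zero] at this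
  linarith

theorem eigen_integrable_line (a b lam : ℝ) (q y : ℂ → ℂ)
    (hq : ∀ z : ℂ, q z = (z ^ 2 - (a : ℂ) ^ 2) * (z ^ 2 + (b : ℂ) ^ 2))
    (h : IsEigen q lam y) (t : ℝ) (ht : 0 ≤ t) : ∃ X₀ : ℝ, ∀ X, X₀ ≤ X →
    IntegrableOn (fun x : ℝ => ‖deriv y (x + t * Complex.I)‖ ^ 2) (Set.Ioi X) ∧
    IntegrableOn (fun x : ℝ => ‖y (x + t * Complex.I)‖ ^ 2) (Set.Ioi X) := by
  obtain ⟨X₀, hX₀, hpos, hX⟩ := Q_large a b t lam h.1 q hq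
  refine ⟨X₀, fun X hXX => ?_⟩
  apply integrable_of_decay y (fun z => (lam : ℂ) ^ 2 * q z) h.2.1 h.2.2.2.1 t X
  · exact fun x hx => (hX x (hXX.trans hx)).2
  · intro x hx
    exact eigen_G_line a b lam q y hq h t ht x (by linarith) (hX x (hXX.trans hx)).1

theorem integrable_cross {u v : ℝ → ℂ} {X : ℝ} (hu : Continuous u) (hv : Continuous v)
    (h1 : IntegrableOn (fun x => ‖u x‖ ^ 2) (Set.Ioi X))
    (h2 : IntegrableOn (fun x => ‖v x‖ ^ 2) (Set.Ioi X)) :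
    IntegrableOn (fun x => u x * v x) (Set.Ioi X) := by
  refine Integrable.mono' (h1.add h2) (hu.mul hv).aestronglyMeasurable ?_
  filter_upwards with x
  simp only [Pi.add_apply, norm_mul]
  nlinarith [sq_nonneg (‖u x‖ - ‖v x‖), sq_nonneg (‖u x‖), sq_nonneg (‖v x‖)]

/-- Two eigenfunctions for the same `lam` are proportional. -/
theorem eigen_prop (a b lam : ℝ) (q y w : ℂ → ℂ)
    (hq : ∀ z : ℂ, q z = (z ^ 2 - (a : ℂ) ^ 2) * (z ^ 2 + (b : ℂ) ^ 2))
    (h : IsEigen q lam y) (h' : IsEigen q lam w) : ∃ c : ℂ, ∀ z, w z = c * y z := by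
  have hy := h.2.1
  have hw := h'.2.1
  set W : ℂ → ℂ := fun z => y z * deriv w z - deriv y z * w z with hW
  have hWd : ∀ z, HasDerivAt W 0 z := by
    intro z
    have h1 := ((hy z).hasDerivAt.mul (hw.deriv z).hasDerivAt).sub
      ((hy.deriv z).hasDerivAt.mul (hw z).hasDerivAt)
    rw [h.2.2.2.1, h'.2.2.2.1] at h1
    have e : deriv y z * deriv w z + y z * ((lam : ℂ) ^ 2 * q z * w z) -
      ((lam : ℂ) ^ 2 * q z * y z * w z + deriv y z * deriv w z) = 0 := by ring
    rw [e] at h1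
    exact h1
  have hWc : ∀ z z', W z = W z' :=
    is_const_of_deriv_eq_zero (fun z => (hWd z).differentiableAt) (fun z => (hWd z).deriv)
  have hW0 : ∀ z, W z = 0 := by
    obtain ⟨X1, hX1⟩ := eigen_integrable_line a b lam q y hq h 0 le_rfl
    obtain ⟨X2, hX2⟩ := eigen_integrable_line a b lam q w hq h' 0 le_rfl
    obtain ⟨i1, i2⟩ := hX1 (max X1 X2) (le_max_left _ _)
    obtain ⟨i3, i4⟩ := hX2 (max X1 X2) (le_max_right _ _)
    simp only [Complex.ofReal_zero, zero_mul, add_zero] at i1 i2 i3 i4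
    have c1 := hy.continuous
    have c2 := hy.deriv.continuous
    have c3 := hw.continuous
    have c4 := hw.deriv.continuous
    have j1 := integrable_cross (by fun_prop) (by fun_prop) i2 i3
    have j2 := integrable_cross (by fun_prop) (by fun_prop) i1 i4
    have j : IntegrableOn (fun x : ℝ => W x) (Set.Ioi (max X1 X2)) := j1.sub j2
    intro z
    by_contra hne
    refine not_integrable_of_lower (X := max X1 X2) (norm_pos_iff.2 hne) ?_ j.norm
    intro x _
    rw [hWc z x]
  obtain ⟨z₀, hz₀⟩ := h.2.2.1
  refine ⟨w z₀ / y z₀, ?_⟩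
  -- local constancy of the quotient
  have hev : ∀ᶠ z in 𝓝 z₀, y z ≠ 0 := hy.continuous.continuousAt.eventually_ne hz₀
  obtain ⟨r, hr, hball⟩ := Metric.eventually_nhds_iff_ball.1 hev
  have hloc : ∀ z ∈ Metric.ball z₀ r, w z = w z₀ / y z₀ * y z := by
    intro z hz
    have hd : ∀ z ∈ Metric.ball z₀ r, HasDerivAt (fun z => w z / y z) 0 z := by
      intro z hz
      have h1 := (hw z).hasDerivAt.div (hy z).hasDerivAt (hball z hz)
      have := hW0 z
      simp only [hW] at this
      have e : deriv w z * y z - w z * deriv y z = 0 := by linear_combination this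
      rw [e, zero_div] at h1
      exact h1
    have := Metric.isOpen_ball.is_const_of_deriv_eq_zero
      (convex_ball z₀ r).isPreconnected
      (fun z hz => (hd z hz).differentiableAt.differentiableWithinAt)
      (fun z hz => (hd z hz).deriv) hz (Metric.mem_ball_self hr)
    rw [← this, div_mul_cancel₀ _ (hball z hz)]
  have h1 : AnalyticOnNhd ℂ w Set.univ := fun z _ => hw.analyticAt z
  have h2 : AnalyticOnNhd ℂ (fun z => w z₀ / y z₀ * y z) Set.univ :=
    fun z _ => (hy.const_mul _).analyticAt z
  have := h1.eq_of_eventuallyEq h2 (z₀ := z₀)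
    (Filter.eventually_of_mem (Metric.ball_mem_nhds z₀ hr) hloc)
  exact fun z => congrFun this z

theorem eigen_neg (a b lam : ℝ) (q y : ℂ → ℂ)
    (hq : ∀ z : ℂ, q z = (z ^ 2 - (a : ℂ) ^ 2) * (z ^ 2 + (b : ℂ) ^ 2))
    (h : IsEigen q lam y) : IsEigen q lam (fun z => y (-z)) := by
  obtain ⟨hl, hy, ⟨z, hz⟩, hode, hI⟩ := h
  refine ⟨hl, hy.comp differentiable_neg, ⟨-z, by simpa using hz⟩, ?_, ?_⟩
  · intro z
    have h1 : deriv (fun z => y (-z)) = fun z => -deriv y (-z) := by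
      funext z; exact deriv_comp_neg y z
    rw [h1, deriv.fun_neg, deriv_comp_neg (deriv y) z, hode, hq, hq]
    ring
  · have := hI.comp_neg
    simpa using this

theorem eigen_conj (a b lam : ℝ) (q y : ℂ → ℂ)
    (hq : ∀ z : ℂ, q z = (z ^ 2 - (a : ℂ) ^ 2) * (z ^ 2 + (b : ℂ) ^ 2))
    (h : IsEigen q lam y) :
    IsEigen q lam (fun z => (starRingEnd ℂ) (y ((starRingEnd ℂ) z))) := by
  obtain ⟨hl, hy, ⟨z, hz⟩, hode, hI⟩ := h
  have hd : ∀ f : ℂ → ℂ, Differentiable ℂ f → ∀ z, HasDerivAt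
      (fun z => (starRingEnd ℂ) (f ((starRingEnd ℂ) z)))
      ((starRingEnd ℂ) (deriv f ((starRingEnd ℂ) z))) z := by
    intro f hf z
    have := (hf ((starRingEnd ℂ) z)).hasDerivAt.conj_conj
    simpa [Function.comp_def] using this
  refine ⟨hl, fun z => (hd y hy z).differentiableAt, ⟨(starRingEnd ℂ) z, by simpa using hz⟩, ?_, ?_⟩
  · intro z
    have h1 : deriv (fun z => (starRingEnd ℂ) (y ((starRingEnd ℂ) z))) =
        fun z => (starRingEnd ℂ) (deriv y ((starRingEnd ℂ) z)) := by
      funext z; exact (hd y hy z).deriv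
    rw [h1, (hd _ hy.deriv z).deriv, hode, hq, hq]
    simp
  · simpa using hI

/-- Reflection symmetries of an eigenfunction. -/
theorem eigen_symm (a b lam : ℝ) (q y : ℂ → ℂ)
    (hq : ∀ z : ℂ, q z = (z ^ 2 - (a : ℂ) ^ 2) * (z ^ 2 + (b : ℂ) ^ 2))
    (h : IsEigen q lam y) :
    (∀ z, ‖y (-z)‖ = ‖y z‖) ∧ (∀ z, ‖y ((starRingEnd ℂ) z)‖ = ‖y z‖) ∧
    (∃ c : ℂ, ∀ x : ℝ, (starRingEnd ℂ) (y x) = c * y x) ∧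
    (∃ c : ℂ, ∀ t : ℝ, (starRingEnd ℂ) (y (t * Complex.I)) = c * y (t * Complex.I)) := by
  obtain ⟨c, hc⟩ := eigen_prop a b lam q y _ hq h (eigen_neg a b lam q y hq h)
  obtain ⟨d, hd⟩ := eigen_prop a b lam q y _ hq h (eigen_conj a b lam q y hq h)
  obtain ⟨z₀, hz₀⟩ := h.2.2.1
  have hn0 : ‖y z₀‖ ≠ 0 := by simpa using hz₀
  have hc1 : ‖c‖ = 1 := by
    have h1 := congrArg norm (hc z₀)
    have h2 := congrArg norm (hc (-z₀))
    rw [neg_neg, norm_mul] at h2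
    rw [norm_mul] at h1
    rw [h1] at h2
    have : ‖c‖ * ‖c‖ = 1 := by
      have : ‖y z₀‖ * (‖c‖ * ‖c‖) = ‖y z₀‖ * 1 := by linarith
      exact mul_left_cancel₀ hn0 this
    nlinarith [norm_nonneg c]
  have hd1 : ‖d‖ = 1 := by
    have h1 := congrArg norm (hd z₀)
    have h2 := congrArg norm (hd ((starRingEnd ℂ) z₀))
    rw [Complex.conj_conj, norm_mul, RCLike.norm_conj] at h2
    rw [norm_mul, RCLike.norm_conj] at h1
    rw [h1] at h2
    have : ‖d‖ * ‖d‖ = 1 := by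
      have : ‖y z₀‖ * (‖d‖ * ‖d‖) = ‖y z₀‖ * 1 := by linarith
      exact mul_left_cancel₀ hn0 this
    nlinarith [norm_nonneg d]
  refine ⟨?_, ?_, ⟨d, ?_⟩, ⟨d * c, ?_⟩⟩
  · intro z; rw [hc z, norm_mul, hc1, one_mul]
  · intro z
    have := congrArg norm (hd z)
    rwa [RCLike.norm_conj, norm_mul, hd1, one_mul] at this
  · intro x; have := hd x; simpa using this
  · intro t
    have h1 := hd (-(t * Complex.I))
    have h2 : (starRingEnd ℂ) (-(t * Complex.I)) = t * Complex.I := by simp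
    rw [h2] at h1
    rw [h1, hc]; ring

theorem norm_v (y : ℂ → ℂ) (hy : Differentiable ℂ y) (x t : ℝ) :
    HasDerivAt (fun t : ℝ => ‖y (x + t * Complex.I)‖ ^ 2)
      (-2 * (BB y (x + t * Complex.I)).im) t := by
  have h1 := line_deriv_s1 y hy x Complex.I t
  have h2 := h1.norm_sq
  convert h2 using 1
  simp [BB, Complex.inner]
  ring

theorem even_deriv_zero {g : ℝ → ℝ} {d : ℝ} (hg : HasDerivAt g d 0) (he : ∀ x, g (-x) = g x) :
    d = 0 := by
  have h1 : HasDerivAt (fun x => g (-x)) (-d) 0 := by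
    have := HasDerivAt.scomp (0 : ℝ) (h := fun x : ℝ => -x) (g₁ := g) (g₁' := d) (h' := -1)
      (by simpa using hg) (hasDerivAt_neg 0)
    simpa [Function.comp_def] using this
  have h2 : (fun x => g (-x)) = g := funext he
  rw [h2] at h1
  have := h1.unique hg
  linarith

theorem eigen_F_real_axis (a b lam : ℝ) (q y : ℂ → ℂ)
    (hq : ∀ z : ℂ, q z = (z ^ 2 - (a : ℂ) ^ 2) * (z ^ 2 + (b : ℂ) ^ 2))
    (h : IsEigen q lam y) (x : ℝ) : (BB y (x + (0 : ℝ) * Complex.I)).im = 0 := by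
  have h1 := norm_v y h.2.1 x 0
  have := even_deriv_zero h1 (by
    intro t
    have := (eigen_symm a b lam q y hq h).2.1 (x + t * Complex.I)
    rw [← this]
    simp)
  linarith

theorem eigen_G_imag_axis (a b lam : ℝ) (q y : ℂ → ℂ)
    (hq : ∀ z : ℂ, q z = (z ^ 2 - (a : ℂ) ^ 2) * (z ^ 2 + (b : ℂ) ^ 2))
    (h : IsEigen q lam y) (t : ℝ) : (BB y ((0 : ℝ) + t * Complex.I)).re = 0 := by
  have h1 := norm_h y h.2.1 t 0
  have := even_deriv_zero h1 (by
    intro x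
    have h2 := (eigen_symm a b lam q y hq h).2.1 (x + t * Complex.I)
    have h3 := (eigen_symm a b lam q y hq h).1 ((starRingEnd ℂ) (x + t * Complex.I))
    rw [← h2, ← h3]
    have e : -(starRingEnd ℂ) (x + t * Complex.I) = ((-x : ℝ) : ℂ) + t * Complex.I := by
      apply Complex.ext <;> simp
    rw [e])
  linarith

/-- In the region to the right of the hyperbola the quantity `F` is nonpositive. -/
theorem eigen_F_right (a b lam : ℝ) (q y : ℂ → ℂ)
    (hq : ∀ z : ℂ, q z = (z ^ 2 - (a : ℂ) ^ 2) * (z ^ 2 + (b : ℂ) ^ 2))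
    (h : IsEigen q lam y) (x₀ t₀ : ℝ) (hx₀ : 0 ≤ x₀) (ht₀ : 0 ≤ t₀)
    (hr : 0 ≤ 2 * (x₀ ^ 2 - t₀ ^ 2) + b ^ 2 - a ^ 2) :
    (∀ x, x₀ ≤ x → (BB y (x + t₀ * Complex.I)).im ≤ 0) ∧
    MonotoneOn (fun x : ℝ => (BB y (x + t₀ * Complex.I)).im) (Set.Ici x₀) := by
  obtain ⟨X₀, hX₀⟩ := eigen_integrable_line a b lam q y hq h t₀ ht₀
  have hy := h.2.1
  have hd := F_h y (fun z => (lam : ℂ) ^ 2 * q z) hy h.2.2.2.1 t₀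
  have hmono : MonotoneOn (fun x : ℝ => (BB y (x + t₀ * Complex.I)).im) (Set.Ici x₀) := by
    apply monotoneOn_of_deriv_nonneg (convex_Ici x₀)
    · exact fun s hs => (hd s).continuousAt.continuousWithinAt
    · exact fun s hs => (hd s).differentiableAt.differentiableWithinAt
    · intro s hs
      rw [interior_Ici] at hs
      rw [(hd s).deriv]
      rw [Q_im a b s t₀ lam q hq]
      have hs' : x₀ < s := hs
      have hs0 : 0 ≤ s := by linarith
      have h1 : 0 ≤ 2 * (s ^ 2 - t₀ ^ 2) + b ^ 2 - a ^ 2 := by nlinarith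
      positivity
  refine ⟨?_, hmono⟩
  intro x hx
  by_contra hcon
  push Not at hcon
  set X := max X₀ x with hX
  obtain ⟨i1, i2⟩ := hX₀ X (le_max_left _ _)
  have c1 := hy.continuous
  have c2 := hy.deriv.continuous
  have j : IntegrableOn (fun s : ℝ => (starRingEnd ℂ) (y (s + t₀ * Complex.I)) *
      deriv y (s + t₀ * Complex.I)) (Set.Ioi X) := by
    apply integrable_cross
    · exact Complex.continuous_conj.comp (by fun_prop)
    · fun_prop
    · simpa using i2
    · exact i1
  refine not_integrable_of_lower (X := X) hcon ?_ j.im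
  intro s hs
  have hxs : x ≤ s := (le_max_right X₀ x).trans hs.le
  exact hmono (Set.mem_Ici.2 hx) (Set.mem_Ici.2 (hx.trans hxs)) hxs

theorem eigen_quadrant (a b lam : ℝ) (ha : 0 < a) (hb : 0 < b) (q y : ℂ → ℂ)
    (hq : ∀ z : ℂ, q z = (z ^ 2 - (a : ℂ) ^ 2) * (z ^ 2 + (b : ℂ) ^ 2))
    (h : IsEigen q lam y) (x₀ t₀ : ℝ) (hx₀ : 0 < x₀) (ht₀ : 0 < t₀) :
    y (x₀ + t₀ * Complex.I) ≠ 0 := by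
  intro hz
  have hy := h.2.1
  have hl := h.1
  obtain ⟨w, hw⟩ := h.2.2.1
  have hBB0 : BB y (x₀ + t₀ * Complex.I) = 0 := by simp [BB, hz]
  rcases le_or_gt 0 (2 * (x₀ ^ 2 - t₀ ^ 2) + b ^ 2 - a ^ 2) with hr | hr
  · -- right region
    obtain ⟨hF, hmono⟩ := eigen_F_right a b lam q y hq h x₀ t₀ hx₀.le ht₀.le hr
    have hflat := flat_of_deriv_nonneg (α := x₀) (β := x₀ + 1)
      (fun s _ => F_h y (fun z => (lam : ℂ) ^ 2 * q z) hy h.2.2.2.1 t₀ s)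
      (by
        intro s hs
        rw [Q_im a b s t₀ lam q hq]
        have hs' : x₀ < s := hs.1
        have hs0 : 0 ≤ s := by linarith
        have h1 : 0 ≤ 2 * (s ^ 2 - t₀ ^ 2) + b ^ 2 - a ^ 2 := by nlinarith
        positivity)
      (by
        rw [hBB0]
        exact hF _ (by linarith))
    refine hw (entire_zero_of_segment y hy (t₀ * Complex.I) 1 one_ne_zero x₀ (x₀ + 1) (by linarith)
      ?_ w)
    intro s hs
    have h1 := hflat s hs
    rw [Q_im a b s t₀ lam q hq] at h1
    have hs' : x₀ < s := hs.1
    have hs0 : 0 < s := by linarith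
    have h2 : 0 < 2 * (s ^ 2 - t₀ ^ 2) + b ^ 2 - a ^ 2 := by nlinarith
    have h3 : lam ^ 2 * (2 * s * t₀ * (2 * (s ^ 2 - t₀ ^ 2) + b ^ 2 - a ^ 2)) ≠ 0 := by positivity
    have h4 := (mul_eq_zero.1 h1).resolve_left h3
    rw [mul_one, add_comm]
    simpa using h4
  rcases le_or_gt ((x₀ ^ 2 - t₀ ^ 2 - a ^ 2) * (x₀ ^ 2 - t₀ ^ 2 + b ^ 2) - 4 * x₀ ^ 2 * t₀ ^ 2) 0
    with hA | hB
  · -- vertical motion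
    obtain ⟨T, hT0, hTt, hFT, hTq⟩ : ∃ T : ℝ, 0 ≤ T ∧ T < t₀ ∧
        (BB y (x₀ + T * Complex.I)).im ≤ 0 ∧
        (x₀ ^ 2 - T ^ 2 - a ^ 2) * (x₀ ^ 2 - T ^ 2 + b ^ 2) - 4 * x₀ ^ 2 * T ^ 2 ≤ 0 := by
      rcases le_or_gt 0 (2 * x₀ ^ 2 + b ^ 2 - a ^ 2) with h1 | h1
      · set T := Real.sqrt ((2 * x₀ ^ 2 + b ^ 2 - a ^ 2) / 2) with hT
        have hT2 : T ^ 2 = (2 * x₀ ^ 2 + b ^ 2 - a ^ 2) / 2 := Real.sq_sqrt (by linarith)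
        refine ⟨T, Real.sqrt_nonneg _, ?_, ?_, ?_⟩
        · apply lt_of_pow_lt_pow_left₀ 2 ht₀.le
          linarith
        · exact (eigen_F_right a b lam q y hq h x₀ T hx₀.le (Real.sqrt_nonneg _)
            (by linarith)).1 x₀ le_rfl
        · have h2 : (x₀ ^ 2 - T ^ 2 - a ^ 2) * (x₀ ^ 2 - T ^ 2 + b ^ 2) =
            - ((a ^ 2 + b ^ 2) / 2) ^ 2 := by rw [hT2]; ring
          rw [h2]
          have : 0 ≤ 4 * x₀ ^ 2 * T ^ 2 := by positivity
          nlinarith [sq_nonneg ((a ^ 2 + b ^ 2) / 2)]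
      · refine ⟨0, le_rfl, ht₀, (eigen_F_real_axis a b lam q y hq h x₀).le, ?_⟩
        have h2 : x₀ ^ 2 - a ^ 2 ≤ 0 := by nlinarith [sq_nonneg a, sq_nonneg b]
        have h3 : 0 ≤ x₀ ^ 2 + b ^ 2 := by positivity
        nlinarith
    have hQneg : ∀ s ∈ Set.Ioo T t₀,
        (x₀ ^ 2 - s ^ 2 - a ^ 2) * (x₀ ^ 2 - s ^ 2 + b ^ 2) - 4 * x₀ ^ 2 * s ^ 2 ≤ 0 := by
      intro s hs
      have e1 : T ^ 2 < s ^ 2 := by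
        have := hs.1; gcongr
      have e2 : s ^ 2 < t₀ ^ 2 := by
        have := hs.2; have := hs.1; gcongr; linarith
      -- convexity in the squared variable
      generalize s ^ 2 = S at *
      generalize T ^ 2 = A at *
      generalize t₀ ^ 2 = C at *
      generalize x₀ ^ 2 = Z at *
      have key : (C - A) * ((Z - S - a ^ 2) * (Z - S + b ^ 2) - 4 * Z * S) =
        (C - S) * ((Z - A - a ^ 2) * (Z - A + b ^ 2) - 4 * Z * A) +
        (S - A) * ((Z - C - a ^ 2) * (Z - C + b ^ 2) - 4 * Z * C) -
        (S - A) * (C - S) * (C - A) := by ring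
      have k1 := mul_nonpos_of_nonneg_of_nonpos (show 0 ≤ C - S by linarith) hTq
      have k2 := mul_nonpos_of_nonneg_of_nonpos (show 0 ≤ S - A by linarith) hA
      have k3 : 0 ≤ (S - A) * (C - S) * (C - A) :=
        mul_nonneg (mul_nonneg (by linarith) (by linarith)) (by linarith)
      by_contra hcon
      push Not at hcon
      have := mul_pos (show 0 < C - A by linarith) hcon
      linarith
    have hflat := flat_of_deriv_nonneg (α := T) (β := t₀)
      (fun s _ => (F_v y (fun z => (lam : ℂ) ^ 2 * q z) hy h.2.2.2.1 x₀ s).neg)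
      (by
        intro s hs
        rw [Q_re a b x₀ s lam q hq]
        have h1 := hQneg s hs
        have h2 := mul_nonneg (mul_nonneg (sq_nonneg lam) (neg_nonneg.2 h1))
          (sq_nonneg ‖y (x₀ + s * Complex.I)‖)
        have h3 := sq_nonneg ‖deriv y (x₀ + s * Complex.I)‖
        linarith)
      (by
        simp only [Pi.neg_apply, hBB0]
        simpa using hFT)
    refine hw (entire_zero_of_deriv_segment y hy x₀ Complex.I Complex.I_ne_zero T t₀ hTt
      ?_ _ hz w)
    intro s hs
    have h0 := hflat s hs
    rw [Q_re a b x₀ s lam q hq] at h0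
    have h1 := hQneg s hs
    have h2 := mul_nonneg (mul_nonneg (sq_nonneg lam) (neg_nonneg.2 h1))
          (sq_nonneg ‖y (x₀ + s * Complex.I)‖)
    have h3 := sq_nonneg ‖deriv y (x₀ + s * Complex.I)‖
    have h4 : ‖deriv y (x₀ + s * Complex.I)‖ ^ 2 = 0 := by linarith
    simpa using h4
  · -- horizontal motion from the imaginary axis
    have hQpos : ∀ s ∈ Set.Ioo 0 x₀,
        0 ≤ (s ^ 2 - t₀ ^ 2 - a ^ 2) * (s ^ 2 - t₀ ^ 2 + b ^ 2) - 4 * s ^ 2 * t₀ ^ 2 := by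
      intro s hs
      have e2 : s ^ 2 < x₀ ^ 2 := by
        have := hs.2; have := hs.1; gcongr
      have e3 := sq_nonneg t₀
      generalize s ^ 2 = S at *
      generalize t₀ ^ 2 = C at *
      generalize x₀ ^ 2 = Z at *
      have key : (S - C - a ^ 2) * (S - C + b ^ 2) - 4 * S * C =
        ((Z - C - a ^ 2) * (Z - C + b ^ 2) - 4 * Z * C) +
        (Z - S) * (4 * C - (2 * (Z - C) + b ^ 2 - a ^ 2) + (Z - S)) := by ring
      rw [key]
      have := mul_nonneg (show 0 ≤ Z - S by linarith)
        (show 0 ≤ 4 * C - (2 * (Z - C) + b ^ 2 - a ^ 2) + (Z - S) by linarith)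
      linarith
    have hflat := flat_of_deriv_nonneg (α := 0) (β := x₀)
      (fun s _ => (G_h y (fun z => (lam : ℂ) ^ 2 * q z) hy h.2.2.2.1 t₀ s))
      (by
        intro s hs
        rw [Q_re a b s t₀ lam q hq]
        have h1 := hQpos s hs
        positivity)
      (by
        rw [hBB0, eigen_G_imag_axis a b lam q y hq h t₀]
        simp)
    refine hw (entire_zero_of_deriv_segment y hy (t₀ * Complex.I) 1 one_ne_zero 0 x₀ hx₀
      ?_ _ hz w)
    intro s hs
    have h0 := hflat s hs
    rw [Q_re a b s t₀ lam q hq] at h0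
    have h1 := hQpos s hs
    have h2 := mul_nonneg (mul_nonneg (sq_nonneg lam) h1)
          (sq_nonneg ‖y (s + t₀ * Complex.I)‖)
    have h3 := sq_nonneg ‖deriv y (s + t₀ * Complex.I)‖
    have h4 : ‖deriv y (s + t₀ * Complex.I)‖ ^ 2 = 0 := by linarith
    rw [mul_one, add_comm]
    simpa using h4

/-- All zeros of an eigenfunction lie on the coordinate axes. -/
theorem eigen_zeros_axes (a b lam : ℝ) (ha : 0 < a) (hb : 0 < b) (q y : ℂ → ℂ)
    (hq : ∀ z : ℂ, q z = (z ^ 2 - (a : ℂ) ^ 2) * (z ^ 2 + (b : ℂ) ^ 2))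
    (h : IsEigen q lam y) (z : ℂ) (hz : y z = 0) : z.im = 0 ∨ z.re = 0 := by
  by_contra hcon
  push Not at hcon
  obtain ⟨h1, h2⟩ := hcon
  obtain ⟨s1, s2, -, -⟩ := eigen_symm a b lam q y hq h
  apply eigen_quadrant a b lam ha hb q y hq h |z.re| |z.im| (abs_pos.2 h2) (abs_pos.2 h1)
  have n0 : ‖y z‖ = 0 := by simp [hz]
  have n1 : ‖y (-z)‖ = 0 := by rw [s1, n0]
  have n2 : ‖y ((starRingEnd ℂ) z)‖ = 0 := by rw [s2, n0]
  have n3 : ‖y (-(starRingEnd ℂ) z)‖ = 0 := by rw [s1, n2]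
  rw [← norm_eq_zero]
  rcases abs_cases z.re with ⟨e1, _⟩ | ⟨e1, _⟩ <;> rcases abs_cases z.im with ⟨e2, _⟩ | ⟨e2, _⟩ <;>
    rw [e1, e2]
  · rw [Complex.re_add_im]; exact n0
  · have e : (z.re : ℂ) + ((-z.im : ℝ) : ℂ) * Complex.I = (starRingEnd ℂ) z := by
      apply Complex.ext <;> simp
    rw [e]; exact n2
  · have e : ((-z.re : ℝ) : ℂ) + (z.im : ℂ) * Complex.I = -(starRingEnd ℂ) z := by
      apply Complex.ext <;> simp
    rw [e]; exact n3
  · have e : ((-z.re : ℝ) : ℂ) + ((-z.im : ℝ) : ℂ) * Complex.I = -z := by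
      apply Complex.ext <;> simp
    rw [e]; exact n1

/-- Sturm-Picone comparison. -/
theorem sturm_picone {f f1 g g1 A B : ℝ → ℝ} {α β : ℝ}
    (hf : ∀ s ∈ Set.Icc α β, HasDerivAt f (f1 s) s)
    (hf1 : ∀ s ∈ Set.Icc α β, HasDerivAt f1 (-A s * f s) s)
    (hg : ∀ s ∈ Set.Icc α β, HasDerivAt g (g1 s) s)
    (hg1 : ∀ s ∈ Set.Icc α β, HasDerivAt g1 (-B s * g s) s)
    (hAB : ∀ s ∈ Set.Icc α β, A s ≤ B s) (hg0 : ∀ s ∈ Set.Icc α β, g s ≠ 0)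
    (hα : f α = 0) (hβ : f β = 0) : ∀ s ∈ Set.Icc α β, f s = 0 := by
  have hK : ∀ s ∈ Set.Icc α β, HasDerivAt (fun x => f x * f1 x - f x ^ 2 * (g1 x / g x))
      ((f1 s - f s * (g1 s / g s)) ^ 2 + (B s - A s) * f s ^ 2) s := by
    intro s hs
    have h0 := hg0 s hs
    have h1 := ((hf s hs).mul (hf1 s hs)).sub
      (((hf s hs).pow 2).mul ((hg1 s hs).div (hg s hs) h0))
    refine h1.congr_deriv ?_
    simp
    field_simp
    ring
  have hflat := flat_of_deriv_nonneg hK (by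
    intro s hs
    have := hAB s (Set.Ioo_subset_Icc_self hs)
    have h2 : 0 ≤ B s - A s := by linarith
    positivity) (by simp [hα, hβ])
  have hq : ∀ s ∈ Set.Icc α β, HasDerivAt (fun x => f x / g x)
      ((f1 s * g s - f s * g1 s) / g s ^ 2) s := fun s hs => (hf s hs).div (hg s hs) (hg0 s hs)
  intro s hs
  rcases eq_or_lt_of_le hs.1 with he | hlt
  · rw [← he]; exact hα
  obtain ⟨c, hc, hce⟩ := exists_hasDerivAt_eq_slope (fun x => f x / g x) _ hlt
    (fun x hx => (hq x ⟨hx.1, hx.2.trans hs.2⟩).continuousAt.continuousWithinAt)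
    (fun x hx => hq x ⟨hx.1.le, hx.2.le.trans hs.2⟩)
  have hcI : c ∈ Set.Ioo α β := ⟨hc.1, hc.2.trans_le hs.2⟩
  have h0 := hg0 c (Set.Ioo_subset_Icc_self hcI)
  have hz : (f1 c * g c - f c * g1 c) = 0 := by
    have h1 := hflat c hcI
    have h2 : 0 ≤ B c - A c := by linarith [hAB c (Set.Ioo_subset_Icc_self hcI)]
    have h3 : 0 ≤ (B c - A c) * f c ^ 2 := by positivity
    have h4 : f1 c - f c * (g1 c / g c) = 0 := by
      have := sq_nonneg (f1 c - f c * (g1 c / g c))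
      have : (f1 c - f c * (g1 c / g c)) ^ 2 = 0 := by linarith
      simpa using this
    field_simp at h4
    linarith
  rw [hz, zero_div, hα, zero_div, sub_zero, eq_comm, div_eq_zero_iff] at hce
  rcases hce with h | h
  · exact (div_eq_zero_iff.1 h).resolve_right (hg0 s hs)
  · linarith

theorem sin_deriv1 (ω c : ℝ) (s : ℝ) :
    HasDerivAt (fun x => Real.sin (ω * x + c)) (ω * Real.cos (ω * s + c)) s := by
  have h : HasDerivAt (fun x : ℝ => ω * x + c) ω s := by
    simpa using ((hasDerivAt_id s).const_mul ω).add_const c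
  have := h.sin
  rwa [mul_comm] at this

theorem sin_deriv2 (ω c : ℝ) (s : ℝ) :
    HasDerivAt (fun x => ω * Real.cos (ω * x + c)) (-ω ^ 2 * Real.sin (ω * s + c)) s := by
  have h : HasDerivAt (fun x : ℝ => ω * x + c) ω s := by
    simpa using ((hasDerivAt_id s).const_mul ω).add_const c
  have := h.cos.const_mul ω
  refine this.congr_deriv ?_
  ring

/-- A real solution of the second order equation with coefficient -lam² p not vanishing on any interval. -/
def RealSol (p : ℝ → ℝ) (lam : ℝ) (Y : ℝ → ℝ) : Prop :=
  0 < lam ∧ (∀ α β : ℝ, α < β → ∃ x ∈ Set.Icc α β, Y x ≠ 0) ∧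
  ∃ Y1 : ℝ → ℝ, (∀ x, HasDerivAt Y (Y1 x) x) ∧ ∀ x, HasDerivAt Y1 (-(lam ^ 2 * p x) * Y x) x

theorem zero_gap {p : ℝ → ℝ} {lam : ℝ} {Y : ℝ → ℝ} (h : RealSol p lam Y) {α β σ : ℝ}
    (hσ : 0 < σ) (hαβ : α < β) (hp : ∀ x ∈ Set.Icc α β, p x ≤ σ ^ 2)
    (hα : Y α = 0) (hβ : Y β = 0) : Real.pi / (lam * σ) ≤ β - α := by
  obtain ⟨hl, hne, Y1, hY, hY1⟩ := h
  by_contra hcon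
  push Not at hcon
  set ω := lam * σ with hω
  have hω0 : 0 < ω := by positivity
  have hlt : ω * (β - α) < Real.pi := by
    rw [lt_div_iff₀ hω0] at hcon; linarith
  set η := (Real.pi - ω * (β - α)) / 2 with hη
  obtain ⟨x, hx, hxne⟩ := hne α β hαβ
  apply hxne
  refine sturm_picone (f := Y) (f1 := Y1) (A := fun x => lam ^ 2 * p x) (B := fun _ => ω ^ 2)
    (fun s _ => hY s) (fun s _ => hY1 s) (fun s _ => sin_deriv1 ω (η - ω * α) s)
    (fun s _ => sin_deriv2 ω (η - ω * α) s) ?_ ?_ hα hβ x hx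
  · intro s hs
    have := hp s hs
    rw [hω, mul_pow]
    gcongr
  · intro s hs
    apply ne_of_gt
    have h1 : ω * α ≤ ω * s := by have := hs.1; gcongr
    have h2 : ω * s ≤ ω * β := by have := hs.2; gcongr
    apply Real.sin_pos_of_pos_of_lt_pi
    · linarith
    · linarith

theorem zero_exists {p : ℝ → ℝ} {lam : ℝ} {Y : ℝ → ℝ} (h : RealSol p lam Y) {α σ : ℝ}
    (hσ : 0 < σ)
    (hp : ∀ x ∈ Set.Icc α (α + Real.pi / (lam * σ)), σ ^ 2 ≤ p x) :
    ∃ x ∈ Set.Icc α (α + Real.pi / (lam * σ)), Y x = 0 := by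
  obtain ⟨hl, hne, Y1, hY, hY1⟩ := h
  by_contra hcon
  push Not at hcon
  set ω := lam * σ with hω
  have hω0 : 0 < ω := by positivity
  have hπ := Real.pi_pos
  have hm : α + Real.pi / ω / 2 ∈ Set.Icc α (α + Real.pi / ω) := by
    have : 0 < Real.pi / ω := by positivity
    constructor <;> linarith
  have := sturm_picone (f := fun x => Real.sin (ω * x + (- ω * α)))
    (g := Y) (g1 := Y1) (B := fun x => lam ^ 2 * p x) (A := fun _ => ω ^ 2)
    (fun s _ => sin_deriv1 ω (-ω * α) s)
    (fun s _ => sin_deriv2 ω (-ω * α) s) (fun s _ => hY s) (fun s _ => hY1 s)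
    (fun s hs => by
      have := hp s hs
      rw [hω, mul_pow]
      gcongr)
    hcon (by simp) (by
      have e : ω * (α + Real.pi / ω) + -ω * α = Real.pi := by field_simp; ring
      rw [e]; simp) _ hm
  have e : ω * (α + Real.pi / ω / 2) + -ω * α = Real.pi / 2 := by field_simp; ring
  rw [e, Real.sin_pi_div_two] at this
  exact one_ne_zero this

/-- The zeros in a half-open interval. -/
def zset (Y : ℝ → ℝ) (c d : ℝ) : Set ℝ := {x | x ∈ Set.Ioc c d ∧ Y x = 0}

theorem count_upper {p : ℝ → ℝ} {lam : ℝ} {Y : ℝ → ℝ} (h : RealSol p lam Y) {c d σ : ℝ}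
    (hσ : 0 < σ) (hcd : c ≤ d) (hp : ∀ x ∈ Set.Icc c d, p x ≤ σ ^ 2) :
    (zset Y c d).Finite ∧ ((zset Y c d).ncard : ℝ) ≤ (d - c) * (lam * σ) / Real.pi + 1 := by
  have hl := h.1
  have hπ := Real.pi_pos
  have hω0 : 0 < lam * σ := by positivity
  set δ := Real.pi / (lam * σ) with hδ
  have hδ0 : 0 < δ := by positivity
  set F : ℝ → ℕ := fun x => ⌊(x - c) / δ⌋₊ with hF
  have hinj : Set.InjOn F (zset Y c d) := by
    have key : ∀ x ∈ zset Y c d, ∀ x' ∈ zset Y c d, x < x' → F x ≠ F x' := by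
      intro x hx x' hx' hlt he
      have hgap := zero_gap h hσ hlt
        (fun s hs => hp s ⟨hx.1.1.le.trans hs.1, hs.2.trans hx'.1.2⟩) hx.2 hx'.2
      have h1 : (x - c) / δ + 1 ≤ (x' - c) / δ := by
        rw [div_add_one hδ0.ne']
        gcongr
        linarith
      have h0 : 0 ≤ (x - c) / δ := div_nonneg (by linarith [hx.1.1]) hδ0.le
      have h2 := Nat.floor_mono h1
      rw [Nat.floor_add_one h0] at h2
      simp only [hF] at he
      omega
    intro x hx x' hx' he
    rcases lt_trichotomy x x' with h1 | h1 | h1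
    · exact absurd he (key x hx x' hx' h1)
    · exact h1
    · exact absurd he.symm (key x' hx' x hx h1)
  set N := ⌊(d - c) / δ⌋₊ with hN
  have hmaps : Set.MapsTo F (zset Y c d) (Finset.range (N + 1) : Set ℕ) := by
    intro x hx
    simp only [Finset.coe_range, Set.mem_Iio, Nat.lt_succ_iff, hF, hN]
    apply Nat.floor_mono
    have := hx.1.2
    gcongr
  have hfin : (zset Y c d).Finite :=
    Set.Finite.of_injOn hmaps hinj (Finset.finite_toSet _)
  refine ⟨hfin, ?_⟩
  have hcard : (zset Y c d).ncard ≤ N + 1 := by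
    have := Set.ncard_le_ncard_of_injOn F hmaps hinj (Finset.finite_toSet _)
    rwa [Set.ncard_coe_finset, Finset.card_range] at this
  calc ((zset Y c d).ncard : ℝ) ≤ (N : ℝ) + 1 := by exact_mod_cast hcard
    _ ≤ (d - c) / δ + 1 := by
      gcongr
      exact Nat.floor_le (div_nonneg (by linarith) hδ0.le)
    _ = _ := by rw [hδ]; field_simp

theorem count_lower {p : ℝ → ℝ} {lam : ℝ} {Y : ℝ → ℝ} (h : RealSol p lam Y) {c d σ : ℝ}
    (hσ : 0 < σ) (hcd : c < d) (hp : ∀ x ∈ Set.Icc c d, σ ^ 2 ≤ p x)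
    (hfin : (zset Y c d).Finite) :
    (d - c) * (lam * σ) / Real.pi - 1 ≤ ((zset Y c d).ncard : ℝ) := by
  have hl := h.1
  have hπ := Real.pi_pos
  have hω0 : 0 < lam * σ := by positivity
  set X := (d - c) * (lam * σ) / Real.pi with hX
  have hX0 : 0 < X := by have : 0 < d - c := by linarith
                         positivity
  obtain ⟨n, hn⟩ : ∃ n, ⌈X⌉₊ = n + 1 := Nat.exists_eq_succ_of_ne_zero (Nat.ceil_pos.2 hX0).ne'
  have hnX : (n : ℝ) < X := by
    have : n < ⌈X⌉₊ := by omega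
    exact Nat.lt_ceil.1 this
  have hXn : X - 1 ≤ n := by
    have := Nat.le_ceil X
    rw [hn] at this
    push_cast at this
    linarith
  suffices hs : n ≤ (zset Y c d).ncard by
    have : (n : ℝ) ≤ ((zset Y c d).ncard : ℝ) := by exact_mod_cast hs
    linarith
  rcases Nat.eq_zero_or_pos n with h0 | hnpos
  · rw [h0]; exact Nat.zero_le _
  have hn0 : (0 : ℝ) < n := by exact_mod_cast hnpos
  set ℓ := (d - c) / n with hℓ
  have hℓn : n * ℓ = d - c := by rw [hℓ]; field_simp
  have hℓ0 : 0 < ℓ := div_pos (by linarith) hn0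
  have hℓlt : Real.pi / (lam * σ) < ℓ := by
    rw [hℓ, div_lt_div_iff₀ hω0 hn0]
    rw [hX, lt_div_iff₀ hπ] at hnX
    linarith
  have hex : ∀ k : ℕ, k < n → ∃ x, x ∈ Set.Ioc (c + k * ℓ) (c + (k + 1) * ℓ) ∧ Y x = 0 := by
    intro k hk
    have hk1 : ((k : ℝ) + 1) ≤ n := by exact_mod_cast hk
    have hk2 : ((k : ℝ) + 1) * ℓ ≤ n * ℓ := by gcongr
    have hk0 : 0 ≤ (k : ℝ) * ℓ := by positivity
    have hw : 0 < Real.pi / (lam * σ) := by positivity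
    obtain ⟨x, hx, hx0⟩ := zero_exists h (α := c + (k + 1) * ℓ - Real.pi / (lam * σ)) hσ (by
      intro s hs
      apply hp s
      have h1 := hs.1
      have h2 := hs.2
      constructor
      · nlinarith
      · linarith)
    refine ⟨x, ⟨?_, ?_⟩, hx0⟩
    · have := hx.1
      nlinarith
    · have := hx.2
      linarith
  choose! Z hZ hZ0 using hex
  have hmaps : Set.MapsTo Z (Finset.range n : Set ℕ) (zset Y c d) := by
    intro k hk
    have hk' : k < n := by simpa using hk
    refine ⟨⟨?_, ?_⟩, hZ0 k hk'⟩
    · have := (hZ k hk').1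
      have : 0 ≤ (k : ℝ) * ℓ := by positivity
      linarith
    · have := (hZ k hk').2
      have hk1 : ((k : ℝ) + 1) ≤ n := by exact_mod_cast hk'
      have hk2 : ((k : ℝ) + 1) * ℓ ≤ n * ℓ := by gcongr
      linarith
  have hinj : Set.InjOn Z (Finset.range n : Set ℕ) := by
    have key : ∀ k k' : ℕ, k < n → k' < n → k < k' → Z k ≠ Z k' := by
      intro k k' hk hk' hlt he
      have h1 := (hZ k hk).2
      have h2 := (hZ k' hk').1
      have h3 : ((k : ℝ) + 1) ≤ k' := by exact_mod_cast hlt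
      have h4 : ((k : ℝ) + 1) * ℓ ≤ k' * ℓ := by gcongr
      linarith
    intro k hk k' hk' he
    have hk1 : k < n := by simpa using hk
    have hk1' : k' < n := by simpa using hk'
    rcases lt_trichotomy k k' with h1 | h1 | h1
    · exact absurd he (key k k' hk1 hk1' h1)
    · exact h1
    · exact absurd he.symm (key k' k hk1' hk1 h1)
  have := Set.ncard_le_ncard_of_injOn Z hmaps hinj hfin
  rwa [Set.ncard_coe_finset, Finset.card_range] at this

/-- Two-sided counting estimate on a small cell. -/
theorem count_cell {p : ℝ → ℝ} {lam : ℝ} {Y : ℝ → ℝ} (h : RealSol p lam Y) {c d s ε : ℝ}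
    (hs : 0 ≤ s) (hε : 0 < ε) (hcd : c < d)
    (hp : ∀ x ∈ Set.Icc c d, |Real.sqrt (p x) - s| ≤ ε) :
    (zset Y c d).Finite ∧
      |((zset Y c d).ncard : ℝ) / lam - s * (d - c) / Real.pi| ≤ ε * (d - c) + 1 / lam := by
  have hl := h.1
  have hπ := Real.pi_pos
  have hd : 0 < d - c := by linarith
  obtain ⟨hfin, hup⟩ := count_upper h (σ := s + ε) (by linarith) hcd.le (by
    intro x hx
    have := (abs_le.1 (hp x hx)).2
    have h1 : Real.sqrt (p x) ≤ s + ε := by linarith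
    exact (Real.sqrt_le_iff.1 h1).2)
  refine ⟨hfin, ?_⟩
  have hlow : (d - c) * (lam * (s - ε)) / Real.pi - 1 ≤ ((zset Y c d).ncard : ℝ) := by
    rcases lt_or_ge ε s with h1 | h1
    · apply count_lower h (by linarith) hcd _ hfin
      intro x hx
      have h2 := (abs_le.1 (hp x hx)).1
      have h3 : s - ε ≤ Real.sqrt (p x) := by linarith
      exact (Real.le_sqrt' (by linarith)).1 h3
    · have : (d - c) * (lam * (s - ε)) / Real.pi ≤ 0 := by
        apply div_nonpos_of_nonpos_of_nonneg _ hπ.le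
        apply mul_nonpos_of_nonneg_of_nonpos hd.le
        apply mul_nonpos_of_nonneg_of_nonpos hl.le
        linarith
      have h2 : (0 : ℝ) ≤ ((zset Y c d).ncard : ℝ) := by positivity
      linarith
  have hπ1 : ε * (d - c) / Real.pi ≤ ε * (d - c) := by
    apply div_le_self (by positivity)
    linarith [Real.pi_gt_three]
  have e1 : ((d - c) * (lam * (s + ε)) / Real.pi + 1) / lam =
      s * (d - c) / Real.pi + ε * (d - c) / Real.pi + 1 / lam := by field_simp
  have e2 : ((d - c) * (lam * (s - ε)) / Real.pi - 1) / lam =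
      s * (d - c) / Real.pi - ε * (d - c) / Real.pi - 1 / lam := by field_simp
  have u1 : ((zset Y c d).ncard : ℝ) / lam ≤ _ := div_le_div_of_nonneg_right hup hl.le
  have u2 : _ ≤ ((zset Y c d).ncard : ℝ) / lam := div_le_div_of_nonneg_right hlow hl.le
  rw [e1] at u1
  rw [e2] at u2
  rw [abs_le]
  constructor <;> linarith

theorem sum_cell {p : ℝ → ℝ} {lam : ℝ} {Y : ℝ → ℝ} (h : RealSol p lam Y) {ψ : ℝ → ℝ}
    (hψ : Continuous ψ) (hpc : Continuous p) {c d ε Φ S : ℝ}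
    (hε : 0 < ε) (hε1 : ε ≤ 1) (hcd : c < d) (hΦ : |ψ c| ≤ Φ) (hS : Real.sqrt (p c) ≤ S)
    (hp : ∀ x ∈ Set.Icc c d, |Real.sqrt (p x) - Real.sqrt (p c)| ≤ ε)
    (hψc : ∀ x ∈ Set.Icc c d, |ψ x - ψ c| ≤ ε) :
    (zset Y c d).Finite ∧
    |1 / lam * (∑ᶠ x ∈ zset Y c d, ψ x) - 1 / Real.pi * ∫ x in c..d, ψ x * Real.sqrt (p x)| ≤
      ε * (2 * (S + 2 + Φ)) * (d - c) + (1 + Φ) / lam := by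
  have hl := h.1
  have hπ := Real.pi_pos
  have hd : 0 < d - c := by linarith
  set s := Real.sqrt (p c) with hs
  have hs0 : 0 ≤ s := Real.sqrt_nonneg _
  have hΦ0 : 0 ≤ Φ := (abs_nonneg _).trans hΦ
  have hπi : 1 / Real.pi ≤ 1 := by
    rw [div_le_one hπ]; linarith [Real.pi_gt_three]
  have hπi0 : 0 < 1 / Real.pi := by positivity
  obtain ⟨hfin, hcount⟩ := count_cell h hs0 hε hcd hp
  refine ⟨hfin, ?_⟩
  set N : ℝ := ((zset Y c d).ncard : ℝ) with hN
  have hN0 : 0 ≤ N := by positivity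
  -- the sum
  have h1 : |(∑ᶠ x ∈ zset Y c d, ψ x) - N * ψ c| ≤ N * ε := by
    rw [finsum_mem_eq_finite_toFinset_sum ψ hfin, hN, Set.ncard_eq_toFinset_card _ hfin]
    have e : (hfin.toFinset.card : ℝ) * ψ c = ∑ x ∈ hfin.toFinset, ψ c := by simp
    rw [e, ← Finset.sum_sub_distrib]
    calc |∑ x ∈ hfin.toFinset, (ψ x - ψ c)| ≤ ∑ x ∈ hfin.toFinset, |ψ x - ψ c| :=
          Finset.abs_sum_le_sum_abs _ _
      _ ≤ ∑ x ∈ hfin.toFinset, ε := by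
          apply Finset.sum_le_sum
          intro x hx
          have hx' : x ∈ zset Y c d := by simpa using hx
          exact hψc x ⟨hx'.1.1.le, hx'.1.2⟩
      _ = _ := by simp
  -- the integral
  have h2 : |(∫ x in c..d, ψ x * Real.sqrt (p x)) - ψ c * s * (d - c)| ≤
      (ε * (S + 1) + Φ * ε) * (d - c) := by
    have hi : IntervalIntegrable (fun x => ψ x * Real.sqrt (p x)) volume c d :=
      (Continuous.intervalIntegrable (by fun_prop) _ _)
    have e : ψ c * s * (d - c) = ∫ x in c..d, ψ c * s := by
      rw [intervalIntegral.integral_const, smul_eq_mul]; ring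
    rw [e, ← intervalIntegral.integral_sub hi (by simp)]
    have := intervalIntegral.norm_integral_le_of_norm_le_const (a := c) (b := d)
      (f := fun x => ψ x * Real.sqrt (p x) - ψ c * s) (C := ε * (S + 1) + Φ * ε) (by
        intro x hx
        rw [Set.uIoc_of_le hcd.le] at hx
        have hx' : x ∈ Set.Icc c d := ⟨hx.1.le, hx.2⟩
        have e1 : ψ x * Real.sqrt (p x) - ψ c * s =
          (ψ x - ψ c) * Real.sqrt (p x) + ψ c * (Real.sqrt (p x) - s) := by ring
        rw [e1, Real.norm_eq_abs]
        refine (abs_add_le _ _).trans ?_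
        rw [abs_mul, abs_mul, abs_of_nonneg (Real.sqrt_nonneg (p x))]
        have a1 := hψc x hx'
        have a2 := hp x hx'
        have a3 : Real.sqrt (p x) ≤ S + 1 := by linarith [(abs_le.1 a2).2]
        have a4 := Real.sqrt_nonneg (p x)
        gcongr)
    rwa [Real.norm_eq_abs, abs_of_pos hd] at this
  -- combine
  have h3 : N / lam ≤ s * (d - c) / Real.pi + ε * (d - c) + 1 / lam := by
    linarith [(abs_le.1 hcount).2]
  have h3' : s * (d - c) / Real.pi ≤ S * (d - c) := by
    have : s * (d - c) / Real.pi ≤ s * (d - c) := by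
      apply div_le_self (by positivity)
      linarith [Real.pi_gt_three]
    nlinarith
  have hsplit : 1 / lam * (∑ᶠ x ∈ zset Y c d, ψ x) -
      1 / Real.pi * ∫ x in c..d, ψ x * Real.sqrt (p x) =
      1 / lam * ((∑ᶠ x ∈ zset Y c d, ψ x) - N * ψ c) +
      ψ c * (N / lam - s * (d - c) / Real.pi) -
      1 / Real.pi * ((∫ x in c..d, ψ x * Real.sqrt (p x)) - ψ c * s * (d - c)) := by
    ring
  rw [hsplit]
  have b1 : |1 / lam * ((∑ᶠ x ∈ zset Y c d, ψ x) - N * ψ c)| ≤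
      ε * ((S + 1) * (d - c)) + 1 / lam := by
    rw [abs_mul, abs_of_pos (by positivity : 0 < 1 / lam)]
    calc 1 / lam * |(∑ᶠ x ∈ zset Y c d, ψ x) - N * ψ c| ≤ 1 / lam * (N * ε) := by gcongr
      _ = ε * (N / lam) := by ring
      _ ≤ ε * ((S + 1) * (d - c) + 1 / lam) := by
          gcongr
          nlinarith
      _ = ε * ((S + 1) * (d - c)) + ε * (1 / lam) := by ring
      _ ≤ ε * ((S + 1) * (d - c)) + 1 / lam := by
          have : 0 < 1 / lam := by positivity
          nlinarith
  have b2 : |ψ c * (N / lam - s * (d - c) / Real.pi)| ≤ Φ * (ε * (d - c) + 1 / lam) := by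
    rw [abs_mul]; gcongr
  have b3 : |1 / Real.pi * ((∫ x in c..d, ψ x * Real.sqrt (p x)) - ψ c * s * (d - c))| ≤
      (ε * (S + 1) + Φ * ε) * (d - c) := by
    rw [abs_mul, abs_of_pos hπi0]
    calc _ ≤ 1 * |(∫ x in c..d, ψ x * Real.sqrt (p x)) - ψ c * s * (d - c)| := by gcongr
      _ ≤ _ := by rw [one_mul]; exact h2
  have b4 := abs_sub (1 / lam * ((∑ᶠ x ∈ zset Y c d, ψ x) - N * ψ c) +
      ψ c * (N / lam - s * (d - c) / Real.pi))
      (1 / Real.pi * ((∫ x in c..d, ψ x * Real.sqrt (p x)) - ψ c * s * (d - c)))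
  have b5 := abs_add_le (1 / lam * ((∑ᶠ x ∈ zset Y c d, ψ x) - N * ψ c))
      (ψ c * (N / lam - s * (d - c) / Real.pi))
  have b6 : (1 + Φ) / lam = 1 / lam + Φ * (1 / lam) := by ring
  have b7 : 0 ≤ ε * (d - c) := by positivity
  rw [b6]
  nlinarith

theorem zset_union (Y : ℝ → ℝ) {c d e : ℝ} (h1 : c ≤ d) (h2 : d ≤ e) :
    zset Y c e = zset Y c d ∪ zset Y d e := by
  ext x
  simp only [zset, Set.mem_union, Set.mem_setOf_eq, Set.mem_Ioc]
  constructor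
  · rintro ⟨⟨a1, a2⟩, a3⟩
    rcases le_or_gt x d with h | h
    · exact Or.inl ⟨⟨a1, h⟩, a3⟩
    · exact Or.inr ⟨⟨h, a2⟩, a3⟩
  · rintro (⟨⟨a1, a2⟩, a3⟩ | ⟨⟨a1, a2⟩, a3⟩)
    · exact ⟨⟨a1, a2.trans h2⟩, a3⟩
    · exact ⟨⟨h1.trans_lt a1, a2⟩, a3⟩

theorem zset_disjoint (Y : ℝ → ℝ) (c d e : ℝ) : Disjoint (zset Y c d) (zset Y d e) := by
  rw [Set.disjoint_left]
  rintro x ⟨⟨_, h1⟩, _⟩ ⟨⟨h2, _⟩, _⟩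
  linarith

/-- Sum over many cells. -/
theorem sum_cells {p : ℝ → ℝ} {lam : ℝ} {Y : ℝ → ℝ} (h : RealSol p lam Y) {ψ : ℝ → ℝ}
    (hψ : Continuous ψ) (hpc : Continuous p) {c ℓ ε Φ S : ℝ}
    (hε : 0 < ε) (hε1 : ε ≤ 1) (hℓ : 0 < ℓ) (hΦ : ∀ x, |ψ x| ≤ Φ) (K : ℕ)
    (hS : ∀ x ∈ Set.Icc c (c + K * ℓ), Real.sqrt (p x) ≤ S)
    (hp : ∀ x ∈ Set.Icc c (c + K * ℓ), ∀ x' ∈ Set.Icc c (c + K * ℓ), |x - x'| ≤ ℓ →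
      |Real.sqrt (p x) - Real.sqrt (p x')| ≤ ε)
    (hψc : ∀ x x', |x - x'| ≤ ℓ → |ψ x - ψ x'| ≤ ε) :
    (zset Y c (c + K * ℓ)).Finite ∧
    |1 / lam * (∑ᶠ x ∈ zset Y c (c + K * ℓ), ψ x) -
      1 / Real.pi * ∫ x in c..(c + K * ℓ), ψ x * Real.sqrt (p x)| ≤
      K * (ε * (2 * (S + 2 + Φ)) * ℓ + (1 + Φ) / lam) := by
  induction K with
  | zero =>
    have : zset Y c c = ∅ := by ext x; simp [zset]
    simp [this]
  | succ k ih =>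
    have hk0 : 0 ≤ (k : ℝ) * ℓ := by positivity
    push_cast at hS hp ⊢
    have hsub : Set.Icc c (c + k * ℓ) ⊆ Set.Icc c (c + (k + 1) * ℓ) := by
      apply Set.Icc_subset_Icc le_rfl; nlinarith
    obtain ⟨f1, e1⟩ := ih (fun x hx => hS x (hsub hx))
      (fun x hx x' hx' => hp x (hsub hx) x' (hsub hx'))
    set m := c + k * ℓ with hm
    have hm' : c + ((k : ℝ) + 1) * ℓ = m + ℓ := by rw [hm]; ring
    rw [hm'] at hS hp ⊢
    have hmem : ∀ x ∈ Set.Icc m (m + ℓ), x ∈ Set.Icc c (m + ℓ) := by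
      intro x hx; exact ⟨by linarith [hx.1], hx.2⟩
    have hmm : m ∈ Set.Icc c (m + ℓ) := ⟨by linarith, by linarith⟩
    have hab : ∀ x ∈ Set.Icc m (m + ℓ), |x - m| ≤ ℓ := by
      intro x hx
      rw [abs_le]; constructor <;> linarith [hx.1, hx.2]
    obtain ⟨f2, e2⟩ := sum_cell h hψ hpc hε hε1 (show m < m + ℓ by linarith) (hΦ m)
      (hS m hmm) (fun x hx => hp x (hmem x hx) m hmm (hab x hx))
      (fun x hx => hψc x m (hab x hx))
    rw [zset_union Y (show c ≤ m by linarith) (show m ≤ m + ℓ by linarith)]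
    refine ⟨f1.union f2, ?_⟩
    rw [finsum_mem_union (zset_disjoint Y c m (m + ℓ)) f1 f2]
    have hcont : Continuous (fun x => ψ x * Real.sqrt (p x)) := by fun_prop
    rw [← intervalIntegral.integral_add_adjacent_intervals (hcont.intervalIntegrable c m)
      (hcont.intervalIntegrable m (m + ℓ))]
    have e3 : m + ℓ - m = ℓ := by ring
    rw [e3] at e2
    have := abs_add_le (1 / lam * (∑ᶠ x ∈ zset Y c m, ψ x) -
      1 / Real.pi * ∫ x in c..m, ψ x * Real.sqrt (p x))
      (1 / lam * (∑ᶠ x ∈ zset Y m (m + ℓ), ψ x) -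
      1 / Real.pi * ∫ x in m..(m + ℓ), ψ x * Real.sqrt (p x))
    calc _ = |(1 / lam * (∑ᶠ x ∈ zset Y c m, ψ x) -
      1 / Real.pi * ∫ x in c..m, ψ x * Real.sqrt (p x)) +
      (1 / lam * (∑ᶠ x ∈ zset Y m (m + ℓ), ψ x) -
      1 / Real.pi * ∫ x in m..(m + ℓ), ψ x * Real.sqrt (p x))| := by congr 1; ring
      _ ≤ _ := this
      _ ≤ _ := by linarith

theorem zset_finite {p : ℝ → ℝ} {lam : ℝ} {Y : ℝ → ℝ} (h : RealSol p lam Y) (hpc : Continuous p)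
    (c d : ℝ) : (zset Y c d).Finite := by
  rcases lt_or_ge c d with hcd | hcd
  · obtain ⟨M, hM⟩ := isCompact_Icc.bddAbove_image (K := Set.Icc c d) hpc.continuousOn
    refine (count_upper h (σ := |M| + 1) (by positivity) hcd.le ?_).1
    intro x hx
    have h1 : p x ≤ M := hM ⟨x, hx, rfl⟩
    nlinarith [le_abs_self M, abs_nonneg M]
  · have : zset Y c d = ∅ := by
      ext x
      simp only [zset, Set.mem_setOf_eq, Set.mem_Ioc, Set.mem_empty_iff_false, iff_false]
      rintro ⟨⟨h1, h2⟩, _⟩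
      linarith
    rw [this]; exact Set.finite_empty

/-- Weak limit of the zero counting measures of real solutions. -/
theorem real_limit {p : ℝ → ℝ} (hpc : Continuous p) {lam : ℕ → ℝ} {Y : ℕ → ℝ → ℝ}
    (hlam : Tendsto lam atTop atTop) (h : ∀ n, RealSol p (lam n) (Y n)) {ψ : ℝ → ℝ}
    (hψ : Continuous ψ) (hψs : HasCompactSupport ψ) :
    Tendsto (fun n => 1 / lam n * ∑ᶠ x ∈ {x | Y n x = 0}, ψ x) atTop
      (𝓝 (1 / Real.pi * ∫ x, ψ x * Real.sqrt (p x))) := by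
  obtain ⟨Φ, hΦ⟩ : ∃ Φ, ∀ x, |ψ x| ≤ Φ := by
    obtain ⟨C, hC⟩ := hψs.exists_bound_of_continuous hψ
    exact ⟨C, fun x => by simpa using hC x⟩
  have hΦ0 : 0 ≤ Φ := (abs_nonneg _).trans (hΦ 0)
  obtain ⟨R, hR0, hR⟩ : ∃ R : ℝ, 0 < R ∧ ∀ x, x ∉ Set.Ioc (-R) R → ψ x = 0 := by
    obtain ⟨r, hr⟩ := hψs.isCompact.isBounded.subset_closedBall 0
    refine ⟨|r| + 1, by positivity, ?_⟩
    intro x hx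
    by_contra hne
    apply hx
    have := hr (subset_tsupport ψ hne)
    rw [Metric.mem_closedBall, dist_zero_right, Real.norm_eq_abs, abs_le] at this
    have := le_abs_self r
    constructor <;> linarith
  have hsum : ∀ n, ∑ᶠ x ∈ {x | Y n x = 0}, ψ x = ∑ᶠ x ∈ zset (Y n) (-R) R, ψ x := by
    intro n
    rw [finsum_mem_def, finsum_mem_def]
    congr 1
    funext x
    by_cases hx : x ∈ Set.Ioc (-R) R
    · by_cases hY : Y n x = 0
      · rw [Set.indicator_of_mem (by exact hY), Set.indicator_of_mem (by exact ⟨hx, hY⟩)]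
      · rw [Set.indicator_of_notMem (by exact hY), Set.indicator_of_notMem (fun hc => hY hc.2)]
    · simp [Set.indicator, hR x hx]
  have hIntg : ∫ x, ψ x * Real.sqrt (p x) = ∫ x in (-R)..R, ψ x * Real.sqrt (p x) := by
    rw [intervalIntegral.integral_of_le (by linarith)]
    symm
    apply setIntegral_eq_integral_of_forall_compl_eq_zero
    intro x hx
    rw [hR x hx, zero_mul]
  simp only [hsum, hIntg]
  obtain ⟨S, hS⟩ : ∃ S, ∀ x ∈ Set.Icc (-R) R, Real.sqrt (p x) ≤ S := by
    obtain ⟨M, hM⟩ := isCompact_Icc.bddAbove_image (K := Set.Icc (-R) R)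
      (f := fun x => Real.sqrt (p x)) (by fun_prop)
    exact ⟨M, fun x hx => hM ⟨x, hx, rfl⟩⟩
  have hS0 : 0 ≤ S := (Real.sqrt_nonneg _).trans (hS 0 ⟨by linarith, by linarith⟩)
  rw [Metric.tendsto_atTop]
  intro η hη
  set C := 2 * (S + 2 + Φ) with hC
  have hC0 : 0 < C := by positivity
  set ε := min 1 (η / (2 * (2 * R * C))) with hε
  have hε0 : 0 < ε := by positivity
  have hε1 : ε ≤ 1 := min_le_left _ _
  have hε2 : ε * C * (2 * R) ≤ η / 2 := by
    have : ε ≤ η / (2 * (2 * R * C)) := min_le_right _ _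
    rw [le_div_iff₀ (by positivity)] at this
    linarith
  have huc1 : UniformContinuous ψ := hψs.uniformContinuous_of_continuous hψ
  have huc2 : UniformContinuousOn (fun x => Real.sqrt (p x)) (Set.Icc (-R) R) :=
    isCompact_Icc.uniformContinuousOn_of_continuous (by fun_prop)
  obtain ⟨δ1, hδ1, H1⟩ := Metric.uniformContinuous_iff.1 huc1 ε hε0
  obtain ⟨δ2, hδ2, H2⟩ := Metric.uniformContinuousOn_iff.1 huc2 ε hε0
  obtain ⟨k, hk⟩ := exists_nat_gt (2 * R / min δ1 δ2)
  have hmin : 0 < min δ1 δ2 := lt_min hδ1 hδ2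
  have hk0 : (0 : ℝ) < k := lt_of_le_of_lt (by positivity) hk
  set ℓ := 2 * R / k with hℓ
  have hℓ0 : 0 < ℓ := by positivity
  have hℓlt : ℓ < min δ1 δ2 := by
    rw [hℓ, div_lt_iff₀ hk0]
    rw [div_lt_iff₀ hmin] at hk
    linarith
  have hkℓ : -R + k * ℓ = R := by rw [hℓ]; field_simp; ring
  have hkℓ' : k * ℓ = 2 * R := by linarith
  have hev := (hlam.eventually_gt_atTop (2 * (k * (1 + Φ)) / η))
  have hev0 := hlam.eventually_gt_atTop 0
  obtain ⟨n0, hn0⟩ := eventually_atTop.1 (hev.and hev0)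
  refine ⟨n0, fun n hn => ?_⟩
  obtain ⟨g1, g2⟩ := hn0 n hn
  obtain ⟨-, hb⟩ := sum_cells (h n) hψ hpc (c := -R) (S := S) hε0 hε1 hℓ0 hΦ k
    (by rw [hkℓ]; exact hS)
    (by
      rw [hkℓ]
      intro x hx x' hx' hd
      have := H2 x hx x' hx' (by
        rw [Real.dist_eq]; exact lt_of_le_of_lt hd (hℓlt.trans_le (min_le_right _ _)))
      rw [Real.dist_eq] at this
      exact this.le)
    (by
      intro x x' hd
      have := H1 (a := x) (b := x') (by
        rw [Real.dist_eq]; exact lt_of_le_of_lt hd (hℓlt.trans_le (min_le_left _ _)))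
      rw [Real.dist_eq] at this
      exact this.le)
  rw [hkℓ] at hb
  rw [Real.dist_eq]
  refine lt_of_le_of_lt hb ?_
  have e1 : k * (ε * (2 * (S + 2 + Φ)) * ℓ + (1 + Φ) / lam n) =
      ε * C * (k * ℓ) + k * (1 + Φ) / lam n := by rw [hC]; ring
  rw [e1, hkℓ']
  have : k * (1 + Φ) / lam n < η / 2 := by
    rw [div_lt_iff₀ hη] at g1
    rw [div_lt_iff₀ g2]
    linarith
  linarith

theorem axis_sol (y : ℂ → ℂ) (hy : Differentiable ℂ y) (hnz : ∃ z, y z ≠ 0) (v : ℂ) (hv : v ≠ 0)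
    (lam : ℝ) (hlam : 0 < lam) (p : ℝ → ℝ)
    (hode : ∀ s : ℝ, deriv (deriv y) (s * v) * v * v = ((-(lam ^ 2 * p s) : ℝ) : ℂ) * y (s * v))
    (hc : ∃ c : ℂ, ∀ s : ℝ, (starRingEnd ℂ) (y (s * v)) = c * y (s * v)) :
    ∃ Y : ℝ → ℝ, RealSol p lam Y ∧ ∀ s, Y s = 0 ↔ y (s * v) = 0 := by
  have hex : ∀ α β : ℝ, α < β → ∃ x ∈ Set.Icc α β, y (x * v) ≠ 0 := by
    intro α β hαβ
    by_contra hcon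
    push Not at hcon
    obtain ⟨z, hz⟩ := hnz
    apply hz
    refine entire_zero_of_segment y hy 0 v hv α β hαβ ?_ z
    intro s hs
    rw [zero_add]
    exact hcon s ⟨hs.1.le, hs.2.le⟩
  obtain ⟨s0, -, hs0⟩ := hex 0 1 one_pos
  obtain ⟨c, hc⟩ := hc
  have hc0 : c ≠ 0 := by
    rintro rfl
    have := hc s0
    rw [zero_mul] at this
    exact hs0 (by simpa using this)
  have hreal : ∀ s : ℝ, ((y (s * v) / y (s0 * v)).im) = 0 := by
    intro s
    rw [← Complex.conj_eq_iff_im, map_div₀, hc, hc]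
    field_simp
  have hiff : ∀ s : ℝ, (y (s * v) / y (s0 * v)).re = 0 ↔ y (s * v) = 0 := by
    intro s
    constructor
    · intro h
      have : y (s * v) / y (s0 * v) = 0 := Complex.ext h (hreal s)
      rcases div_eq_zero_iff.1 this with h | h
      · exact h
      · exact absurd h hs0
    · intro h
      rw [h]; simp
  refine ⟨fun s => (y (s * v) / y (s0 * v)).re, ⟨hlam, ?_, 
    fun s => (deriv y (s * v) * v / y (s0 * v)).re, ?_, ?_⟩, hiff⟩
  · intro α β hαβ
    obtain ⟨x, hx, hx'⟩ := hex α β hαβ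
    exact ⟨x, hx, fun h => hx' ((hiff x).1 h)⟩
  · intro s
    have h1 := line_deriv_s1 y hy 0 v s
    simp only [zero_add] at h1
    exact re_hasDerivAt (h1.div_const _)
  · intro s
    have h1 := line_deriv_s1 (deriv y) hy.deriv 0 v s
    simp only [zero_add] at h1
    have h2 := re_hasDerivAt ((h1.mul_const v).div_const (y (s0 * v)))
    refine h2.congr_deriv ?_
    rw [hode s, mul_div_assoc, Complex.re_ofReal_mul]

theorem zeros_support_finite {p : ℝ → ℝ} {lam : ℝ} {Y : ℝ → ℝ} (h : RealSol p lam Y)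
    (hpc : Continuous p) {ψ : ℝ → ℝ} (hψs : HasCompactSupport ψ) :
    ({x | Y x = 0} ∩ Function.support ψ).Finite := by
  obtain ⟨r, hr⟩ := hψs.isCompact.isBounded.subset_closedBall 0
  refine (zset_finite h hpc (-|r| - 1) (|r|)).subset ?_
  rintro x ⟨hx, hx'⟩
  have := hr (subset_tsupport ψ hx')
  rw [Metric.mem_closedBall, dist_zero_right, Real.norm_eq_abs, abs_le] at this
  have := le_abs_self r
  refine ⟨⟨by linarith, by linarith⟩, hx⟩

theorem zeroSum_split (y : ℂ → ℂ) (φ : ℂ → ℝ)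
    (hax : ∀ z, y z = 0 → z.im = 0 ∨ z.re = 0)
    (h1 : ({x : ℝ | y x = 0} ∩ Function.support (fun x : ℝ => φ x)).Finite)
    (h2 : ({t : ℝ | y (t * Complex.I) = 0} ∩
      Function.support (fun t : ℝ => φ (t * Complex.I))).Finite) :
    ∃ e : ℝ, |e| ≤ |φ 0| ∧ zeroSum y φ = (∑ᶠ x ∈ {x : ℝ | y x = 0}, φ x) +
      (∑ᶠ t ∈ {t : ℝ | y (t * Complex.I) = 0}, φ (t * Complex.I)) - e := by
  set Zr := {x : ℝ | y x = 0} with hZr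
  set Zi := {t : ℝ | y (t * Complex.I) = 0} with hZi
  set Z0 := Zi \ {0} with hZ0
  have injr : Set.InjOn (fun x : ℝ => (x : ℂ)) Zr := fun _ _ _ _ h => Complex.ofReal_injective h
  have inji : Function.Injective (fun t : ℝ => (t : ℂ) * Complex.I) := by
    intro s t h
    simpa using h
  have hset : {z : ℂ | y z = 0} = (fun x : ℝ => (x : ℂ)) '' Zr ∪
      (fun t : ℝ => (t : ℂ) * Complex.I) '' Z0 := by
    ext z
    constructor
    · intro hz
      have hz : y z = 0 := hz
      by_cases hi : z.im = 0
      · left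
        have e : ((z.re : ℝ) : ℂ) = z := Complex.ext (by simp) (by simp [hi])
        exact ⟨z.re, by show y _ = 0; rw [e]; exact hz, e⟩
      · right
        have hr := (hax z hz).resolve_left hi
        have e : ((z.im : ℝ) : ℂ) * Complex.I = z := Complex.ext (by simp [hr]) (by simp)
        exact ⟨z.im, ⟨by show y _ = 0; rw [e]; exact hz, hi⟩, e⟩
    · rintro (⟨x, hx, rfl⟩ | ⟨x, hx, rfl⟩)
      · exact hx
      · exact hx.1
  have hdisj : Disjoint ((fun x : ℝ => (x : ℂ)) '' Zr)
      ((fun t : ℝ => (t : ℂ) * Complex.I) '' Z0) := by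
    rw [Set.disjoint_left]
    rintro _ ⟨x, hx, rfl⟩ ⟨t, ht, h⟩
    have := congrArg Complex.im h
    simp at this
    exact ht.2 this
  have f1 : (((fun x : ℝ => (x : ℂ)) '' Zr) ∩ Function.support φ).Finite := by
    refine (h1.image (fun x : ℝ => (x : ℂ))).subset ?_
    rintro _ ⟨⟨x, hx, rfl⟩, h⟩
    exact ⟨x, ⟨hx, h⟩, rfl⟩
  have f2 : (((fun t : ℝ => (t : ℂ) * Complex.I) '' Z0) ∩ Function.support φ).Finite := by
    refine (h2.image (fun t : ℝ => (t : ℂ) * Complex.I)).subset ?_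
    rintro _ ⟨⟨x, hx, rfl⟩, h⟩
    exact ⟨x, ⟨hx.1, h⟩, rfl⟩
  have hz : zeroSum y φ = ∑ᶠ z ∈ {z : ℂ | y z = 0}, φ z := by
    have e1 : zeroSum y φ = ∑' z, ({z : ℂ | y z = 0}).indicator φ z :=
      tsum_subtype {z : ℂ | y z = 0} φ
    rw [e1, tsum_eq_finsum, finsum_mem_def]
    show (Function.support _).Finite
    rw [Set.support_indicator, hset, Set.union_inter_distrib_right]
    exact f1.union f2
  rw [hz, hset, finsum_mem_union' hdisj f1 f2, finsum_mem_image injr,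
    finsum_mem_image inji.injOn]
  by_cases h0 : (0 : ℝ) ∈ Zi
  · refine ⟨φ 0, le_rfl, ?_⟩
    have hU : Zi = {0} ∪ Z0 := by
      rw [hZ0, Set.union_sdiff_cancel]
      simpa using h0
    have : ∑ᶠ t ∈ Zi, φ (t * Complex.I) = φ 0 + ∑ᶠ t ∈ Z0, φ (t * Complex.I) := by
      rw [hU, finsum_mem_union', finsum_mem_singleton]
      · simp
      · rw [hZ0]; exact Set.disjoint_sdiff_right
      · exact (Set.finite_singleton _).subset Set.inter_subset_left
      · exact h2.subset (Set.inter_subset_inter_left _ Set.sdiff_subset)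
    rw [this]; ring
  · refine ⟨0, by simp, ?_⟩
    have : Z0 = Zi := by rw [hZ0]; exact Set.sdiff_singleton_eq_self h0
    rw [this]; ring

theorem symmetric_single_well_zero_limit
    (a b : ℝ) (ha : 0 < a) (hb : 0 < b)
    (q : ℂ → ℂ) (hq : ∀ z : ℂ, q z = (z ^ 2 - (a : ℂ) ^ 2) * (z ^ 2 + (b : ℂ) ^ 2))
    (lam : ℕ → ℝ) (y : ℕ → ℂ → ℂ)
    (hlam : Tendsto lam atTop atTop)
    (heig : ∀ n, IsEigen q (lam n) (y n))
    (φ : ℂ → ℝ) (hφc : Continuous φ) (hφs : HasCompactSupport φ) :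
    Tendsto (fun n => (1 / lam n) * zeroSum (y n) φ) atTop
      (nhds ((1 / Real.pi) *
        ((∫ x in (-a)..a, φ (x : ℂ) * Real.sqrt ((a ^ 2 - x ^ 2) * (x ^ 2 + b ^ 2)))
        + (∫ t in Set.Ioi b, φ ((t : ℂ) * Complex.I) *
            Real.sqrt ((t ^ 2 + a ^ 2) * (t ^ 2 - b ^ 2)))
        + ∫ t in Set.Iio (-b), φ ((t : ℂ) * Complex.I) *
            Real.sqrt ((t ^ 2 + a ^ 2) * (t ^ 2 - b ^ 2))))) := by
  set pr : ℝ → ℝ := fun x => (a ^ 2 - x ^ 2) * (x ^ 2 + b ^ 2) with hpr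
  set pim : ℝ → ℝ := fun t => (t ^ 2 + a ^ 2) * (t ^ 2 - b ^ 2) with hpim
  have hprc : Continuous pr := by fun_prop
  have hpimc : Continuous pim := by fun_prop
  have solr : ∀ n, ∃ Y : ℝ → ℝ, RealSol pr (lam n) Y ∧ ∀ s : ℝ, Y s = 0 ↔ y n s = 0 := by
    intro n
    have h := heig n
    obtain ⟨-, -, ⟨c, hc⟩, -⟩ := eigen_symm a b (lam n) q (y n) hq h
    obtain ⟨Y, hY, hY'⟩ := axis_sol (y n) h.2.1 h.2.2.1 1 one_ne_zero (lam n) h.1 pr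
      (by
        intro s
        rw [h.2.2.2.1, hq, hpr]
        push_cast
        ring)
      ⟨c, by intro s; rw [mul_one]; exact hc s⟩
    exact ⟨Y, hY, fun s => by rw [hY', mul_one]⟩
  have soli : ∀ n, ∃ Y : ℝ → ℝ, RealSol pim (lam n) Y ∧
      ∀ s : ℝ, Y s = 0 ↔ y n (s * Complex.I) = 0 := by
    intro n
    have h := heig n
    obtain ⟨-, -, -, hc⟩ := eigen_symm a b (lam n) q (y n) hq h
    exact axis_sol (y n) h.2.1 h.2.2.1 Complex.I Complex.I_ne_zero (lam n) h.1 pim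
      (by
        intro s
        rw [h.2.2.2.1, hq, hpim, mul_assoc, Complex.I_mul_I, mul_pow, Complex.I_sq]
        push_cast
        ring) hc
  choose Yr hYr hYr0 using solr
  choose Yi hYi hYi0 using soli
  set ψr : ℝ → ℝ := fun x => φ (x : ℂ) with hψr
  set ψi : ℝ → ℝ := fun t => φ ((t : ℂ) * Complex.I) with hψi
  have cr : Continuous ψr := by fun_prop
  have ci : Continuous ψi := by fun_prop
  have sr : HasCompactSupport ψr :=
    hφs.comp_isClosedEmbedding Complex.isometry_ofReal.isClosedEmbedding
  have si : HasCompactSupport ψi := by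
    have : Isometry (fun t : ℝ => (t : ℂ) * Complex.I) := by
      refine Isometry.of_dist_eq fun s t => ?_
      rw [dist_eq_norm, ← sub_mul, norm_mul, Complex.norm_I, mul_one, ← Complex.ofReal_sub,
        Complex.norm_real, dist_eq_norm]
    exact hφs.comp_isClosedEmbedding this.isClosedEmbedding
  have Lr := real_limit hprc hlam hYr cr sr
  have Li := real_limit hpimc hlam hYi ci si
  have hsetr : ∀ n, {x | Yr n x = 0} = {x : ℝ | y n x = 0} := fun n => by
    ext x; exact hYr0 n x
  have hseti : ∀ n, {x | Yi n x = 0} = {x : ℝ | y n (x * Complex.I) = 0} := fun n => by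
    ext x; exact hYi0 n x
  have hsp : ∀ n, ∃ e : ℝ, |e| ≤ |φ 0| ∧ zeroSum (y n) φ =
      (∑ᶠ x ∈ {x | Yr n x = 0}, ψr x) + (∑ᶠ t ∈ {x | Yi n x = 0}, ψi t) - e := by
    intro n
    have fr := zeros_support_finite (hYr n) hprc sr
    have fi := zeros_support_finite (hYi n) hpimc si
    rw [hsetr n] at fr ⊢
    rw [hseti n] at fi ⊢
    exact zeroSum_split (y n) φ
      (fun z hz => eigen_zeros_axes a b (lam n) ha hb q (y n) hq (heig n) z hz) fr fi
  choose e he hsum using hsp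
  have Le : Tendsto (fun n => 1 / lam n * e n) atTop (𝓝 0) := by
    have hinv : Tendsto (fun n => 1 / lam n) atTop (𝓝 0) := by
      simp only [one_div]
      exact hlam.inv_tendsto_atTop
    refine hinv.zero_mul_isBoundedUnder_le ?_
    exact isBoundedUnder_of ⟨|φ 0|, fun n => by simpa using he n⟩
  have hL := (Lr.add Li).sub Le
  have hIr : ∫ x, ψr x * Real.sqrt (pr x) = ∫ x in (-a)..a, ψr x * Real.sqrt (pr x) := by
    rw [intervalIntegral.integral_of_le (by linarith)]
    symm
    apply setIntegral_eq_integral_of_forall_compl_eq_zero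
    intro x hx
    have : pr x ≤ 0 := by
      apply mul_nonpos_of_nonpos_of_nonneg _ (by positivity)
      by_contra hcon
      push Not at hcon
      have := abs_lt_of_sq_lt_sq' (by linarith : x ^ 2 < a ^ 2) ha.le
      exact hx ⟨this.1, this.2.le⟩
    rw [Real.sqrt_eq_zero_of_nonpos this, mul_zero]
  have hIi : ∫ x, ψi x * Real.sqrt (pim x) = (∫ x in Set.Ioi b, ψi x * Real.sqrt (pim x)) +
      ∫ x in Set.Iio (-b), ψi x * Real.sqrt (pim x) := by
    have hIntg : Integrable (fun x => ψi x * Real.sqrt (pim x)) :=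
      Continuous.integrable_of_hasCompactSupport (by fun_prop) si.mul_right
    rw [← setIntegral_union _ measurableSet_Iio hIntg.integrableOn hIntg.integrableOn]
    · symm
      apply setIntegral_eq_integral_of_forall_compl_eq_zero
      intro x hx
      have : pim x ≤ 0 := by
        apply mul_nonpos_of_nonneg_of_nonpos (by positivity)
        simp only [Set.mem_union, Set.mem_Ioi, Set.mem_Iio, not_or, not_lt] at hx
        nlinarith
      rw [Real.sqrt_eq_zero_of_nonpos this, mul_zero]
    · rw [Set.disjoint_left]
      intro x hx hx'
      have h1 : b < x := hx
      have h2 : x < -b := hx'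
      linarith
  rw [hIr, hIi] at hL
  refine (hL.congr fun n => ?_).trans_eq ?_
  · rw [hsum n]; ring
  · congr 1
    ring
end

section
/- (Density of non-resonant indices for an irrational ratio.) Let θ > 0 be irrational and let 0 < τ < 1/2. Then the set A = {n ∈ ℕ : |(2n+1)θ − (2m+1)| > 2τ for every integer m} has natural density 1 − 2τ, i.e. #(A ∩ {0,…,N−1})/N → 1 − 2τ as N → ∞. -/
open Filter Topology

open MeasureTheory in
/-- Weyl criterion on the circle: convergence of Fourier coefficients implies weak convergence. -/
lemma weyl_aux {T : ℝ} [hT : Fact (0 < T)] (μs : ℕ → ProbabilityMeasure (AddCircle T))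
    (μ : ProbabilityMeasure (AddCircle T))
    (h : ∀ k : ℤ, Tendsto (fun i => ∫ x, fourier k x ∂(μs i : Measure (AddCircle T))) atTop
      (𝓝 (∫ x, fourier k x ∂(μ : Measure (AddCircle T))))) :
    Tendsto μs atTop (𝓝 μ) := by
  have int : ∀ (ν : ProbabilityMeasure (AddCircle T)) (f : C(AddCircle T, ℂ)),
      Integrable f (ν : Measure (AddCircle T)) := fun ν f =>
    f.continuous.integrable_of_hasCompactSupport (HasCompactSupport.of_compactSpace f)
  have hspan : ∀ g ∈ Submodule.span ℂ (Set.range (@fourier T)),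
      Tendsto (fun i => ∫ x, g x ∂(μs i : Measure (AddCircle T))) atTop
      (𝓝 (∫ x, g x ∂(μ : Measure (AddCircle T)))) := by
    intro g hg
    induction hg using Submodule.span_induction with
    | mem x hx => obtain ⟨k, rfl⟩ := hx; exact h k
    | zero => simp
    | add x y _ _ hx hy =>
      simp only [ContinuousMap.add_apply]
      rw [integral_add (int μ x) (int μ y)]
      refine (hx.add hy).congr fun i => ?_
      rw [integral_add (int _ x) (int _ y)]
    | smul a x _ hx =>
      simp only [ContinuousMap.smul_apply]
      rw [integral_smul]
      refine (hx.const_smul a).congr fun i => ?_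
      rw [integral_smul]
  have hall : ∀ f : C(AddCircle T, ℂ),
      Tendsto (fun i => ∫ x, f x ∂(μs i : Measure (AddCircle T))) atTop
      (𝓝 (∫ x, f x ∂(μ : Measure (AddCircle T)))) := by
    intro f
    have hf : f ∈ closure (Submodule.span ℂ (Set.range (@fourier T)) : Set C(AddCircle T, ℂ)) := by
      have := @span_fourier_closure_eq_top T _
      rw [← Submodule.topologicalClosure_coe, this]; trivial
    rw [Metric.tendsto_atTop]
    intro ε hε
    obtain ⟨g, hg, hd⟩ := Metric.mem_closure_iff.1 hf (ε / 3) (by positivity)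
    obtain ⟨N, hN⟩ := Metric.tendsto_atTop.1 (hspan g hg) (ε / 3) (by positivity)
    have key : ∀ ν : ProbabilityMeasure (AddCircle T),
        dist (∫ x, f x ∂(ν : Measure (AddCircle T))) (∫ x, g x ∂(ν : Measure (AddCircle T)))
          ≤ dist f g := by
      intro ν
      rw [dist_eq_norm, ← integral_sub (int ν f) (int ν g)]
      refine (norm_integral_le_of_norm_le_const (C := dist f g)
        (Eventually.of_forall fun x => ?_)).trans (by simp)
      rw [← dist_eq_norm]
      exact ContinuousMap.dist_apply_le_dist x
    refine ⟨N, fun n hn => ?_⟩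
    have h1 := key (μs n)
    have h2 := key μ
    have h3 := hN n hn
    have h4 := dist_triangle4 (∫ x, f x ∂(μs n : Measure (AddCircle T)))
      (∫ x, g x ∂(μs n : Measure (AddCircle T))) (∫ x, g x ∂(μ : Measure (AddCircle T)))
      (∫ x, f x ∂(μ : Measure (AddCircle T)))
    rw [dist_comm (∫ x, g x ∂(μ : Measure (AddCircle T)))] at h4
    linarith
  rw [ProbabilityMeasure.tendsto_iff_forall_integral_rclike_tendsto ℂ]
  intro f
  exact hall f.toContinuousMap

open MeasureTheory in
/-- Empirical measure of the first `N + 1` terms of a sequence. -/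
noncomputable def empMeasure {X : Type*} [MeasurableSpace X] (x : ℕ → X) (N : ℕ) : Measure X :=
  ((N + 1 : ℕ) : ENNReal)⁻¹ • ∑ n ∈ Finset.range (N + 1), Measure.dirac (x n)

open MeasureTheory in
instance empMeasure_prob {X : Type*} [MeasurableSpace X] (x : ℕ → X) (N : ℕ) :
    IsProbabilityMeasure (empMeasure x N) := by
  constructor
  simp only [empMeasure, Measure.smul_apply, Measure.finsetSum_apply, measure_univ,
    Finset.sum_const, Finset.card_range, smul_eq_mul, nsmul_eq_mul, mul_one]
  exact ENNReal.inv_mul_cancel (by simp) (by finiteness)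

lemma geom_avg (z c : ℂ) (hz : ‖z‖ = 1) (hz1 : z ≠ 1) :
    Tendsto (fun N : ℕ => ((N + 1 : ℕ) : ℝ)⁻¹ • ∑ n ∈ Finset.range (N + 1), c * z ^ n) atTop
      (𝓝 0) := by
  have h0 : Tendsto (fun N : ℕ => ((N + 1 : ℕ) : ℝ)⁻¹) atTop (𝓝 0) :=
    (tendsto_inv_atTop_nhds_zero_nat (𝕜 := ℝ)).comp (tendsto_add_atTop_nat 1)
  have h1 : Tendsto (fun N : ℕ => ((N + 1 : ℕ) : ℝ)⁻¹ * (‖c‖ * (2 / ‖z - 1‖))) atTop (𝓝 0) := by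
    simpa using h0.mul_const (‖c‖ * (2 / ‖z - 1‖))
  refine squeeze_zero_norm (fun N => ?_) h1
  rw [norm_smul, ← Finset.mul_sum, geom_sum_eq hz1, norm_mul, norm_div, norm_inv,
    Real.norm_of_nonneg (by positivity : (0:ℝ) ≤ ((N + 1 : ℕ) : ℝ))]
  gcongr
  refine (norm_sub_le _ _).trans ?_
  rw [norm_pow, hz]; norm_num

/-- Density of non-resonant indices for an irrational ratio: the set of `n` for which
`(2n+1)θ` stays at distance `> 2τ` from all odd integers has natural density `1 − 2τ`. -/
theorem density_nonresonant_indices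
    (θ : ℝ) (hθpos : 0 < θ) (hθ : Irrational θ)
    (τ : ℝ) (hτ : 0 < τ) (hτ' : τ < 1 / 2) :
    Tendsto
      (fun N : ℕ =>
        ((({n : ℕ | ∀ m : ℤ, 2 * τ < |(2 * (n : ℝ) + 1) * θ - (2 * (m : ℝ) + 1)|} ∩
          Set.Iio N).ncard : ℝ) / N))
      atTop (nhds (1 - 2 * τ)) := by
  classical
  have : Fact ((0:ℝ) < 2) := ⟨by norm_num⟩
  let x : ℕ → AddCircle (2:ℝ) := fun n => (((2 * (n : ℝ) + 1) * θ - 1 : ℝ) : AddCircle (2:ℝ))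
  let μ : MeasureTheory.ProbabilityMeasure (AddCircle (2:ℝ)) := ⟨AddCircle.haarAddCircle, inferInstance⟩
  let μs : ℕ → MeasureTheory.ProbabilityMeasure (AddCircle (2:ℝ)) :=
    fun N => ⟨empMeasure x N, inferInstance⟩
  have hlim : Tendsto μs atTop (𝓝 μ) := by
    apply weyl_aux
    intro k
    have e1 : ∀ N, ∫ y, fourier k y ∂(μs N : MeasureTheory.Measure (AddCircle (2:ℝ))) =
        ((N + 1 : ℕ) : ℝ)⁻¹ • ∑ n ∈ Finset.range (N + 1), fourier k (x n) := by
      intro N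
      change ∫ y, fourier k y ∂(empMeasure x N) = _
      rw [empMeasure, MeasureTheory.integral_smul_measure,
        MeasureTheory.integral_finsetSum_measure]
      · rw [ENNReal.toReal_inv, ENNReal.toReal_natCast]
        simp only [MeasureTheory.integral_dirac]
      · intro i _
        exact (fourier k).continuous.integrable_of_hasCompactSupport
          (HasCompactSupport.of_compactSpace _)
    have e2 : ∫ y, fourier k y ∂(μ : MeasureTheory.Measure (AddCircle (2:ℝ))) =
        if k = 0 then 1 else 0 := by
      change ∫ y, fourier k y ∂(AddCircle.haarAddCircle) = _
      have := congrFun (fourierCoeff_fourier (T := (2:ℝ)) k) 0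
      simp only [fourierCoeff, neg_zero, fourier_zero, one_smul] at this
      rw [this, Pi.single_apply]
      simp [eq_comm]
    simp only [e1, e2]
    split_ifs with hk
    · subst hk
      refine tendsto_const_nhds.congr fun N => ?_
      simp
      have : ((N:ℂ) + 1) ≠ 0 := by exact_mod_cast N.succ_ne_zero
      field_simp
    · have := geom_avg (fourier k ((2 * θ : ℝ) : AddCircle (2:ℝ)))
        (fourier k ((θ - 1 : ℝ) : AddCircle (2:ℝ))) (by rw [fourier_apply]; exact Circle.norm_coe _) (by
          rw [fourier_coe_apply, ne_eq, Complex.exp_eq_one_iff]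
          rintro ⟨n, hn⟩
          have hpi : (2 * Real.pi * Complex.I : ℂ) ≠ 0 := Complex.two_pi_I_ne_zero
          have h2 : (k : ℂ) * θ = n := by
            apply mul_left_cancel₀ hpi
            push_cast at hn
            linear_combination hn
          have h3 : (k : ℝ) * θ = n := by exact_mod_cast h2
          exact (hθ.intCast_mul hk).ne_int n h3)
      refine this.congr fun N => ?_
      congr 1
      refine Finset.sum_congr rfl fun n _ => ?_
      simp only [x, fourier_coe_apply]
      rw [← Complex.exp_nat_mul, ← Complex.exp_add]
      congr 1
      push_cast
      ring
  let E : Set (AddCircle (2:ℝ)) := (Metric.closedBall 0 (2 * τ))ᶜ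
  have hvol : (AddCircle.haarAddCircle (T := (2:ℝ))).AbsolutelyContinuous MeasureTheory.volume := by
    rw [AddCircle.volume_eq_smul_haarAddCircle]
    exact MeasureTheory.Measure.absolutelyContinuous_smul (by simp)
  have hfr : (μ : MeasureTheory.Measure (AddCircle (2:ℝ))) (frontier E) = 0 := by
    apply hvol
    rw [frontier_compl]
    refine MeasureTheory.measure_mono_null Metric.frontier_closedBall_subset_sphere ?_
    rw [← Metric.closedBall_sdiff_ball]
    exact MeasureTheory.ae_le_set.1 AddCircle.closedBall_ae_eq_ball.le
  have hE := MeasureTheory.ProbabilityMeasure.tendsto_measure_of_null_frontier_of_tendsto' hlim hfr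
  have hE2 := (ENNReal.tendsto_toReal (MeasureTheory.measure_ne_top _ _)).comp hE
  have hmE : MeasurableSet E := Metric.isClosed_closedBall.measurableSet.compl
  have hμE : ((μ : MeasureTheory.Measure (AddCircle (2:ℝ))) E).toReal = 1 - 2 * τ := by
    change (AddCircle.haarAddCircle E).toReal = _
    have hv := AddCircle.volume_closedBall 2 (x := (0 : AddCircle (2:ℝ))) (2 * τ)
    rw [AddCircle.volume_eq_smul_haarAddCircle, min_eq_right (by linarith),
      MeasureTheory.Measure.smul_apply, smul_eq_mul] at hv
    have hv2 := congrArg ENNReal.toReal hv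
    rw [ENNReal.toReal_mul, ENNReal.toReal_ofReal (by norm_num),
      ENNReal.toReal_ofReal (by positivity)] at hv2
    have := MeasureTheory.probReal_compl_eq_one_sub (μ := AddCircle.haarAddCircle (T := (2:ℝ)))
      (Metric.isClosed_closedBall (x := (0 : AddCircle (2:ℝ))) (ε := 2 * τ)).measurableSet
    simp only [MeasureTheory.measureReal_def] at this
    simp only [E, this]
    linarith
  rw [hμE] at hE2
  rw [← tendsto_add_atTop_iff_nat 1]
  refine hE2.congr fun N => ?_
  have hmem : ∀ n : ℕ, (∀ m : ℤ, 2 * τ < |(2 * (n : ℝ) + 1) * θ - (2 * (m : ℝ) + 1)|) ↔ x n ∈ E := by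
    intro n
    simp only [E, Set.mem_compl_iff, Metric.mem_closedBall, dist_zero_right, not_le, x]
    constructor
    · intro h
      rw [AddCircle.norm_eq]
      have h' := h (round ((2:ℝ)⁻¹ * ((2 * (n : ℝ) + 1) * θ - 1)))
      generalize round ((2:ℝ)⁻¹ * ((2 * (n : ℝ) + 1) * θ - 1)) = m at h' ⊢
      have e : (2 * (n : ℝ) + 1) * θ - 1 - m * 2 = (2 * (n : ℝ) + 1) * θ - (2 * m + 1) := by ring
      rwa [e]
    · intro h m
      refine h.trans_le ?_
      have e : (((2 * (n : ℝ) + 1) * θ - 1 : ℝ) : AddCircle (2:ℝ)) =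
          (((2 * (n : ℝ) + 1) * θ - (2 * m + 1) : ℝ) : AddCircle (2:ℝ)) := by
        rw [← sub_eq_zero, ← AddCircle.coe_sub, AddCircle.coe_eq_zero_iff]
        exact ⟨m, by rw [zsmul_eq_mul]; ring⟩
      rw [e]
      exact QuotientAddGroup.norm_mk_le_norm
  have hset : {n : ℕ | ∀ m : ℤ, 2 * τ < |(2 * (n : ℝ) + 1) * θ - (2 * (m : ℝ) + 1)|} ∩
      Set.Iio (N + 1) = ((Finset.range (N + 1)).filter (fun n => x n ∈ E) : Finset ℕ) := by
    ext n
    simp only [Set.mem_inter_iff, Set.mem_ofPred_eq, hmem]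
    simp [and_comm]
  rw [hset, Set.ncard_coe_finset]
  change (empMeasure x N E).toReal = _
  simp only [empMeasure, MeasureTheory.Measure.smul_apply, MeasureTheory.Measure.finsetSum_apply,
    MeasureTheory.Measure.dirac_apply' _ hmE, Set.indicator_apply, Pi.one_apply, smul_eq_mul,
    ENNReal.toReal_mul, ENNReal.toReal_inv, ENNReal.toReal_natCast]
  rw [div_eq_inv_mul]
  congr 1
  rw [← ENNReal.toReal_natCast, Finset.card_filter]
  congr 1
  push_cast
  refine Finset.sum_congr rfl fun n _ => ?_
  by_cases hn : x n ∈ E <;> simp [hn]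
end
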